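/- arXiv:2304.02164 — 3 statements merged into one kernel-verified Lean document; each statement's English description precedes it below -/
import Mathlib

section
/- For every ε > 0 there exists n₀ such that for all integers n ≥ n₀, H_n(K_{2,3}) ≤ n^{n/2} · 2^{−n/2 + εn}; that is, the maximum size of a family of Hamilton paths in K_n the union of any two of which contains K_{2,3} is at most n^{n/2} 2^{−n/2 + o(n)}. -/
open SimpleGraph

/-- `H` is contained in `G` as a subgraph:
there is an injective map preserving adjacency. -/
def ContainsCopy {W V : Type*} (H : SimpleGraph W) (G : SimpleGraph V) : Prop :=
  ∃ f : W ↪ V, ∀ ⦃a b : W⦄, H.Adj a b → G.Adj (f a) (f b)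

/-- The union of (the edge sets of) two walks in the complete graph on `Fin n`,
as a simple graph on `Fin n`. -/
def walkUnion {n : ℕ} {u v u' v' : Fin n}
    (p : (⊤ : SimpleGraph (Fin n)).Walk u v) (q : (⊤ : SimpleGraph (Fin n)).Walk u' v') :
    SimpleGraph (Fin n) :=
  (p.toSubgraph ⊔ q.toSubgraph).spanningCoe

open Filter Topology

open ArithmeticFunction in
lemma exists_continuousOn_LSeries_vonMangoldt_sub_one :
    ∃ G : ℂ → ℂ, ContinuousOn G {s | 1 ≤ s.re} ∧ ∀ s : ℂ, 1 < s.re →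
      HasSum (LSeries.term (fun n => (vonMangoldt n : ℂ) - 1) s) (G s) := by
  let Z : ℂ → ℂ := Function.update (fun s => riemannZeta s - 1 / (s - 1)) 1
    (Real.eulerMascheroniConstant : ℂ)
  have hZ : Continuous Z := by
    rw [continuous_iff_continuousAt]
    intro s
    rcases eq_or_ne s 1 with rfl | hs
    · rw [continuousAt_update_same]
      exact tendsto_riemannZeta_sub_one_div
    · rw [continuousAt_update_of_ne hs]
      have := sub_ne_zero.2 hs
      exact (differentiableAt_riemannZeta hs).continuousAt.sub (by fun_prop (disch := assumption))
  refine ⟨fun s => vonMangoldt.LFunctionResidueClassAux (1 : ZMod 1) s - Z s,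
    (vonMangoldt.continuousOn_LFunctionResidueClassAux (1 : ZMod 1)).sub hZ.continuousOn, ?_⟩
  intro s hs
  have hs1 : s ≠ 1 := by rintro rfl; simp at hs
  have h1 := vonMangoldt.eqOn_LFunctionResidueClassAux (q := 1) (a := 1) isUnit_one hs
  have h2 : (fun n : ℕ => ((vonMangoldt.residueClass (1 : ZMod 1) n : ℝ) : ℂ)) =
      fun n => (vonMangoldt n : ℂ) := by
    funext n
    simp [vonMangoldt.residueClass, Subsingleton.elim (n : ZMod 1) 1]
  have h3 : LSeriesHasSum (fun n => (vonMangoldt n : ℂ)) s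
      (LSeries (fun n => (vonMangoldt n : ℂ)) s) :=
    (LSeriesSummable_vonMangoldt hs).LSeriesHasSum
  have h4 := h3.sub (LSeriesHasSum_one hs)
  have h5 : vonMangoldt.LFunctionResidueClassAux (1 : ZMod 1) s - Z s =
      LSeries (fun n => (vonMangoldt n : ℂ)) s - riemannZeta s := by
    simp only [h1, h2, Z, Function.update_of_ne hs1]
    simp
  exact Eq.mpr (congrArg (fun z => HasSum _ z) h5) h4

noncomputable def fejer (T u : ℝ) : ℝ := if u = 0 then T else 2 * (1 - Real.cos (T * u)) / (T * u ^ 2)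

lemma fejer_nonneg {T : ℝ} (hT : 0 < T) (u : ℝ) : 0 ≤ fejer T u := by
  unfold fejer
  split_ifs
  · exact hT.le
  · have := Real.cos_le_one (T * u)
    exact div_nonneg (by linarith) (by positivity)

lemma fejer_le {T : ℝ} (hT : 0 < T) (u : ℝ) : fejer T u ≤ T := by
  unfold fejer
  split_ifs with h
  · exact le_rfl
  · have := Real.one_sub_sq_div_two_le_cos (x := T * u)
    rw [div_le_iff₀ (by positivity)]
    nlinarith

lemma fejer_le_div {T : ℝ} (hT : 0 < T) {u : ℝ} (hu : u ≠ 0) : fejer T u ≤ 4 / T * (1 / u ^ 2) := by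
  rw [fejer, if_neg hu, div_mul_div_comm, mul_one]
  have := Real.neg_one_le_cos (T * u)
  gcongr
  linarith

lemma le_fejer {T : ℝ} (hT : 0 < T) {u : ℝ} (hu : |u| ≤ 1 / T) : T / 4 ≤ fejer T u := by
  unfold fejer
  split_ifs with h
  · linarith
  · have h1 : |T * u| ≤ 1 := by
      rw [abs_mul, abs_of_pos hT]
      calc T * |u| ≤ T * (1 / T) := by gcongr
        _ = 1 := by field_simp
    have h2 := Real.cos_le_one_sub_mul_cos_sq (h1.trans (by linarith [Real.pi_gt_three]))
    rw [le_div_iff₀ (by positivity)]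
    have h3 : (1 : ℝ) / 16 ≤ 1 / Real.pi ^ 2 := by
      apply one_div_le_one_div_of_le (by positivity)
      nlinarith [Real.pi_lt_four, Real.pi_pos]
    have h4 : 2 / Real.pi ^ 2 = 2 * (1 / Real.pi ^ 2) := by ring
    rw [h4] at h2
    have : 1 / 16 * (T * u) ^ 2 ≤ 1 / Real.pi ^ 2 * (T * u) ^ 2 := by gcongr
    nlinarith

open Complex in
lemma integral_triangle_mul_exp {T : ℝ} (hT : 0 < T) (u : ℝ) :
    ∫ t in (-T)..T, ((1 - |t| / T : ℝ) : ℂ) * exp (I * t * u) = fejer T u := by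
  have hint : ∀ a b : ℝ, IntervalIntegrable
      (fun t : ℝ => ((1 - |t| / T : ℝ) : ℂ) * exp (I * t * u)) MeasureTheory.volume a b :=
    fun a b => Continuous.intervalIntegrable (by fun_prop) a b
  have hneg : ∫ t in (-T)..0, ((1 - |t| / T : ℝ) : ℂ) * exp (I * t * u) =
      ∫ t in (0 : ℝ)..T, ((1 - |t| / T : ℝ) : ℂ) * exp (I * t * (-u : ℝ)) := by
    have := intervalIntegral.integral_comp_neg
      (f := fun t : ℝ => ((1 - |t| / T : ℝ) : ℂ) * exp (I * t * (-u : ℝ))) (a := -T) (b := 0)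
    rw [neg_zero, neg_neg] at this
    rw [← this]
    simp
  rw [← intervalIntegral.integral_add_adjacent_intervals (hint _ 0) (hint 0 _), hneg]
  have habs : ∀ v : ℝ, ∫ t in (0 : ℝ)..T, ((1 - |t| / T : ℝ) : ℂ) * exp (I * t * v) =
      ∫ t in (0 : ℝ)..T, (1 - t / T : ℂ) * exp (I * t * v) := by
    intro v
    apply intervalIntegral.integral_congr
    intro t ht
    rw [Set.uIcc_of_le hT.le] at ht
    simp [abs_of_nonneg ht.1]
  have hTc : (T : ℂ) ≠ 0 := by exact_mod_cast hT.ne'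
  rcases eq_or_ne u 0 with rfl | hu
  · have : ∫ t in (0 : ℝ)..T, (1 - t / T : ℂ) = ((T / 2 : ℝ) : ℂ) := by
      have h : ∀ t : ℝ, (1 - t / T : ℂ) = ((1 - t / T : ℝ) : ℂ) := by intro t; simp
      simp_rw [h, intervalIntegral.integral_ofReal]
      congr 1
      rw [intervalIntegral.integral_sub (by simp)
        (Continuous.intervalIntegrable (by fun_prop) _ _)]
      simp only [intervalIntegral.integral_const, intervalIntegral.integral_div, integral_id,
        smul_eq_mul]
      field_simp
      ring
    rw [neg_zero, habs]
    simp only [fejer, if_true, ofReal_zero, mul_zero, exp_zero, mul_one, this]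
    push_cast
    ring
  · have key : ∀ v : ℝ, v ≠ 0 → ∫ t in (0 : ℝ)..T, (1 - t / T : ℂ) * exp (I * t * v) =
        -exp (I * T * v) / (T * v ^ 2) - 1 / (I * v) + 1 / (T * v ^ 2) := by
      intro v hv
      have hvc : (v : ℂ) ≠ 0 := by exact_mod_cast hv
      rw [intervalIntegral.integral_eq_sub_of_hasDerivAt
        (f := fun t : ℝ => (1 - t / T : ℂ) * exp (I * t * v) / (I * v) -
          exp (I * t * v) / (T * v ^ 2))]
      · simp [hTc]
        ring
      · intro t _
        have he : HasDerivAt (fun t : ℝ => exp (I * t * v)) (exp (I * t * v) * (I * v)) t := by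
          have h0 : HasDerivAt (fun t : ℝ => (I * t * v : ℂ)) (I * 1 * v) t :=
            ((hasDerivAt_id t).ofReal_comp.const_mul I).mul_const _
          simpa using h0.cexp
        have hl : HasDerivAt (fun t : ℝ => (1 - t / T : ℂ)) (-(1 / T : ℂ)) t := by
          simpa using ((hasDerivAt_id t).ofReal_comp.div_const (T : ℂ)).const_sub 1
        have := ((hl.mul he).div_const (I * v : ℂ)).sub (he.div_const (T * v ^ 2 : ℂ))
        refine this.congr_deriv ?_
        field_simp
        ring_nf
        rw [I_sq]
        ring
      · exact Continuous.intervalIntegrable (by fun_prop) _ _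
    rw [habs, habs, key u hu, key (-u) (neg_ne_zero.2 hu), fejer, if_neg hu]
    have huc : (u : ℂ) ≠ 0 := by exact_mod_cast hu
    push_cast
    rw [Complex.cos]
    have e1 : exp (T * u * I) = exp (I * T * u) := by ring_nf
    have e2 : exp (-(T * u) * I) = exp (I * T * -u) := by ring_nf
    rw [e1, e2]
    field_simp
    ring

open ArithmeticFunction Complex in
lemma hasSum_fejer {T : ℝ} (hT : 0 < T) (X : ℝ) {σ : ℝ} (hσ : 1 < σ) {G : ℂ → ℂ}
    (hG : ∀ s : ℂ, 1 < s.re →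
      HasSum (LSeries.term (fun n => (vonMangoldt n : ℂ) - 1) s) (G s)) :
    HasSum (fun n : ℕ => if n = 0 then 0 else
        (vonMangoldt n - 1) * (n : ℝ) ^ (-σ) * fejer T (Real.log n - X))
      (∫ t in (-T)..T, ((1 - |t| / T : ℝ) : ℂ) * exp (-(I * t * X)) * G (σ - I * t)).re := by
  have hre : ∀ t : ℝ, (σ - I * t : ℂ).re = σ := by intro t; simp
  have hterm : ∀ (n : ℕ) (t : ℝ), LSeries.term (fun n => (vonMangoldt n : ℂ) - 1) (σ - I * t) n =
      if n = 0 then 0 else (((vonMangoldt n - 1) * (n : ℝ) ^ (-σ) : ℝ) : ℂ) *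
        exp (I * t * Real.log n) := by
    intro n t
    rw [LSeries.term_def]
    split_ifs with hn
    · rfl
    · have hn' : (n : ℂ) ≠ 0 := by exact_mod_cast hn
      have hnpos : (0 : ℝ) < n := by exact_mod_cast Nat.pos_of_ne_zero hn
      rw [div_eq_mul_inv, ← cpow_neg, neg_sub, cpow_sub _ _ hn', cpow_def_of_ne_zero hn' (I * t),
        ← natCast_log]
      push_cast
      rw [ofReal_cpow hnpos.le, ofReal_neg, cpow_neg]
      push_cast
      rw [show Complex.log n * (I * t) = I * t * Complex.log n by ring]
      ring
  have hsum : HasSum (fun n : ℕ => ∫ t in (-T)..T, ((1 - |t| / T : ℝ) : ℂ) * exp (-(I * t * X)) *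
      LSeries.term (fun n => (vonMangoldt n : ℂ) - 1) (σ - I * t) n)
      (∫ t in (-T)..T, ((1 - |t| / T : ℝ) : ℂ) * exp (-(I * t * X)) * G (σ - I * t)) := by
    apply intervalIntegral.hasSum_integral_of_dominated_convergence
      (fun n _ => ‖LSeries.term (fun n => (vonMangoldt n : ℂ) - 1) σ n‖)
    · intro n
      apply Continuous.aestronglyMeasurable
      simp_rw [hterm]
      split_ifs <;> fun_prop
    · intro n
      refine Eventually.of_forall fun t ht => ?_
      rw [Set.uIoc_of_le (by linarith)] at ht
      have h1 : ‖((1 - |t| / T : ℝ) : ℂ)‖ ≤ 1 := by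
        rw [norm_real, Real.norm_eq_abs, abs_le]
        have h2 : |t| / T ≤ 1 := by
          rw [div_le_one hT, abs_le]
          exact ⟨ht.1.le, ht.2⟩
        have h3 : 0 ≤ |t| / T := by positivity
        constructor <;> linarith
      have h2 : ‖exp (-(I * t * X))‖ = 1 := by
        rw [show -(I * t * X) = ((-(t * X) : ℝ) : ℂ) * I by push_cast; ring]
        exact norm_exp_ofReal_mul_I _
      have h3 : ‖LSeries.term (fun n => (vonMangoldt n : ℂ) - 1) (σ - I * t) n‖ =
          ‖LSeries.term (fun n => (vonMangoldt n : ℂ) - 1) σ n‖ := by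
        rw [LSeries.norm_term_eq, LSeries.norm_term_eq, hre, ofReal_re]
      rw [norm_mul, norm_mul, h2, h3, mul_one]
      exact mul_le_of_le_one_left (norm_nonneg _) h1
    · exact Eventually.of_forall fun t _ => (hG σ (by simpa using hσ)).summable.norm
    · exact intervalIntegrable_const
    · exact Eventually.of_forall fun t _ => (hG _ (by rw [hre]; exact hσ)).mul_left _
  convert hasSum_re hsum using 1
  funext n
  simp_rw [hterm]
  split_ifs with hn
  · simp
  · have : ∀ t : ℝ, ((1 - |t| / T : ℝ) : ℂ) * exp (-(I * t * X)) *
        ((((vonMangoldt n - 1) * (n : ℝ) ^ (-σ) : ℝ) : ℂ) * exp (I * t * Real.log n)) =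
        (((vonMangoldt n - 1) * (n : ℝ) ^ (-σ) : ℝ) : ℂ) *
          (((1 - |t| / T : ℝ) : ℂ) * exp (I * t * (Real.log n - X : ℝ))) := by
      intro t
      have : exp (I * t * (Real.log n - X : ℝ)) =
          exp (-(I * t * X)) * exp (I * t * Real.log n) := by
        rw [← exp_add]
        push_cast
        ring_nf
      rw [this]
      ring
    simp_rw [this]
    rw [intervalIntegral.integral_const_mul, integral_triangle_mul_exp hT, ← ofReal_mul, ofReal_re]

open ArithmeticFunction in
lemma sum_vonMangoldt_div_sq_le : ∃ C : ℝ, 0 < C ∧ ∀ (X δ σ : ℝ) (F : Finset ℕ),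
    0 < δ → δ ≤ 1 → 1 ≤ σ → (∀ n ∈ F, n ≠ 0 ∧ δ < |Real.log n - X|) →
    ∑ n ∈ F, vonMangoldt n * (n : ℝ) ^ (-σ) * (1 / (Real.log n - X) ^ 2) ≤ C / δ ^ 2 := by
  have hsummable : Summable (fun j : ℤ => 1 / (1 + (j : ℝ) ^ 2)) := by
    have h := Real.summable_one_div_int_pow (p := 2) |>.2 (by norm_num)
    refine Summable.of_norm_bounded_eventually h ?_
    filter_upwards [Set.Finite.compl_mem_cofinite (Set.finite_singleton (0 : ℤ))] with j hj
    have hj' : (j : ℝ) ≠ 0 := by exact_mod_cast hj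
    rw [Real.norm_of_nonneg (by positivity)]
    apply one_div_le_one_div_of_le (by positivity)
    linarith
  set S := ∑' j : ℤ, 1 / (1 + (j : ℝ) ^ 2)
  set C0 : ℝ := Real.log 4 + 4
  have hC0 : 0 < C0 := by
    have : 0 < Real.log 4 := Real.log_pos (by norm_num)
    positivity
  have hS : 0 < S := by
    refine hsummable.tsum_pos (fun j => by positivity) 0 (by simp)
  refine ⟨5 * C0 * Real.exp 1 * S, by positivity, ?_⟩
  intro X δ σ F hδ hδ1 hσ hF
  classical
  let j : ℕ → ℤ := fun n => ⌊Real.log n - X⌋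
  have hcell : ∀ i : ℤ, ∑ n ∈ F with j n = i, vonMangoldt n * (n : ℝ) ^ (-σ) ≤
      C0 * Real.exp 1 := by
    intro i
    have h1 : ∀ n ∈ F.filter (fun n => j n = i), vonMangoldt n * (n : ℝ) ^ (-σ) ≤
        vonMangoldt n * Real.exp (-(X + i)) := by
      intro n hn
      rw [Finset.mem_filter] at hn
      have hn0 : (0 : ℝ) < n := by exact_mod_cast Nat.pos_of_ne_zero (hF n hn.1).1
      have hn1 : (1 : ℝ) ≤ n := by exact_mod_cast Nat.pos_of_ne_zero (hF n hn.1).1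
      have h2 : (i : ℝ) ≤ Real.log n - X := by rw [← hn.2]; exact Int.floor_le _
      refine mul_le_mul_of_nonneg_left ?_ vonMangoldt_nonneg
      calc (n : ℝ) ^ (-σ) ≤ (n : ℝ) ^ (-1 : ℝ) :=
            Real.rpow_le_rpow_of_exponent_le hn1 (by linarith)
        _ = Real.exp (-Real.log n) := by
            rw [Real.rpow_neg_one, Real.exp_neg, Real.exp_log hn0]
        _ ≤ _ := Real.exp_le_exp.2 (by linarith)
    have h2 : ∑ n ∈ F with j n = i, vonMangoldt n ≤ Chebyshev.psi (Real.exp (X + i + 1)) := by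
      rw [Chebyshev.psi]
      refine Finset.sum_le_sum_of_subset_of_nonneg ?_ (fun _ _ _ => vonMangoldt_nonneg)
      intro n hn
      rw [Finset.mem_filter] at hn
      have hn0 : (0 : ℝ) < n := by exact_mod_cast Nat.pos_of_ne_zero (hF n hn.1).1
      have h2 : Real.log n - X < i + 1 := by rw [← hn.2]; exact Int.lt_floor_add_one _
      rw [Finset.mem_Ioc]
      refine ⟨Nat.pos_of_ne_zero (hF n hn.1).1, Nat.le_floor ?_⟩
      rw [← Real.exp_log hn0]
      exact Real.exp_le_exp.2 (by linarith)
    calc _ ≤ ∑ n ∈ F with j n = i, vonMangoldt n * Real.exp (-(X + i)) := Finset.sum_le_sum h1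
      _ = (∑ n ∈ F with j n = i, vonMangoldt n) * Real.exp (-(X + i)) := by rw [Finset.sum_mul]
      _ ≤ (C0 * Real.exp (X + i + 1)) * Real.exp (-(X + i)) := by
          gcongr
          exact h2.trans (Chebyshev.psi_le_const_mul_self (Real.exp_pos _).le)
      _ = C0 * Real.exp 1 := by
          rw [mul_assoc, ← Real.exp_add]
          congr 2
          ring
  have hpt : ∀ n ∈ F, 1 / (Real.log n - X) ^ 2 ≤ 5 / δ ^ 2 * (1 / (1 + (j n : ℝ) ^ 2)) := by
    intro n hn
    have hu := (hF n hn).2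
    set u := Real.log n - X
    have h1 : (j n : ℝ) ≤ u := Int.floor_le _
    have h2 : u < j n + 1 := Int.lt_floor_add_one _
    have h3 : |(j n : ℝ)| ≤ |u| + 1 := by
      rw [abs_le]
      constructor <;> linarith [le_abs_self u, neg_abs_le u]
    have h4 : (j n : ℝ) ^ 2 ≤ (|u| + 1) ^ 2 := by
      rw [← sq_abs]
      gcongr
    have hu2 : δ ^ 2 < u ^ 2 := by
      rw [← sq_abs u]
      gcongr
    have hupos : 0 < u ^ 2 := lt_trans (by positivity) hu2
    have h5 : (1 + (j n : ℝ) ^ 2) * δ ^ 2 ≤ 5 * u ^ 2 := by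
      have h6 : 1 + (j n : ℝ) ^ 2 ≤ 3 + 2 * u ^ 2 := by
        have := sq_abs u
        nlinarith [sq_nonneg (|u| - 1)]
      have h7 : δ ^ 2 ≤ 1 := by nlinarith
      nlinarith
    rw [div_mul_div_comm, mul_one, div_le_div_iff₀ hupos (by positivity)]
    linarith
  calc ∑ n ∈ F, vonMangoldt n * (n : ℝ) ^ (-σ) * (1 / (Real.log n - X) ^ 2)
      ≤ ∑ n ∈ F, vonMangoldt n * (n : ℝ) ^ (-σ) * (5 / δ ^ 2 * (1 / (1 + (j n : ℝ) ^ 2))) := by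
        refine Finset.sum_le_sum fun n hn => mul_le_mul_of_nonneg_left (hpt n hn) ?_
        exact mul_nonneg vonMangoldt_nonneg (by positivity)
    _ = ∑ i ∈ F.image j, ∑ n ∈ F with j n = i,
          vonMangoldt n * (n : ℝ) ^ (-σ) * (5 / δ ^ 2 * (1 / (1 + (j n : ℝ) ^ 2))) :=
        (Finset.sum_fiberwise_of_maps_to (fun n hn => Finset.mem_image_of_mem j hn) _).symm
    _ = ∑ i ∈ F.image j, (∑ n ∈ F with j n = i, vonMangoldt n * (n : ℝ) ^ (-σ)) *
          (5 / δ ^ 2 * (1 / (1 + (i : ℝ) ^ 2))) := by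
        refine Finset.sum_congr rfl fun i _ => ?_
        rw [Finset.sum_mul]
        refine Finset.sum_congr rfl fun n hn => ?_
        rw [(Finset.mem_filter.1 hn).2]
    _ ≤ ∑ i ∈ F.image j, (C0 * Real.exp 1) * (5 / δ ^ 2 * (1 / (1 + (i : ℝ) ^ 2))) := by
        refine Finset.sum_le_sum fun i _ => mul_le_mul_of_nonneg_right (hcell i) (by positivity)
    _ = (C0 * Real.exp 1) * (5 / δ ^ 2) * ∑ i ∈ F.image j, 1 / (1 + (i : ℝ) ^ 2) := by
        rw [Finset.mul_sum]
        exact Finset.sum_congr rfl fun i _ => by ring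
    _ ≤ (C0 * Real.exp 1) * (5 / δ ^ 2) * S := by
        gcongr
        exact hsummable.sum_le_tsum _ (fun i _ => by positivity)
    _ = _ := by ring

open Complex in
lemma tendsto_integral_triangle_mul {T : ℝ} {g : ℝ → ℂ} :
    Tendsto (fun X : ℝ => ∫ t in (-T)..T, ((1 - |t| / T : ℝ) : ℂ) * exp (-(I * t * X)) * g t)
      atTop (𝓝 0) := by
  have key : ∀ (s : Set ℝ), MeasurableSet s →
      Tendsto (fun X : ℝ => ∫ t in s, ((1 - |t| / T : ℝ) : ℂ) * exp (-(I * t * X)) * g t)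
      atTop (𝓝 0) := by
    intro s hs
    have h := (Real.tendsto_integral_exp_smul_cocompact
      (s.indicator (fun t => ((1 - |t| / T : ℝ) : ℂ) * g t))).comp
      (tendsto_id.mono_left (atTop_le_cocompact (α := ℝ)))
    have hscale : Tendsto (fun X : ℝ => X / (2 * Real.pi)) atTop atTop :=
      tendsto_id.atTop_div_const (by positivity)
    refine (h.comp hscale).congr fun X => ?_
    rw [← MeasureTheory.integral_indicator hs]
    refine MeasureTheory.integral_congr_ae (Eventually.of_forall fun t => ?_)
    by_cases ht : t ∈ s
    · simp only [Set.indicator_of_mem ht, id, Circle.smul_def, Real.fourierChar_apply,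
        smul_eq_mul]
      have : (2 * Real.pi * -(t * (X / (2 * Real.pi))) : ℝ) = -(t * X) := by
        have := Real.pi_ne_zero
        field_simp
      rw [this]
      push_cast
      rw [show -(t * X : ℂ) * I = -(I * t * X) by ring]
      ring
    · simp [Set.indicator_of_notMem ht]
  simp_rw [intervalIntegral.intervalIntegral_eq_integral_uIoc]
  simpa using (key _ measurableSet_uIoc).const_smul (if -T ≤ T then (1 : ℝ) else -1)

open Complex in
lemma tendsto_integral_triangle_nhdsGT {T : ℝ} (X : ℝ) {G : ℂ → ℂ}
    (hG : ContinuousOn G {s | 1 ≤ s.re}) :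
    Tendsto (fun σ : ℝ => ∫ t in (-T)..T, ((1 - |t| / T : ℝ) : ℂ) * exp (-(I * t * X)) *
      G (σ - I * t)) (𝓝[>] 1)
      (𝓝 (∫ t in (-T)..T, ((1 - |t| / T : ℝ) : ℂ) * exp (-(I * t * X)) * G (1 - I * t))) := by
  have hc : Continuous (fun z : ℝ × ℝ => G ((max z.1 1 : ℝ) - I * z.2)) := by
    refine hG.comp_continuous (by fun_prop) fun z => ?_
    simp
  have h := intervalIntegral.continuous_parametric_intervalIntegral_of_continuous'
    (μ := MeasureTheory.volume)
    (f := fun (σ t : ℝ) => ((1 - |t| / T : ℝ) : ℂ) * exp (-(I * t * X)) *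
      G ((max σ 1 : ℝ) - I * t)) (by
        refine Continuous.mul (by fun_prop) ?_
        exact hc) (-T) T
  have h1 := (h.tendsto 1).mono_left (nhdsWithin_le_nhds (s := Set.Ioi 1))
  simp only [max_self, ofReal_one] at h1
  refine h1.congr' ?_
  filter_upwards [self_mem_nhdsWithin] with σ hσ
  rw [max_eq_left (le_of_lt hσ)]

open ArithmeticFunction in
lemma exists_le_sum_vonMangoldt_div {δ : ℝ} (hδ : 0 < δ) (hδ1 : δ ≤ 1) :
    ∃ c : ℝ, 0 < c ∧ ∀ᶠ X : ℝ in atTop,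
      c ≤ ∑ n ∈ (Finset.Icc 1 ⌊Real.exp (X + δ)⌋₊).filter (fun n : ℕ => X - δ ≤ Real.log n),
        vonMangoldt n * (n : ℝ)⁻¹ := by
  obtain ⟨G, hGc, hGs⟩ := exists_continuousOn_LSeries_vonMangoldt_sub_one
  obtain ⟨C, hC, htail⟩ := sum_vonMangoldt_div_sq_le
  obtain ⟨T, hT2, hTδ, hTC⟩ : ∃ T : ℝ, 2 ≤ T ∧ 1 / δ ≤ T ∧ 64 * C / δ ^ 2 ≤ T :=
    ⟨max 2 (max (1 / δ) (64 * C / δ ^ 2)), by simp, by simp, by simp⟩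
  have hT : 0 < T := by linarith
  have hTδ' : 1 / T ≤ δ := by
    rw [div_le_iff₀ hδ] at hTδ
    rw [div_le_iff₀ hT]
    linarith
  refine ⟨1 / (16 * T), by positivity, ?_⟩
  have hRL := (tendsto_integral_triangle_mul (T := T) (g := fun t => G (1 - Complex.I * t)))
  have hRL' : ∀ᶠ X : ℝ in atTop, -(1 / 16) ≤ (∫ t in (-T)..T, ((1 - |t| / T : ℝ) : ℂ) *
      Complex.exp (-(Complex.I * t * X)) * G (1 - Complex.I * t)).re := by
    have := (Complex.continuous_re.tendsto _).comp hRL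
    rw [Complex.zero_re] at this
    exact this.eventually (eventually_ge_nhds (by norm_num))
  have hexp : ∀ᶠ X : ℝ in atTop, T / 4 * Real.exp (-X) ≤ 1 / 16 := by
    have := (Real.tendsto_exp_neg_atTop_nhds_zero).const_mul (T / 4)
    rw [mul_zero] at this
    exact this.eventually (eventually_le_nhds (by norm_num))
  filter_upwards [hRL', hexp] with X hX1 hX2
  set W := Finset.filter (fun n : ℕ => X - δ ≤ Real.log n) (Finset.Icc 1 ⌊Real.exp (X + δ)⌋₊)
    with hW
  set N := Finset.Icc ⌈Real.exp (X - 1 / T)⌉₊ ⌊Real.exp (X + 1 / T)⌋₊ with hN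
  have hN0 : ∀ n ∈ N, (0 : ℝ) < n ∧ X - 1 / T ≤ Real.log n ∧ Real.log n ≤ X + 1 / T := by
    intro n hn
    rw [hN, Finset.mem_Icc, Nat.ceil_le, Nat.le_floor_iff (Real.exp_pos _).le] at hn
    have hpos : (0 : ℝ) < n := (Real.exp_pos _).trans_le hn.1
    exact ⟨hpos, (Real.le_log_iff_exp_le hpos).2 hn.1, (Real.log_le_iff_le_exp hpos).2 hn.2⟩
  have hNpos : ∀ n ∈ N, n ≠ 0 := fun n hn => by exact_mod_cast (hN0 n hn).1.ne'
  have hσ : ∀ σ : ℝ, 1 < σ → T / 4 * ∑ n ∈ N, (n : ℝ) ^ (-σ) - 1 / 16 +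
      (∫ t in (-T)..T, ((1 - |t| / T : ℝ) : ℂ) * Complex.exp (-(Complex.I * t * X)) *
        G (σ - Complex.I * t)).re ≤ T * ∑ n ∈ W, vonMangoldt n * (n : ℝ) ^ (-σ) := by
    intro σ hσ
    have hS := hasSum_fejer hT X hσ hGs
    rw [← le_sub_iff_add_le']
    refine le_of_tendsto hS ?_
    filter_upwards [eventually_ge_atTop (W ∪ N)] with F hF
    have hWF : W ⊆ F.filter (fun n => n ≠ 0) := by
      intro n hn
      rw [Finset.mem_filter]
      refine ⟨hF (Finset.mem_union_left _ hn), ?_⟩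
      have := (Finset.mem_Icc.1 (Finset.mem_filter.1 hn).1).1
      lia
    have hNF : N ⊆ F.filter (fun n => n ≠ 0) := fun n hn =>
      Finset.mem_filter.2 ⟨hF (Finset.mem_union_right _ hn), hNpos n hn⟩
    have hk := fun n : ℕ => fejer_nonneg hT (Real.log n - X)
    have e1 : ∑ n ∈ F, (if n = 0 then 0 else
        (vonMangoldt n - 1) * (n : ℝ) ^ (-σ) * fejer T (Real.log n - X)) =
        ∑ n ∈ F with n ≠ 0, vonMangoldt n * (n : ℝ) ^ (-σ) * fejer T (Real.log n - X) -
        ∑ n ∈ F with n ≠ 0, (n : ℝ) ^ (-σ) * fejer T (Real.log n - X) := by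
      rw [← Finset.sum_sub_distrib, Finset.sum_filter]
      refine Finset.sum_congr rfl fun n _ => ?_
      by_cases h : n = 0
      · simp [h]
      · simp only [h, if_false, ne_eq, not_false_eq_true, if_true]
        ring
    have e2 : T / 4 * ∑ n ∈ N, (n : ℝ) ^ (-σ) ≤
        ∑ n ∈ F with n ≠ 0, (n : ℝ) ^ (-σ) * fejer T (Real.log n - X) := by
      refine le_trans ?_ (Finset.sum_le_sum_of_subset_of_nonneg hNF
        fun n _ _ => mul_nonneg (by positivity) (hk n))
      rw [Finset.mul_sum]
      refine Finset.sum_le_sum fun n hn => ?_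
      rw [mul_comm]
      refine mul_le_mul_of_nonneg_left (le_fejer hT ?_) (by positivity)
      obtain ⟨_, h1, h2⟩ := hN0 n hn
      rw [abs_le]
      constructor <;> linarith
    have e3 : ∑ n ∈ W, vonMangoldt n * (n : ℝ) ^ (-σ) * fejer T (Real.log n - X) ≤
        T * ∑ n ∈ W, vonMangoldt n * (n : ℝ) ^ (-σ) := by
      rw [Finset.mul_sum]
      refine Finset.sum_le_sum fun n _ => ?_
      rw [mul_comm T]
      exact mul_le_mul_of_nonneg_left (fejer_le hT _)
        (mul_nonneg vonMangoldt_nonneg (by positivity))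
    have hout : ∀ n ∈ F.filter (fun n => n ≠ 0) \ W, n ≠ 0 ∧ δ < |Real.log n - X| := by
      intro n hn
      rw [Finset.mem_sdiff, Finset.mem_filter] at hn
      refine ⟨hn.1.2, ?_⟩
      by_contra! h
      rw [abs_le] at h
      have hpos : (0 : ℝ) < n := by exact_mod_cast Nat.pos_of_ne_zero hn.1.2
      refine hn.2 (Finset.mem_filter.2 ⟨Finset.mem_Icc.2 ⟨Nat.pos_of_ne_zero hn.1.2, ?_⟩, ?_⟩)
      · exact Nat.le_floor ((Real.log_le_iff_le_exp hpos).1 (by linarith))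
      · linarith
    have e4 : ∑ n ∈ F.filter (fun n => n ≠ 0) \ W,
        vonMangoldt n * (n : ℝ) ^ (-σ) * fejer T (Real.log n - X) ≤ 1 / 16 := by
      calc _ ≤ ∑ n ∈ F.filter (fun n => n ≠ 0) \ W, 4 / T *
            (vonMangoldt n * (n : ℝ) ^ (-σ) * (1 / (Real.log n - X) ^ 2)) := by
            refine Finset.sum_le_sum fun n hn => ?_
            have hne : Real.log n - X ≠ 0 := by
              intro h
              have := (hout n hn).2
              rw [h, abs_zero] at this
              linarith
            have := mul_le_mul_of_nonneg_left (fejer_le_div hT hne)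
              (mul_nonneg (vonMangoldt_nonneg (n := n))
                (by positivity : 0 ≤ (n : ℝ) ^ (-σ)))
            linarith
        _ ≤ 4 / T * (C / δ ^ 2) := by
            rw [← Finset.mul_sum]
            gcongr
            exact htail X δ σ _ hδ hδ1 hσ.le hout
        _ ≤ 1 / 16 := by
            rw [div_mul_eq_mul_div, div_le_iff₀ hT]
            have : 64 * C / δ ^ 2 = 64 * (C / δ ^ 2) := by ring
            linarith
    have e5 := Finset.sum_sdiff hWF
      (f := fun n : ℕ => vonMangoldt n * (n : ℝ) ^ (-σ) * fejer T (Real.log n - X))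
    rw [e1]
    linarith
  have hlim1 : Tendsto (fun σ : ℝ => T * ∑ n ∈ W, vonMangoldt n * (n : ℝ) ^ (-σ)) (𝓝[>] 1)
      (𝓝 (T * ∑ n ∈ W, vonMangoldt n * (n : ℝ) ^ (-1 : ℝ))) := by
    refine Tendsto.mono_left ?_ (nhdsWithin_le_nhds)
    refine ((tendsto_finsetSum _ fun n hn => ?_)).const_mul T
    have hn0 : (n : ℝ) ≠ 0 := by
      have := (Finset.mem_Icc.1 (Finset.mem_filter.1 hn).1).1
      positivity
    exact ((Real.continuous_const_rpow hn0).comp continuous_neg).tendsto 1 |>.const_mul _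
  have hlim2 : Tendsto (fun σ : ℝ => T / 4 * ∑ n ∈ N, (n : ℝ) ^ (-σ)) (𝓝[>] 1)
      (𝓝 (T / 4 * ∑ n ∈ N, (n : ℝ) ^ (-1 : ℝ))) := by
    refine Tendsto.mono_left ?_ (nhdsWithin_le_nhds)
    refine ((tendsto_finsetSum _ fun n hn => ?_)).const_mul _
    exact ((Real.continuous_const_rpow (hN0 n hn).1.ne').comp continuous_neg).tendsto 1
  have hlim3 := (Complex.continuous_re.tendsto _).comp
    (tendsto_integral_triangle_nhdsGT (T := T) X hGc)
  have hfin := le_of_tendsto_of_tendsto ((hlim2.sub_const (1 / 16)).add hlim3) hlim1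
    (by filter_upwards [self_mem_nhdsWithin] with σ h using hσ σ h)
  simp only [Real.rpow_neg_one] at hfin
  have hnear : 1 / T - Real.exp (-X) ≤ ∑ n ∈ N, (n : ℝ)⁻¹ := by
    have hcard : Real.exp (X + 1 / T) - Real.exp (X - 1 / T) - 1 ≤ (N.card : ℝ) := by
      rw [hN, Nat.card_Icc]
      have h1 := Nat.lt_floor_add_one (Real.exp (X + 1 / T))
      have h2 := Nat.ceil_lt_add_one (Real.exp_pos (X - 1 / T)).le
      have h3 : ((⌊Real.exp (X + 1 / T)⌋₊ + 1 : ℕ) : ℝ) - (⌈Real.exp (X - 1 / T)⌉₊ : ℕ) ≤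
          ((⌊Real.exp (X + 1 / T)⌋₊ + 1 - ⌈Real.exp (X - 1 / T)⌉₊ : ℕ) : ℝ) := by
        rw [sub_le_iff_le_add]
        exact_mod_cast le_tsub_add
      push_cast at h3
      linarith
    have hle : (N.card : ℝ) * Real.exp (-(X + 1 / T)) ≤ ∑ n ∈ N, (n : ℝ)⁻¹ := by
      rw [← nsmul_eq_mul]
      refine Finset.card_nsmul_le_sum _ _ _ fun n hn => ?_
      obtain ⟨h0, _, h2⟩ := hN0 n hn
      rw [show (n : ℝ)⁻¹ = Real.exp (-Real.log n) by rw [Real.exp_neg, Real.exp_log h0]]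
      exact Real.exp_le_exp.2 (by linarith)
    have h1 : (Real.exp (X + 1 / T) - Real.exp (X - 1 / T) - 1) * Real.exp (-(X + 1 / T)) =
        1 - Real.exp (-(2 / T)) - Real.exp (-X) * Real.exp (-(1 / T)) := by
      have e1 : Real.exp (X + 1 / T) * Real.exp (-(X + 1 / T)) = 1 := by
        rw [← Real.exp_add, add_neg_cancel, Real.exp_zero]
      have e2 : Real.exp (X - 1 / T) * Real.exp (-(X + 1 / T)) = Real.exp (-(2 / T)) := by
        rw [← Real.exp_add]
        congr 1
        ring
      have e3 : Real.exp (-(X + 1 / T)) = Real.exp (-X) * Real.exp (-(1 / T)) := by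
        rw [← Real.exp_add, neg_add]
      rw [sub_mul, sub_mul, e1, e2, one_mul, e3]
    have h2 : Real.exp (-(1 / T)) ≤ 1 := Real.exp_le_one_iff.2 (by simp [hT.le])
    have h3 : Real.exp (-(2 / T)) ≤ 1 - 1 / T := by
      have ha : 0 < 1 + 2 / T := by positivity
      have : Real.exp (-(2 / T)) ≤ 1 / (1 + 2 / T) := by
        rw [Real.exp_neg, ← one_div]
        apply one_div_le_one_div_of_le ha
        linarith [Real.add_one_le_exp (2 / T)]
      refine this.trans ?_
      have h4 : 2 / T = 2 * (1 / T) := by ring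
      have h5 : 1 / T ≤ 1 / 2 := one_div_le_one_div_of_le (by norm_num) hT2
      have h6 : 0 < 1 / T := by positivity
      rw [div_le_iff₀ ha, h4]
      nlinarith
    have h4 := mul_le_mul_of_nonneg_right hcard (Real.exp_pos (-(X + 1 / T))).le
    have h5 : Real.exp (-X) * Real.exp (-(1 / T)) ≤ Real.exp (-X) :=
      mul_le_of_le_one_right (Real.exp_pos _).le h2
    linarith
  have h6 := mul_le_mul_of_nonneg_left hnear (by positivity : 0 ≤ T / 4)
  have h7 : T / 4 * (1 / T - Real.exp (-X)) = 1 / 4 - T / 4 * Real.exp (-X) := by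
    field_simp
  rw [div_le_iff₀ (by positivity)]
  linarith

open ArithmeticFunction in
lemma eventually_exists_prime_log_mem {δ : ℝ} (hδ : 0 < δ) (hδ1 : δ ≤ 1) :
    ∀ᶠ X : ℝ in atTop, ∃ p : ℕ, p.Prime ∧ X - δ ≤ Real.log p ∧ Real.log p ≤ X + δ := by
  obtain ⟨c, hc, hW⟩ := exists_le_sum_vonMangoldt_div hδ hδ1
  obtain ⟨C, hC⟩ := Chebyshev.psi_sub_theta_le_mul_sqrt
  have hlim : Tendsto (fun X : ℝ => C * Real.exp (3 / 2 * δ - X / 2)) atTop (𝓝 (C * 0)) := by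
    refine (Real.tendsto_exp_atBot.comp ?_).const_mul C
    exact tendsto_atBot_add_const_left _ _
      (tendsto_neg_atTop_atBot.comp (tendsto_id.atTop_div_const (by norm_num : (0 : ℝ) < 2)))
  rw [mul_zero] at hlim
  filter_upwards [hW, hlim.eventually (eventually_lt_nhds hc)] with X hX1 hX2
  by_contra! hno
  refine absurd (hX1.trans ?_) (not_le.2 hX2)
  have hmem : ∀ n ∈ (Finset.Icc 1 ⌊Real.exp (X + δ)⌋₊).filter (fun n : ℕ => X - δ ≤ Real.log n),
      (0 : ℝ) < n ∧ X - δ ≤ Real.log n ∧ ¬ n.Prime := by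
    intro n hn
    rw [Finset.mem_filter, Finset.mem_Icc, Nat.le_floor_iff (Real.exp_pos _).le] at hn
    have h0 : (0 : ℝ) < n := by exact_mod_cast hn.1.1
    refine ⟨h0, hn.2, fun hp => ?_⟩
    exact absurd ((Real.log_le_iff_le_exp h0).2 hn.1.2) (not_le.2 (hno n hp hn.2))
  calc _ ≤ ∑ n ∈ (Finset.Icc 1 ⌊Real.exp (X + δ)⌋₊).filter
          (fun n : ℕ => X - δ ≤ Real.log n), vonMangoldt n * Real.exp (-(X - δ)) := by
        refine Finset.sum_le_sum fun n hn => ?_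
        obtain ⟨h0, h1, -⟩ := hmem n hn
        refine mul_le_mul_of_nonneg_left ?_ vonMangoldt_nonneg
        rw [show (n : ℝ)⁻¹ = Real.exp (-Real.log n) by rw [Real.exp_neg, Real.exp_log h0]]
        exact Real.exp_le_exp.2 (by linarith)
    _ ≤ ∑ n ∈ Finset.Ioc 0 ⌊Real.exp (X + δ)⌋₊ with ¬ n.Prime,
          vonMangoldt n * Real.exp (-(X - δ)) := by
        refine Finset.sum_le_sum_of_subset_of_nonneg (fun n hn => ?_)
          fun n _ _ => mul_nonneg vonMangoldt_nonneg (Real.exp_pos _).le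
        have h1 := Finset.mem_Icc.1 (Finset.mem_filter.1 hn).1
        exact Finset.mem_filter.2 ⟨Finset.mem_Ioc.2 h1, (hmem n hn).2.2⟩
    _ ≤ C * √(Real.exp (X + δ)) * Real.exp (-(X - δ)) := by
        rw [← Finset.sum_mul, ← Chebyshev.psi_sub_theta_eq_sum_not_prime]
        gcongr
        exact hC _
    _ = C * Real.exp (3 / 2 * δ - X / 2) := by
        rw [mul_assoc, Real.sqrt_eq_rpow, ← Real.exp_mul, ← Real.exp_add]
        congr 2
        ring

lemma eventually_exists_prime_le_mul {δ : ℝ} (hδ : 0 < δ) :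
    ∀ᶠ x : ℝ in atTop, ∃ p : ℕ, p.Prime ∧ x ≤ p ∧ (p : ℝ) ≤ (1 + δ) * x := by
  have hr : 0 < Real.log (1 + δ) := Real.log_pos (by linarith)
  obtain ⟨r, hr0, hr1, hr2⟩ : ∃ r : ℝ, 0 < r ∧ r ≤ 1 ∧ 2 * r ≤ Real.log (1 + δ) :=
    ⟨min (Real.log (1 + δ) / 2) 1, lt_min (by linarith) one_pos, min_le_right _ _,
      by linarith [min_le_left (Real.log (1 + δ) / 2) 1]⟩
  have h := (tendsto_atTop_add_const_right _ r Real.tendsto_log_atTop).eventually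
    (eventually_exists_prime_log_mem hr0 hr1)
  filter_upwards [h, eventually_gt_atTop 0] with x ⟨p, hp, h1, h2⟩ hx
  have hp0 : (0 : ℝ) < p := by exact_mod_cast hp.pos
  refine ⟨p, hp, (Real.log_le_log_iff hx hp0).1 (by linarith), ?_⟩
  refine (Real.log_le_log_iff hp0 (by positivity)).1 ?_
  rw [Real.log_mul (by positivity) hx.ne']
  linarith

lemma card_nonzero_squares {F : Type*} [Field F] [Fintype F] [DecidableEq F] (h2 : (2 : F) ≠ 0) :
    2 * Fintype.card {s : F // s ≠ 0 ∧ IsSquare s} + 1 = Fintype.card F := by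
  classical
  have h := Finset.card_eq_sum_card_fiberwise (s := Finset.univ.filter (fun u : F => u ≠ 0))
    (t := Finset.univ.filter (fun s : F => s ≠ 0 ∧ IsSquare s)) (f := fun u => u * u) (by
      intro u hu
      simp only [Finset.coe_filter, Finset.mem_univ, true_and, Set.mem_ofPred_eq] at hu ⊢
      exact ⟨mul_self_ne_zero.2 hu, u, rfl⟩)
  have hf : ∀ s ∈ Finset.univ.filter (fun s : F => s ≠ 0 ∧ IsSquare s),
      ((Finset.univ.filter (fun u : F => u ≠ 0)).filter (fun u => u * u = s)).card = 2 := by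
    intro s hs
    obtain ⟨hs0, r, rfl⟩ := (Finset.mem_filter.1 hs).2
    have hr : r ≠ 0 := mul_self_ne_zero.1 hs0
    have hne : r ≠ -r := by
      intro h
      have : 2 * r = 0 := by linear_combination h
      exact (mul_ne_zero h2 hr) this
    rw [← Finset.card_pair hne]
    congr 1
    ext u
    simp only [Finset.mem_filter, Finset.mem_univ, true_and, Finset.mem_insert,
      Finset.mem_singleton, mul_self_eq_mul_self_iff]
    constructor
    · exact fun h => h.2
    · rintro (rfl | rfl) <;> simp [hr]
  rw [Finset.sum_congr rfl hf, Finset.sum_const, smul_eq_mul, Finset.filter_ne',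
    Finset.card_erase_of_mem (Finset.mem_univ _), Finset.card_univ] at h
  rw [Fintype.card_subtype]
  have := Fintype.card_pos (α := F)
  lia

/-- The relation `(x + a) ^ 2 = s * t` between the pairs `(a, s)` and `(x, t)`. -/
def squareRel {F : Type*} [Field F] (v w : F × {s : F // s ≠ 0 ∧ IsSquare s}) : Prop :=
  (w.1 + v.1) ^ 2 = v.2.1 * w.2.1

lemma squareRel_symm {F : Type*} [Field F] {v w : F × {s : F // s ≠ 0 ∧ IsSquare s}}
    (h : squareRel v w) :
    squareRel w v := by
  unfold squareRel at *
  rw [add_comm, h, mul_comm]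

lemma squareRel_snd_eq {F : Type*} [Field F]
    {v w w' : F × {s : F // s ≠ 0 ∧ IsSquare s}} (h : squareRel v w)
    (h' : squareRel v w') (hw : w.1 = w'.1) : w = w' := by
  unfold squareRel at *
  refine Prod.ext hw (Subtype.ext ?_)
  refine mul_left_cancel₀ v.2.2.1 ?_
  rw [← h, ← h', hw]

open Classical in
lemma card_squareRel {F : Type*} [Field F] [Fintype F] [DecidableEq F]
    (v : F × {s : F // s ≠ 0 ∧ IsSquare s}) :
    (Finset.univ.filter (squareRel v)).card + 1 = Fintype.card F := by
  have h : (Finset.univ.filter (squareRel v)).card = (Finset.univ.erase (-v.1)).card := by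
    refine Finset.card_bij (fun w _ => w.1) ?_ ?_ ?_
    · intro w hw
      simp only [Finset.mem_erase, Finset.mem_univ, and_true]
      intro h
      have hw := (Finset.mem_filter.1 hw).2
      unfold squareRel at hw
      rw [h, neg_add_cancel, zero_pow two_ne_zero, eq_comm] at hw
      exact mul_ne_zero v.2.2.1 w.2.2.1 hw
    · intro w hw w' hw' h
      exact squareRel_snd_eq (Finset.mem_filter.1 hw).2 (Finset.mem_filter.1 hw').2 h
    · intro x hx
      have hx : x + v.1 ≠ 0 := fun h => (Finset.mem_erase.1 hx).1 (eq_neg_of_add_eq_zero_left h)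
      obtain ⟨a, s, hs, r, rfl⟩ := v
      have hr : r ≠ 0 := mul_self_ne_zero.1 hs
      refine ⟨(x, ⟨((x + a) / r) * ((x + a) / r), mul_self_ne_zero.2 (div_ne_zero hx hr), _, rfl⟩),
        ?_, rfl⟩
      simp only [Finset.mem_filter, Finset.mem_univ, true_and, squareRel]
      field_simp
  rw [h, Finset.card_erase_add_one (Finset.mem_univ _), Finset.card_univ]

open Classical in
lemma card_squareRel_inter_le {F : Type*} [Field F] [Fintype F] [DecidableEq F]
    (h2 : (2 : F) ≠ 0) {v w : F × {s : F // s ≠ 0 ∧ IsSquare s}}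
    (hvw : v ≠ w) :
    (Finset.univ.filter (fun x => squareRel v x ∧ squareRel w x)).card ≤ 2 := by
  by_contra! h
  obtain ⟨x, hx, y, hy, z, hz, hxy, hxz, hyz⟩ := Finset.two_lt_card.1 h
  simp only [Finset.mem_filter, Finset.mem_univ, true_and] at hx hy hz
  have hxy' : x.1 - y.1 ≠ 0 := fun h => hxy (squareRel_snd_eq hx.1 hy.1 (sub_eq_zero.1 h))
  have hxz' : x.1 - z.1 ≠ 0 := fun h => hxz (squareRel_snd_eq hx.1 hz.1 (sub_eq_zero.1 h))
  have hyz' : y.1 - z.1 ≠ 0 := fun h => hyz (squareRel_snd_eq hy.1 hz.1 (sub_eq_zero.1 h))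
  have key : ∀ x : F × {s : F // s ≠ 0 ∧ IsSquare s}, squareRel v x ∧ squareRel w x →
      (w.2.1 - v.2.1) * x.1 ^ 2 + 2 * (w.2.1 * v.1 - v.2.1 * w.1) * x.1 +
        (w.2.1 * v.1 ^ 2 - v.2.1 * w.1 ^ 2) = 0 := by
    intro x ⟨h1, h2⟩
    unfold squareRel at h1 h2
    linear_combination w.2.1 * h1 - v.2.1 * h2
  have kx := key x hx
  have ky := key y hy
  have kz := key z hz
  have e1 : (w.2.1 - v.2.1) * (x.1 + y.1) + 2 * (w.2.1 * v.1 - v.2.1 * w.1) = 0 :=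
    (mul_eq_zero.1 (by linear_combination kx - ky :
      (x.1 - y.1) * ((w.2.1 - v.2.1) * (x.1 + y.1) + 2 * (w.2.1 * v.1 - v.2.1 * w.1)) = 0
      )).resolve_left hxy'
  have e2 : (w.2.1 - v.2.1) * (x.1 + z.1) + 2 * (w.2.1 * v.1 - v.2.1 * w.1) = 0 :=
    (mul_eq_zero.1 (by linear_combination kx - kz :
      (x.1 - z.1) * ((w.2.1 - v.2.1) * (x.1 + z.1) + 2 * (w.2.1 * v.1 - v.2.1 * w.1)) = 0
      )).resolve_left hxz'
  have e3 : w.2.1 - v.2.1 = 0 :=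
    (mul_eq_zero.1 (by linear_combination e1 - e2 :
      (w.2.1 - v.2.1) * (y.1 - z.1) = 0)).resolve_right hyz'
  have e4 : v.2.1 * (v.1 - w.1) = 0 := by
    refine (mul_eq_zero.1 (?_ : 2 * (v.2.1 * (v.1 - w.1)) = 0)).resolve_left h2
    linear_combination e1 - (x.1 + y.1 + 2 * v.1) * e3
  exact hvw (Prod.ext (sub_eq_zero.1 ((mul_eq_zero.1 e4).resolve_left v.2.2.1))
    (Subtype.ext (sub_eq_zero.1 e3).symm))

open Classical in
/-- A symmetric relation in which every element has `d` neighbours, distinct elements have at most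
two common neighbours, and there are `d * (d + 1) / 2` elements. -/
structure IsSparseRel {V : Type*} [Fintype V] (R : V → V → Prop) (d : ℕ) : Prop where
  symm : ∀ v w, R v w → R w v
  two_mul_card : 2 * Fintype.card V = d * (d + 1)
  card_eq : ∀ v, (Finset.univ.filter (R v)).card = d
  card_inter_le : ∀ v w, v ≠ w → (Finset.univ.filter (fun x => R v x ∧ R w x)).card ≤ 2

lemma exists_isSparseRel {p : ℕ} (hp : p.Prime) (hp2 : p ≠ 2) :
    ∃ (V : Type) (_ : Fintype V) (R : V → V → Prop), IsSparseRel R (p - 1) := by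
  have : Fact p.Prime := ⟨hp⟩
  have h2 : (2 : ZMod p) ≠ 0 := by
    intro h
    have h' : ((2 : ℕ) : ZMod p) = 0 := by exact_mod_cast h
    rw [ZMod.natCast_eq_zero_iff] at h'
    exact hp2 ((Nat.prime_dvd_prime_iff_eq hp Nat.prime_two).1 h')
  have hS := card_nonzero_squares h2
  rw [ZMod.card] at hS
  refine ⟨ZMod p × {s : ZMod p // s ≠ 0 ∧ IsSquare s}, inferInstance, squareRel,
    fun v w h => squareRel_symm h, ?_, fun v => ?_, fun v w h => ?_⟩
  · rw [Fintype.card_prod, ZMod.card, Nat.mul_left_comm, Nat.sub_add_cancel hp.one_le,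
      mul_comm (p - 1)]
    congr 1
    lia
  · have := card_squareRel v
    rw [ZMod.card] at this
    convert Nat.eq_sub_of_add_eq this using 2
  · convert card_squareRel_inter_le h2 h using 2

namespace IsSparseRel

open Classical in
lemma sum_card_filter_sq_le {V : Type*} [Fintype V] {R : V → V → Prop} {d : ℕ}
    (hR : IsSparseRel R d) (Y : Finset V) :
    ∑ x, (Y.filter (R x)).card ^ 2 ≤ d * Y.card + 2 * Y.card ^ 2 := by
  have h1 : ∀ x, (Y.filter (R x)).card ^ 2 =
      ∑ y ∈ Y, ∑ z ∈ Y, if R y x ∧ R z x then 1 else 0 := by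
    intro x
    rw [sq, Finset.card_filter, Finset.sum_mul_sum]
    refine Finset.sum_congr rfl fun y _ => Finset.sum_congr rfl fun z _ => ?_
    have hy : R x y ↔ R y x := ⟨hR.symm _ _, hR.symm _ _⟩
    have hz : R x z ↔ R z x := ⟨hR.symm _ _, hR.symm _ _⟩
    by_cases h1 : R y x <;> by_cases h2 : R z x <;> simp [hy, hz, h1, h2]
  have h2 : ∀ y ∈ Y, ∑ z ∈ Y, ∑ x, (if R y x ∧ R z x then 1 else 0) ≤ d + 2 * Y.card := by
    intro y hy
    rw [← Finset.add_sum_erase _ _ hy]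
    refine add_le_add ?_ ?_
    · rw [← Finset.card_filter]
      simp only [and_self]
      exact (hR.card_eq y).le
    · refine (Finset.sum_le_card_nsmul _ _ 2 fun z hz => ?_).trans ?_
      · rw [← Finset.card_filter]
        exact hR.card_inter_le y z (Finset.ne_of_mem_erase hz).symm
      · rw [smul_eq_mul, mul_comm]
        exact Nat.mul_le_mul_left _ (Finset.card_le_card (Finset.erase_subset _ _))
  calc _ = ∑ y ∈ Y, ∑ z ∈ Y, ∑ x, (if R y x ∧ R z x then 1 else 0) := by
        rw [Finset.sum_congr rfl fun x _ => h1 x, Finset.sum_comm]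
        exact Finset.sum_congr rfl fun y _ => Finset.sum_comm
    _ ≤ Y.card • (d + 2 * Y.card) := Finset.sum_le_card_nsmul _ _ _ h2
    _ = _ := by rw [smul_eq_mul]; ring

open Classical in
lemma sum_card_filter {V : Type*} [Fintype V] {R : V → V → Prop} {d : ℕ}
    (hR : IsSparseRel R d) (Y : Finset V) : ∑ x, (Y.filter (R x)).card = d * Y.card := by
  simp only [Finset.card_filter]
  rw [Finset.sum_comm, mul_comm, ← smul_eq_mul, ← Finset.sum_const]
  refine Finset.sum_congr rfl fun y _ => ?_
  rw [← hR.card_eq y, Finset.card_filter]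
  refine Finset.sum_congr rfl fun x _ => ?_
  have : R x y ↔ R y x := ⟨hR.symm _ _, hR.symm _ _⟩
  simp [this]

open Classical in
lemma sq_sum_card_filter_sub_le {V : Type*} [Fintype V] {R : V → V → Prop} {d : ℕ}
    (hR : IsSparseRel R d) (X Y : Finset V) :
    ((∑ x ∈ X, ((Y.filter (R x)).card : ℝ)) - d * X.card * Y.card / Fintype.card V) ^ 2 ≤
      2 * d * X.card * Y.card := by
  rcases isEmpty_or_nonempty V with hV | hV
  · simp [Finset.eq_empty_of_isEmpty]
  set N : ℝ := (Fintype.card V : ℝ) with hN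
  set y : ℝ := (Y.card : ℝ) with hy
  have hN0 : 0 < N := by rw [hN]; exact_mod_cast Fintype.card_pos
  have hNd : 2 * N = d * (d + 1) := by rw [hN]; exact_mod_cast hR.two_mul_card
  have hyN : y ≤ N := by rw [hN, hy]; exact_mod_cast Finset.card_le_univ Y
  have hy0 : 0 ≤ y := Nat.cast_nonneg _
  have s1 : ∑ x, ((Y.filter (R x)).card : ℝ) = d * y := by
    rw [hy]
    exact_mod_cast hR.sum_card_filter Y
  have s2 : ∑ x, ((Y.filter (R x)).card : ℝ) ^ 2 ≤ d * y + 2 * y ^ 2 := by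
    rw [hy]
    exact_mod_cast hR.sum_card_filter_sq_le Y
  have hvar : ∑ x, (((Y.filter (R x)).card : ℝ) - d * y / N) ^ 2 ≤ 2 * d * y := by
    have e : ∑ x, (((Y.filter (R x)).card : ℝ) - d * y / N) ^ 2 =
        ∑ x, ((Y.filter (R x)).card : ℝ) ^ 2 - (d * y) ^ 2 / N := by
      simp only [sub_sq]
      rw [Finset.sum_add_distrib, Finset.sum_sub_distrib, ← Finset.sum_mul, ← Finset.mul_sum, s1,
        Finset.sum_const, Finset.card_univ, nsmul_eq_mul, ← hN]
      field_simp
      ring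
    have e2 : 2 * y ^ 2 - (d * y) ^ 2 / N ≤ d * y := by
      rw [sub_le_iff_le_add, ← sub_le_iff_le_add', le_div_iff₀ hN0]
      have : (d : ℝ) * y * y ≤ d * y * N := by gcongr
      nlinarith
    linarith
  have e3 : (∑ x ∈ X, ((Y.filter (R x)).card : ℝ)) - d * X.card * y / N =
      ∑ x ∈ X, (((Y.filter (R x)).card : ℝ) - d * y / N) := by
    rw [Finset.sum_sub_distrib, Finset.sum_const, nsmul_eq_mul]
    ring
  rw [e3]
  refine (sq_sum_le_card_mul_sum_sq).trans ?_
  have := (Finset.sum_le_sum_of_subset_of_nonneg (Finset.subset_univ X) fun x _ _ =>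
    sq_nonneg (((Y.filter (R x)).card : ℝ) - d * y / N)).trans hvar
  have := mul_le_mul_of_nonneg_left this (Nat.cast_nonneg (α := ℝ) X.card)
  linarith

open Classical in
lemma exists_core {V : Type*} [Fintype V] {R : V → V → Prop} {d : ℕ}
    (hR : IsSparseRel R d) {η δ : ℝ} (hη : 0 < η) (hη1 : η < 1 / 3) (hδ : 0 < δ)
    (hd : 2 < η ^ 3 * δ ^ 2 * d) {U : Finset V} (hU : δ * Fintype.card V ≤ U.card)
    (hU1 : 1 ≤ η * U.card) :
    ∃ W ⊆ U, W.Nonempty ∧ ∀ v ∈ W,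
      (1 - 3 * η) * (d * U.card / Fintype.card V) ≤ (W.filter (R v)).card := by
  set N : ℝ := (Fintype.card V : ℝ) with hN
  set k : ℝ := (U.card : ℝ) with hk
  have hk0 : 0 < k := by
    by_contra! h
    nlinarith
  have hN0 : 0 < N := lt_of_lt_of_le hk0 (by rw [hN, hk]; exact_mod_cast Finset.card_le_univ U)
  have hd0 : (0 : ℝ) < d := by
    by_contra! h
    have : η ^ 3 * δ ^ 2 * d ≤ 0 := mul_nonpos_of_nonneg_of_nonpos (by positivity) h
    linarith
  set c : ℝ := (1 - 3 * η) * (d * k / N) with hc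
  obtain ⟨h, hh1, hh2⟩ : ∃ h : ℕ, η * k ≤ h ∧ (h : ℝ) ≤ 2 * η * k :=
    ⟨⌈η * k⌉₊, Nat.le_ceil _, by
      have := Nat.ceil_lt_add_one (by positivity : 0 ≤ η * k)
      linarith⟩
  set S : Finset (Finset V) := U.powerset.filter (fun X =>
    (∑ x ∈ X, (((U \ X).filter (R x)).card : ℝ)) ≤ c * X.card ∧ X.card ≤ h) with hS
  have hSne : S.Nonempty := ⟨∅, by simp [hS]⟩
  obtain ⟨X, hX, hmax⟩ := S.exists_max_image Finset.card hSne
  obtain ⟨hXU, hXe, hXh⟩ : X ⊆ U ∧ _ ∧ _ := by simpa [hS] using hX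
  have hUX : ((U \ X).card : ℝ) = k - X.card := by
    rw [Finset.card_sdiff_of_subset hXU, Nat.cast_sub (Finset.card_le_card hXU)]
  have hXlt : X.card < h := by
    refine lt_of_le_of_ne hXh fun heq => ?_
    have hdisc := hR.sq_sum_card_filter_sub_le X (U \ X)
    rw [hUX, heq, ← hN] at hdisc
    rw [heq] at hXe
    have hh0 : (0 : ℝ) < h := lt_of_lt_of_le (by positivity) hh1
    have h1 : η * (d * h * k / N) ≤ d * h * (k - h) / N - c * h := by
      have : d * h * (k - h) / N - c * h - η * (d * h * k / N) =
          d * h / N * (2 * η * k - h) := by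
        rw [hc]
        field_simp
        ring
      have : 0 ≤ d * h / N * (2 * η * k - h) := mul_nonneg (by positivity) (by linarith)
      linarith
    have h2 : (η * (d * h * k / N)) ^ 2 ≤ 2 * d * h * k := by
      have h3 : 2 * (d : ℝ) * h * (k - h) ≤ 2 * d * h * k := by
        gcongr
        linarith
      refine le_trans ?_ (hdisc.trans h3)
      rw [← neg_sq (_ - _)]
      refine pow_le_pow_left₀ (by positivity) ?_ 2
      linarith
    have h4 : η ^ 2 * d * h * k ≤ 2 * N ^ 2 := by
      have e : (η * (d * h * k / N)) ^ 2 = (η ^ 2 * d * h * k) * (d * h * k) / N ^ 2 := by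
        field_simp
      rw [e, div_le_iff₀ (by positivity)] at h2
      refine le_of_mul_le_mul_right (h2.trans_eq ?_) (by positivity : 0 < d * h * k)
      ring
    have h5 : η ^ 2 * d * (η * k) * k ≤ η ^ 2 * d * h * k := by gcongr
    have h6 : (δ * N) ^ 2 ≤ k ^ 2 := by gcongr
    have h7 : η ^ 3 * d * (δ * N) ^ 2 ≤ η ^ 3 * d * k ^ 2 := by gcongr
    have h8 : 2 * N ^ 2 < η ^ 3 * δ ^ 2 * d * N ^ 2 := by gcongr
    linarith
  refine ⟨U \ X, Finset.sdiff_subset, ?_, fun v hv => ?_⟩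
  · rw [← Finset.card_pos]
    have h1 : (X.card : ℝ) < k := by
      have : (X.card : ℝ) < h := by exact_mod_cast hXlt
      nlinarith
    have : (0 : ℝ) < (U \ X).card := by rw [hUX]; linarith
    exact_mod_cast this
  · by_contra! hlt
    obtain ⟨hvU, hvX⟩ := Finset.mem_sdiff.1 hv
    have hins : insert v X ∈ S := by
      rw [hS, Finset.mem_filter, Finset.mem_powerset]
      refine ⟨Finset.insert_subset hvU hXU, ?_, ?_⟩
      · have hmono : ∀ x, (((U \ insert v X).filter (R x)).card : ℝ) ≤
            ((U \ X).filter (R x)).card := fun x => by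
          exact_mod_cast Finset.card_le_card (Finset.filter_subset_filter _
            (Finset.sdiff_subset_sdiff le_rfl (Finset.subset_insert _ _)))
        rw [Finset.sum_insert hvX, Finset.card_insert_of_notMem hvX]
        have h1 := Finset.sum_le_sum fun x (_ : x ∈ X) => hmono x
        have h2 := hmono v
        push_cast
        linarith
      · rw [Finset.card_insert_of_notMem hvX]
        exact hXlt
    have := hmax _ hins
    rw [Finset.card_insert_of_notMem hvX] at this
    lia

end IsSparseRel

/-- Injective sequences of length `L` in `U` which, preceded by `v` and started at time `i`,
have consecutive terms related except at the times divisible by `M`. -/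
def IsEpochSeq {V : Type*} (R : V → V → Prop) (M : ℕ) {L : ℕ} (i : ℕ) (v : V) (U : Finset V)
    (f : Fin L → V) : Prop :=
  Function.Injective f ∧ (∀ j, f j ∈ U) ∧ ∀ j : Fin L, (i + j) % M ≠ 0 →
    R (Fin.cons (α := fun _ => V) v f j.castSucc) (f j)

lemma IsEpochSeq.cons {V : Type*} [DecidableEq V] {R : V → V → Prop} {M L i : ℕ} {v w : V}
    {U : Finset V} {f : Fin L → V} (hf : IsEpochSeq R M (i + 1) w (U.erase w) f) (hw : w ∈ U)
    (hvw : i % M ≠ 0 → R v w) :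
    IsEpochSeq R M i v U (Fin.cons (α := fun _ => V) w f) := by
  obtain ⟨h1, h2, h3⟩ := hf
  refine ⟨?_, ?_, ?_⟩
  · rw [Fin.cons_injective_iff]
    refine ⟨?_, h1⟩
    rintro ⟨j, hj⟩
    exact (Finset.mem_erase.1 (h2 j)).1 hj
  · intro j
    refine Fin.cases ?_ (fun j => ?_) j
    · exact hw
    · exact Finset.mem_of_mem_erase (h2 j)
  · intro j
    refine Fin.cases ?_ (fun j => ?_) j
    · simpa using hvw
    · intro hj
      rw [← Fin.succ_castSucc, Fin.cons_succ, Fin.cons_succ]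
      refine h3 j ?_
      rwa [Fin.val_succ, ← Nat.add_assoc, Nat.add_right_comm] at hj

open Classical in
lemma le_card_isEpochSeq_of_choices {V : Type*} [Fintype V] {R : V → V → Prop} {M L i : ℕ} {v : V}
    {U C : Finset V} (hCU : C ⊆ U) (hCv : ∀ w ∈ C, i % M ≠ 0 → R v w) {a : ℝ}
    (ha : ∀ w ∈ C, a ≤ (Finset.univ.filter
      (IsEpochSeq (L := L) R M (i + 1) w (U.erase w))).card) :
    C.card * a ≤ (Finset.univ.filter (IsEpochSeq (L := L + 1) R M i v U)).card := by
  have h : (C.sigma fun w => Finset.univ.filter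
      (IsEpochSeq (L := L) R M (i + 1) w (U.erase w))).card ≤
      (Finset.univ.filter (IsEpochSeq (L := L + 1) R M i v U)).card := by
    refine Finset.card_le_card_of_injOn
      (fun x => Fin.cons (α := fun _ => V) x.1 x.2) ?_ ?_
    · intro x hx
      obtain ⟨hx1, hx2⟩ := Finset.mem_sigma.1 hx
      refine Finset.mem_coe.2 (Finset.mem_filter.2 ⟨Finset.mem_univ _, ?_⟩)
      exact (Finset.mem_filter.1 hx2).2.cons (hCU hx1) (hCv _ hx1)
    · rintro ⟨w, f⟩ - ⟨w', f'⟩ - h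
      obtain ⟨rfl, rfl⟩ := Fin.cons_inj.1 h
      rfl
  rw [Finset.card_sigma] at h
  calc C.card * a = C.card • a := (nsmul_eq_mul _ _).symm
    _ ≤ ∑ w ∈ C, ((Finset.univ.filter
      (IsEpochSeq (L := L) R M (i + 1) w (U.erase w))).card : ℝ) :=
        Finset.card_nsmul_le_sum _ _ _ ha
    _ ≤ _ := by exact_mod_cast h

open Classical in
lemma le_card_isEpochSeq {V : Type*} [Fintype V] {R : V → V → Prop} {M K : ℕ} {B : ℝ}
    (hB : 0 ≤ B)
    (hcore : ∀ U : Finset V, K ≤ U.card → ∃ W ⊆ U, W.Nonempty ∧ ∀ v ∈ W,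
      B * U.card + M ≤ (W.filter (R v)).card) (hM : 0 < M)
    (L i : ℕ) (v : V) (U : Finset V) (hU : K + L ≤ U.card)
    (hW : i % M ≠ 0 → ∃ W : Finset V, v ∈ W ∧ (W \ U).card ≤ i % M ∧ ∀ x ∈ W,
      B * U.card + M ≤ (W.filter (R x)).card) :
    B ^ L * (U.card.descFactorial L : ℝ) ≤
      (Finset.univ.filter (IsEpochSeq (L := L) R M i v U)).card := by
  induction L generalizing i v U with
  | zero =>
    have : (Finset.univ.filter (IsEpochSeq (L := 0) R M i v U)) = Finset.univ := by
      refine Finset.filter_true_of_mem fun f _ => ⟨?_, ?_, ?_⟩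
      · exact Function.injective_of_subsingleton f
      · exact fun j => j.elim0
      · exact fun j => j.elim0
    rw [this, Finset.card_univ]
    simp
  | succ L ih =>
    have hmod : (i + 1) % M ≠ 0 → (i + 1) % M = i % M + 1 := by
      intro h
      have hlt := Nat.mod_lt i hM
      rw [← Nat.mod_add_mod] at h ⊢
      refine Nat.mod_eq_of_lt (lt_of_le_of_ne hlt fun h' => h ?_)
      rw [h', Nat.mod_self]
    obtain ⟨C, hCU, hCv, hCcard, hCW⟩ : ∃ C ⊆ U, (∀ w ∈ C, i % M ≠ 0 → R v w) ∧
        B * U.card ≤ C.card ∧ ∀ w ∈ C, (i + 1) % M ≠ 0 → ∃ W : Finset V, w ∈ W ∧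
          (W \ U.erase w).card ≤ (i + 1) % M ∧ ∀ x ∈ W,
            B * U.card + M ≤ (W.filter (R x)).card := by
      by_cases hi : i % M = 0
      · obtain ⟨W, hWU, ⟨w, hw⟩, hWd⟩ := hcore U (by lia)
        refine ⟨W, hWU, fun _ _ h => absurd hi h, ?_, fun w hw h => ⟨W, hw, ?_, hWd⟩⟩
        · have h1 := hWd w hw
          have h2 : ((W.filter (R w)).card : ℝ) ≤ W.card := by
            exact_mod_cast Finset.card_filter_le _ _
          have h3 : (0 : ℝ) ≤ M := Nat.cast_nonneg M
          linarith
        · rw [hmod h]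
          have : W \ U.erase w ⊆ {w} := by
            intro x hx
            rw [Finset.mem_sdiff, Finset.mem_erase] at hx
            rw [Finset.mem_singleton]
            by_contra hne
            exact hx.2 ⟨hne, hWU hx.1⟩
          have := Finset.card_le_card this
          rw [Finset.card_singleton] at this
          lia
      · obtain ⟨W, hvW, hWU, hWd⟩ := hW hi
        refine ⟨(W ∩ U).filter (R v), (Finset.filter_subset _ _).trans Finset.inter_subset_right,
          fun w hw _ => (Finset.mem_filter.1 hw).2, ?_, fun w hw h => ⟨W, ?_, ?_, hWd⟩⟩
        · have h1 := hWd v hvW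
          have h2 : (W.filter (R v)).card ≤ ((W ∩ U).filter (R v)).card + (W \ U).card := by
            refine le_trans (Finset.card_le_card ?_) (Finset.card_union_le _ _)
            intro x hx
            rw [Finset.mem_filter] at hx
            rw [Finset.mem_union, Finset.mem_filter, Finset.mem_inter, Finset.mem_sdiff]
            tauto
          have h3 : (W.filter (R v)).card ≤ ((W ∩ U).filter (R v)).card + M := by
            have := Nat.mod_lt i hM
            lia
          have h4 : ((W.filter (R v)).card : ℝ) ≤ ((W ∩ U).filter (R v)).card + M := by
            exact_mod_cast h3
          linarith
        · exact (Finset.mem_inter.1 (Finset.mem_filter.1 hw).1).1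
        · rw [hmod h]
          have : W \ U.erase w ⊆ insert w (W \ U) := by
            intro x hx
            rw [Finset.mem_sdiff, Finset.mem_erase] at hx
            rw [Finset.mem_insert, Finset.mem_sdiff]
            tauto
          have := (Finset.card_le_card this).trans (Finset.card_insert_le _ _)
          lia
    obtain ⟨k, hk⟩ : ∃ k, U.card = k + 1 := ⟨U.card - 1, by lia⟩
    have herase : ∀ w ∈ C, (U.erase w).card = k := fun w hw => by
      rw [Finset.card_erase_of_mem (hCU hw), hk, Nat.add_sub_cancel]
    have hstep : ∀ w ∈ C, B ^ L * (k.descFactorial L : ℝ) ≤ (Finset.univ.filter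
        (IsEpochSeq (L := L) R M (i + 1) w (U.erase w))).card := by
      intro w hw
      have := ih (i + 1) w (U.erase w) (by rw [herase w hw]; lia) fun h => by
        obtain ⟨W, h1, h2, h3⟩ := hCW w hw h
        refine ⟨W, h1, h2, fun x hx => le_trans ?_ (h3 x hx)⟩
        gcongr
        exact Finset.erase_subset _ _
      rwa [herase w hw] at this
    refine le_trans ?_ (le_card_isEpochSeq_of_choices hCU hCv hstep)
    rw [hk, Nat.succ_descFactorial_succ, ← hk]
    calc B ^ (L + 1) * ((U.card * k.descFactorial L : ℕ) : ℝ)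
        = (B * U.card) * (B ^ L * k.descFactorial L) := by push_cast; ring
      _ ≤ _ := by gcongr

/-- A labelling of the positions is good if consecutive labels are related except at
multiples of `M`. -/
def IsGoodLabelling {V : Type*} (R : V → V → Prop) (M : ℕ) {n : ℕ} (f : Fin n → V) : Prop :=
  Function.Injective f ∧ ∀ i j : Fin n, (j : ℕ) = i + 1 → (j : ℕ) % M ≠ 0 → R (f i) (f j)

open Classical in
lemma IsSparseRel.le_card_isGoodLabelling {V : Type*} [Fintype V] {R : V → V → Prop} {d : ℕ}
    (hR : IsSparseRel R d) {η δ : ℝ} (hη : 0 < η) (hη1 : η < 1 / 4) (hδ : 0 < δ)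
    (hd : 2 < η ^ 3 * δ ^ 2 * d) (hN : 1 ≤ η * δ * Fintype.card V) {n M : ℕ} (hM : 0 < M)
    (hMd : M ≤ η * δ * d) (hn : δ * Fintype.card V + n + 1 ≤ Fintype.card V) :
    ((1 - 4 * η) * d / Fintype.card V) ^ n * ((Fintype.card V).descFactorial n : ℝ) ≤
      (Finset.univ.filter (IsGoodLabelling (n := n) R M)).card := by
  have hN0 : (0 : ℝ) < Fintype.card V := by
    by_contra! h
    nlinarith [mul_pos hη hδ]
  obtain ⟨v⟩ : Nonempty V := Fintype.card_pos_iff.1 (by exact_mod_cast hN0)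
  have h := le_card_isEpochSeq (R := R) (M := M) (K := ⌈δ * Fintype.card V⌉₊)
    (B := (1 - 4 * η) * d / Fintype.card V)
    (div_nonneg (mul_nonneg (by linarith) (Nat.cast_nonneg d)) hN0.le) ?_ hM n 0 v Finset.univ ?_
    (fun h => absurd (Nat.zero_mod M) h)
  · rw [Finset.card_univ] at h
    refine h.trans ?_
    rw [Nat.cast_le]
    refine Finset.card_le_card fun f hf => ?_
    obtain ⟨h1, -, h3⟩ := (Finset.mem_filter.1 hf).2
    refine Finset.mem_filter.2 ⟨Finset.mem_univ _, h1, fun i j hij hj => ?_⟩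
    have := h3 j (by rwa [Nat.zero_add])
    have e : j.castSucc = i.succ := Fin.ext (by simp [hij])
    rwa [e, Fin.cons_succ] at this
  · intro U hU
    have hU' : δ * Fintype.card V ≤ U.card := (Nat.le_ceil _).trans (by exact_mod_cast hU)
    have hU1 : 1 ≤ η * U.card := hN.trans (by rw [mul_assoc]; gcongr)
    obtain ⟨W, hWU, hWne, hWd⟩ := hR.exists_core hη (by linarith) hδ hd hU' hU1
    refine ⟨W, hWU, hWne, fun v hv => le_trans ?_ (hWd v hv)⟩
    have h1 : (M : ℝ) ≤ η * (d * U.card / Fintype.card V) := by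
      refine hMd.trans ?_
      rw [mul_assoc]
      refine mul_le_mul_of_nonneg_left ?_ hη.le
      rw [le_div_iff₀ hN0]
      have := mul_le_mul_of_nonneg_left hU' (Nat.cast_nonneg (α := ℝ) d)
      linarith
    have h2 : (1 - 4 * η) * d / Fintype.card V * U.card =
        (1 - 3 * η) * (d * U.card / Fintype.card V) - η * (d * U.card / Fintype.card V) := by
      ring
    linarith
  · rw [Finset.card_univ]
    have := Nat.ceil_lt_add_one (by positivity : 0 ≤ δ * Fintype.card V)
    have h2 : ((⌈δ * Fintype.card V⌉₊ + n : ℕ) : ℝ) ≤ Fintype.card V := by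
      push_cast
      linarith
    exact_mod_cast h2

/-- The positions in `Fin n` adjacent to, or at distance one from, a step ending at a multiple
of `M`. -/
def keyPositions (n M : ℕ) : Finset (Fin n) :=
  Finset.univ.filter fun i => (i : ℕ) % M ∈ ({M - 2, M - 1, 0, 1} : Finset ℕ)

lemma card_keyPositions_le (n M : ℕ) : (keyPositions n M).card ≤ 4 * (n / M + 1) := by
  calc (keyPositions n M).card
      ≤ (({M - 2, M - 1, 0, 1} : Finset ℕ) ×ˢ Finset.range (n / M + 1)).card := by
        refine Finset.card_le_card_of_injOn (fun i => ((i : ℕ) % M, (i : ℕ) / M)) ?_ ?_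
        · intro i hi
          refine Finset.mem_coe.2 (Finset.mem_product.2 ⟨(Finset.mem_filter.1 hi).2, ?_⟩)
          exact Finset.mem_range.2 (Nat.lt_succ_of_le (Nat.div_le_div_right i.2.le))
        · intro i _ j _ h
          obtain ⟨h1, h2⟩ := Prod.mk.inj h
          refine Fin.ext ?_
          rw [← Nat.div_add_mod (i : ℕ) M, ← Nat.div_add_mod (j : ℕ) M, h1, h2]
    _ ≤ _ := by
        rw [Finset.card_product, Finset.card_range]
        exact Nat.mul_le_mul_right _ Finset.card_le_four

lemma mem_keyPositions_of_near {n M : ℕ} (hM : 4 ≤ M) {i j k : Fin n} (hij : (j : ℕ) = i + 1)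
    (hj : (j : ℕ) % M = 0) (hk : (k : ℕ) ≤ j + 1) (hk' : (i : ℕ) ≤ k + 1) :
    k ∈ keyPositions n M := by
  have hj' : M ∣ (j : ℕ) := Nat.dvd_of_mod_eq_zero hj
  obtain ⟨c, hc⟩ := hj'
  obtain ⟨c, rfl⟩ : ∃ c', c = c' + 1 := by
    refine Nat.exists_eq_add_one_of_ne_zero ?_
    rintro rfl
    lia
  rw [Nat.mul_succ] at hc
  have h : ∀ r, r < M → (M * c + r) % M = r := fun r hr => by
    rw [Nat.mul_add_mod, Nat.mod_eq_of_lt hr]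
  have h' : ∀ r, r < M → (M * c + M + r) % M = r := fun r hr => by
    rw [Nat.add_assoc, Nat.mul_add_mod, Nat.add_mod_left, Nat.mod_eq_of_lt hr]
  simp only [keyPositions, Finset.mem_filter, Finset.mem_univ, true_and, Finset.mem_insert,
    Finset.mem_singleton]
  have hcases : (k : ℕ) = M * c + (M - 2) ∨ (k : ℕ) = M * c + (M - 1) ∨
      (k : ℕ) = M * c + M + 0 ∨ (k : ℕ) = M * c + M + 1 := by lia
  rcases hcases with hk | hk | hk | hk
  · exact Or.inl (by rw [hk, h _ (by lia)])
  · exact Or.inr (Or.inl (by rw [hk, h _ (by lia)]))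
  · exact Or.inr (Or.inr (Or.inl (by rw [hk, h' _ (by lia)])))
  · exact Or.inr (Or.inr (Or.inr (by rw [hk, h' _ (by lia)])))

/-- The vertices `x` and `y` are consecutive in the ordering `π`. -/
def IsStep {n : ℕ} (π : Fin n ≃ Fin n) (x y : Fin n) : Prop :=
  (π.symm y : ℕ) = π.symm x + 1 ∨ (π.symm x : ℕ) = π.symm y + 1

lemma rel_of_isStep {V : Type*} [Fintype V] {R : V → V → Prop} {d : ℕ} (hR : IsSparseRel R d)
    {n M : ℕ} (hM : 4 ≤ M) {π π' : Fin n ≃ Fin n} (hkey : ∀ k ∈ keyPositions n M, π k = π' k)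
    {φ : Fin n → V} (h : IsGoodLabelling R M (φ ∘ π))
    {x : Fin n} {y : Fin 3 ↪ Fin n} (hxy : ∀ b, IsStep π x (y b) ∨ IsStep π' x (y b))
    (b : Fin 3) (hb : IsStep π x (y b)) : R (φ x) (φ (y b)) := by
  have key : ∀ i j : Fin n, (j : ℕ) = i + 1 → (j : ℕ) % M = 0 →
      (π.symm x = i ∨ π.symm x = j) → False := by
    intro i j hij hj hx
    have hx' : (i : ℕ) ≤ π.symm x ∧ (π.symm x : ℕ) ≤ j := by
      rcases hx with h | h <;> rw [h] <;> lia
    have hsymm : ∀ k ∈ keyPositions n M, ∀ z, π'.symm z = k → π.symm z = k := by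
      intro k hk z hz
      rw [Equiv.symm_apply_eq] at hz ⊢
      rw [hkey k hk, hz]
    have hxk : π.symm x ∈ keyPositions n M :=
      mem_keyPositions_of_near hM hij hj (by lia) (by lia)
    have hx2 : π'.symm x = π.symm x := by
      rw [Equiv.symm_apply_eq, ← hkey _ hxk, Equiv.apply_symm_apply]
    have hstep : ∀ b, IsStep π x (y b) := by
      intro b
      rcases hxy b with h | h
      · exact h
      · have h0 := h
        unfold IsStep at h ⊢
        rw [hx2] at h
        rwa [hsymm _ (mem_keyPositions_of_near hM hij hj (by lia) (by lia)) (y b) rfl]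
    have hne : ∀ b c, b ≠ c → (π.symm (y b) : ℕ) ≠ π.symm (y c) := fun b c hbc h =>
      hbc (y.injective (π.symm.injective (Fin.ext h)))
    have h0 := hstep 0
    have h1 := hstep 1
    have h2 := hstep 2
    have h01 := hne 0 1 (by decide)
    have h02 := hne 0 2 (by decide)
    have h12 := hne 1 2 (by decide)
    unfold IsStep at h0 h1 h2
    lia
  rcases hb with hb | hb
  · have := h.2 _ _ hb fun h0 => key _ _ hb h0 (Or.inl rfl)
    simpa using this
  · have := h.2 _ _ hb fun h0 => key _ _ hb h0 (Or.inr rfl)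
    exact hR.symm _ _ (by simpa using this)

lemma not_isGoodLabelling {V : Type*} [Fintype V] {R : V → V → Prop} {d : ℕ}
    (hR : IsSparseRel R d) {n M : ℕ} (hM : 4 ≤ M) {π π' : Fin n ≃ Fin n}
    (hkey : ∀ k ∈ keyPositions n M, π k = π' k) {φ : Fin n → V}
    (h : IsGoodLabelling R M (φ ∘ π)) (h' : IsGoodLabelling R M (φ ∘ π'))
    {f : Fin 2 ⊕ Fin 3 ↪ Fin n}
    (hf : ∀ a b, IsStep π (f (Sum.inl a)) (f (Sum.inr b)) ∨
      IsStep π' (f (Sum.inl a)) (f (Sum.inr b))) : False := by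
  classical
  have hrel : ∀ a b, R (φ (f (Sum.inl a))) (φ (f (Sum.inr b))) := by
    intro a b
    rcases hf a b with hs | hs
    · exact rel_of_isStep hR hM hkey h (y := Function.Embedding.inr.trans f) (hf a) b hs
    · exact rel_of_isStep hR hM (fun k hk => (hkey k hk).symm) h'
        (y := Function.Embedding.inr.trans f) (fun b => (hf a b).symm) b hs
  have hφ : Function.Injective φ := by
    have := h.1.comp π.symm.injective
    rwa [Function.comp_assoc, Equiv.self_comp_symm, Function.comp_id] at this
  have hne : φ (f (Sum.inl 0)) ≠ φ (f (Sum.inl 1)) := fun h => by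
    simpa using f.injective (hφ h)
  have hle := hR.card_inter_le _ _ hne
  have : (Finset.univ.image fun b : Fin 3 => φ (f (Sum.inr b))).card ≤ 2 := by
    refine (Finset.card_le_card ?_).trans hle
    intro x hx
    obtain ⟨b, -, rfl⟩ := Finset.mem_image.1 hx
    exact Finset.mem_filter.2 ⟨Finset.mem_univ _, hrel 0 b, hrel 1 b⟩
  rw [Finset.card_image_of_injective _ fun b c h => by simpa using f.injective (hφ h)] at this
  simp at this

open Classical in
lemma card_mul_card_isGoodLabelling_le {V : Type*} [Fintype V] {R : V → V → Prop} {d : ℕ}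
    (hR : IsSparseRel R d) {n M m : ℕ} (hM : 4 ≤ M) (hn : 0 < n) (π : Fin m → (Fin n ≃ Fin n))
    (hπ : ∀ i j, i ≠ j → ∃ f : Fin 2 ⊕ Fin 3 ↪ Fin n, ∀ a b,
      IsStep (π i) (f (Sum.inl a)) (f (Sum.inr b)) ∨
      IsStep (π j) (f (Sum.inl a)) (f (Sum.inr b))) :
    m * (Finset.univ.filter (IsGoodLabelling (n := n) R M)).card ≤
      (Fintype.card V).descFactorial n * n ^ (4 * (n / M + 1)) := by
  have hcount : ∀ j, (Finset.univ.filter fun φ : Fin n → V =>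
      IsGoodLabelling R M (φ ∘ π j)).card =
      (Finset.univ.filter (IsGoodLabelling (n := n) R M)).card := by
    intro j
    refine Finset.card_bij (fun φ _ => φ ∘ π j) ?_ ?_ ?_
    · intro φ hφ
      simpa using hφ
    · intro φ _ ψ _ h
      exact (π j).surjective.injective_comp_right h
    · intro ψ hψ
      refine ⟨ψ ∘ (π j).symm, ?_, ?_⟩
      · simpa [Function.comp_assoc] using hψ
      · simp [Function.comp_assoc]
  have hX : ∀ φ : Fin n → V, (Finset.univ.filter fun j => IsGoodLabelling R M (φ ∘ π j)).card ≤
      n ^ (4 * (n / M + 1)) := by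
    intro φ
    have h1 : (Finset.univ.filter fun j => IsGoodLabelling R M (φ ∘ π j)).card ≤
        Fintype.card (keyPositions n M → Fin n) := by
      rw [← Finset.card_univ]
      refine Finset.card_le_card_of_injOn (fun j k => π j k) (fun _ _ => by simp) ?_
      intro i hi j hj hij
      by_contra hne
      obtain ⟨f, hf⟩ := hπ i j hne
      refine not_isGoodLabelling hR hM (fun k hk => ?_) (Finset.mem_filter.1 hi).2
        (Finset.mem_filter.1 hj).2 hf
      exact congrFun hij ⟨k, hk⟩
    refine h1.trans ?_
    rw [Fintype.card_fun, Fintype.card_fin, Fintype.card_coe]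
    exact Nat.pow_le_pow_right hn (card_keyPositions_le n M)
  have hinj : (Finset.univ.filter fun φ : Fin n → V => Function.Injective φ).card =
      (Fintype.card V).descFactorial n := by
    rw [← Fintype.card_subtype, ← Fintype.card_congr (Equiv.subtypeInjectiveEquivEmbedding _ _).symm,
      Fintype.card_embedding_eq, Fintype.card_fin]
  calc m * (Finset.univ.filter (IsGoodLabelling (n := n) R M)).card
      = ∑ j : Fin m, (Finset.univ.filter fun φ : Fin n → V =>
          IsGoodLabelling R M (φ ∘ π j)).card := by
        rw [Finset.sum_congr rfl fun j _ => hcount j, Finset.sum_const, Finset.card_univ,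
          Fintype.card_fin, smul_eq_mul]
    _ = ∑ φ : Fin n → V, (Finset.univ.filter fun j => IsGoodLabelling R M (φ ∘ π j)).card := by
        simp only [Finset.card_filter]
        exact Finset.sum_comm
    _ = ∑ φ : Fin n → V with Function.Injective φ,
          (Finset.univ.filter fun j => IsGoodLabelling R M (φ ∘ π j)).card := by
        refine (Finset.sum_filter_of_ne fun φ _ hne => ?_).symm
        obtain ⟨j, hj⟩ := Finset.card_ne_zero.1 hne
        have := (Finset.mem_filter.1 hj).2.1.comp (π j).symm.injective
        rwa [Function.comp_assoc, Equiv.self_comp_symm, Function.comp_id] at this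
    _ ≤ _ := by
        rw [← hinj, ← smul_eq_mul]
        exact Finset.sum_le_card_nsmul _ _ _ fun φ _ => hX φ

lemma exists_equiv_isStep_of_isHamiltonian {n : ℕ} {u v : Fin n}
    {p : (⊤ : SimpleGraph (Fin n)).Walk u v} (hp : p.IsHamiltonian) :
    ∃ π : Fin n ≃ Fin n, ∀ x y, p.toSubgraph.Adj x y → IsStep π x y := by
  have hlen : n = p.support.length := by rw [hp.length_support, Fintype.card_fin]
  set π : Fin n ≃ Fin n := (finCongr hlen).trans hp.getVertEquiv with hπ
  have hv : ∀ i : Fin n, π i = p.getVert i := fun i => rfl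
  have key : ∀ (i : ℕ) (hi : i + 1 < n), (π.symm (p.getVert (i + 1)) : ℕ) =
      π.symm (p.getVert i) + 1 := by
    intro i hi
    have h1 : π.symm (p.getVert (i + 1)) = ⟨i + 1, hi⟩ := by
      rw [Equiv.symm_apply_eq, hv]
    have h2 : π.symm (p.getVert i) = ⟨i, by lia⟩ := by
      rw [Equiv.symm_apply_eq, hv]
    rw [h1, h2]
  refine ⟨π, fun x y hxy => ?_⟩
  obtain ⟨i, hi, hilt⟩ := p.toSubgraph_adj_iff.1 hxy
  have hi' : i + 1 < n := by
    rw [p.length_support] at hlen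
    lia
  rcases Sym2.eq_iff.1 hi with ⟨rfl, rfl⟩ | ⟨rfl, rfl⟩
  · exact Or.inl (key i hi')
  · exact Or.inr (key i hi')

open Classical in
lemma card_mul_card_isGoodLabelling_le_of_walks {V : Type*} [Fintype V] {R : V → V → Prop} {d : ℕ}
    (hR : IsSparseRel R d) {n M m : ℕ} (hM : 4 ≤ M) (hn : 0 < n)
    (P : Fin m → Σ u : Fin n, Σ v : Fin n, (⊤ : SimpleGraph (Fin n)).Walk u v)
    (hP : ∀ i, (P i).2.2.IsHamiltonian)
    (hC : ∀ i j, i ≠ j →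
      ContainsCopy (completeBipartiteGraph (Fin 2) (Fin 3)) (walkUnion (P i).2.2 (P j).2.2)) :
    m * (Finset.univ.filter (IsGoodLabelling (n := n) R M)).card ≤
      (Fintype.card V).descFactorial n * n ^ (4 * (n / M + 1)) := by
  choose π hπ using fun i => exists_equiv_isStep_of_isHamiltonian (hP i)
  refine card_mul_card_isGoodLabelling_le hR hM hn π fun i j hij => ?_
  obtain ⟨f, hf⟩ := hC i j hij
  refine ⟨f, fun a b => ?_⟩
  have h := hf (a := Sum.inl a) (b := Sum.inr b) (by simp)
  simp only [walkUnion, SimpleGraph.Subgraph.spanningCoe_adj, SimpleGraph.Subgraph.sup_adj] at h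
  exact h.imp (hπ i _ _) (hπ j _ _)

lemma eventually_pow_le_two_rpow {ε : ℝ} (hε : 0 < ε) :
    ∀ᶠ n : ℕ in atTop, ∀ M : ℕ, (n : ℝ) ^ (1 / 4 : ℝ) ≤ M →
      (n : ℝ) ^ (4 * (n / M + 1)) ≤ (2 : ℝ) ^ (ε * n) := by
  have hlog2 : 0 < Real.log 2 := Real.log_pos (by norm_num)
  have h := (isLittleO_log_rpow_atTop (by norm_num : (0 : ℝ) < 1 / 4)).bound
    (by positivity : 0 < ε * Real.log 2 / 8)
  filter_upwards [tendsto_natCast_atTop_atTop.eventually h, eventually_ge_atTop 1]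
    with n hn hn1 M hM
  have hn1' : (1 : ℝ) ≤ n := by exact_mod_cast hn1
  have hn0 : (0 : ℝ) < n := by linarith
  have hlog0 : 0 ≤ Real.log n := Real.log_nonneg hn1'
  rw [Real.norm_of_nonneg hlog0, Real.norm_of_nonneg (by positivity)] at hn
  have h34 : (n : ℝ) ^ (3 / 4 : ℝ) * (n : ℝ) ^ (1 / 4 : ℝ) = n := by
    rw [← Real.rpow_add hn0]
    norm_num
  have hq0 : 0 < (n : ℝ) ^ (1 / 4 : ℝ) := by positivity
  have hK : ((4 * (n / M + 1) : ℕ) : ℝ) ≤ 8 * (n : ℝ) ^ (3 / 4 : ℝ) := by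
    have h1 : ((n / M : ℕ) : ℝ) ≤ (n : ℝ) ^ (3 / 4 : ℝ) := by
      refine Nat.cast_div_le.trans ?_
      rw [div_le_iff₀ (hq0.trans_le hM)]
      calc (n : ℝ) = (n : ℝ) ^ (3 / 4 : ℝ) * (n : ℝ) ^ (1 / 4 : ℝ) := h34.symm
        _ ≤ _ := by gcongr
    have h2 : (1 : ℝ) ≤ (n : ℝ) ^ (3 / 4 : ℝ) := Real.one_le_rpow hn1' (by norm_num)
    push_cast
    linarith
  rw [← Real.rpow_natCast, Real.rpow_def_of_pos hn0, Real.rpow_def_of_pos two_pos,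
    Real.exp_le_exp]
  calc Real.log n * ((4 * (n / M + 1) : ℕ) : ℝ)
      ≤ (ε * Real.log 2 / 8 * (n : ℝ) ^ (1 / 4 : ℝ)) * (8 * (n : ℝ) ^ (3 / 4 : ℝ)) := by gcongr
    _ = ε * Real.log 2 * ((n : ℝ) ^ (3 / 4 : ℝ) * (n : ℝ) ^ (1 / 4 : ℝ)) := by ring
    _ = Real.log 2 * (ε * n) := by rw [h34]; ring

/-- The bound obtained from the incidence relation over a field with `p` elements. -/
lemma card_paths_le_of_prime {p : ℕ} (hp : p.Prime) (hp2 : p ≠ 2) {η δ : ℝ} (hη : 0 < η)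
    (hη1 : η < 1 / 4) (hδ : 0 < δ) (hd : 2 < η ^ 3 * δ ^ 2 * (p - 1))
    {n M m : ℕ} (hn : 0 < n) (hM : 4 ≤ M) (hMd : M ≤ η * δ * (p - 1))
    (hN : 1 ≤ η * δ * n) (hnp : n + 1 ≤ (1 - δ) * (p * (p - 1) / 2 : ℝ))
    (P : Fin m → Σ u : Fin n, Σ v : Fin n, (⊤ : SimpleGraph (Fin n)).Walk u v)
    (hP : ∀ i, (P i).2.2.IsHamiltonian)
    (hC : ∀ i j, i ≠ j →
      ContainsCopy (completeBipartiteGraph (Fin 2) (Fin 3)) (walkUnion (P i).2.2 (P j).2.2)) :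
    (m : ℝ) ≤ (n : ℝ) ^ (4 * (n / M + 1)) * (p / (2 * (1 - 4 * η))) ^ n := by
  classical
  obtain ⟨V, _, R, hR⟩ := exists_isSparseRel hp hp2
  have hp1 : (1 : ℝ) < p := by exact_mod_cast hp.one_lt
  have hcast : ((p - 1 : ℕ) : ℝ) = p - 1 := by rw [Nat.cast_sub hp.one_le, Nat.cast_one]
  have hV : (Fintype.card V : ℝ) = p * (p - 1) / 2 := by
    have h := hR.two_mul_card
    rw [Nat.sub_add_cancel hp.one_le] at h
    have h' : (2 : ℝ) * Fintype.card V = (p - 1 : ℕ) * p := by exact_mod_cast h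
    rw [hcast] at h'
    linarith
  have hVn : (n : ℝ) + 1 ≤ Fintype.card V := by
    rw [hV]
    have : 0 ≤ δ * (p * (p - 1) / 2 : ℝ) := mul_nonneg hδ.le (by nlinarith)
    linarith
  have hVn' : (n : ℝ) ≤ Fintype.card V := by linarith
  have hlow := hR.le_card_isGoodLabelling (n := n) (M := M) hη hη1 hδ (by rw [hcast]; exact hd)
    (hN.trans (by gcongr)) (by lia) (by rw [hcast]; exact hMd)
    (by rw [← hV] at hnp; linarith)
  have hup := Nat.cast_le (α := ℝ).2
    (card_mul_card_isGoodLabelling_le_of_walks hR hM hn P hP hC)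
  rw [Nat.cast_mul, Nat.cast_mul, Nat.cast_pow] at hup
  have hD : (0 : ℝ) < ((Fintype.card V).descFactorial n : ℝ) := by
    have : n ≤ Fintype.card V := by exact_mod_cast hVn'
    exact_mod_cast Nat.descFactorial_pos.2 this
  have hB : (1 - 4 * η) * (p - 1 : ℕ) / Fintype.card V = (p / (2 * (1 - 4 * η)) : ℝ)⁻¹ := by
    rw [hcast, hV]
    have : (p : ℝ) - 1 ≠ 0 := by linarith
    have : (1 : ℝ) - 4 * η ≠ 0 := by linarith
    field_simp
  rw [hB] at hlow
  have h1 := (mul_le_mul_of_nonneg_left hlow (Nat.cast_nonneg (α := ℝ) m)).trans hup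
  have hc : (0 : ℝ) < p / (2 * (1 - 4 * η)) := div_pos (by linarith) (by linarith)
  rw [inv_pow] at h1
  have h2 : (m : ℝ) * ((p / (2 * (1 - 4 * η)) : ℝ) ^ n)⁻¹ ≤ (n : ℝ) ^ (4 * (n / M + 1)) := by
    refine le_of_mul_le_mul_right ?_ hD
    linarith
  rwa [← div_eq_mul_inv, div_le_iff₀ (by positivity)] at h2

lemma exists_pos_lt_sq_div_le {b : ℝ} (hb : 1 < b) :
    ∃ δ : ℝ, 0 < δ ∧ δ < 1 / 8 ∧ (1 + δ) ^ 2 / (1 - 4 * δ) ≤ b := by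
  have hc : ContinuousAt (fun δ : ℝ => (1 + δ) ^ 2 / (1 - 4 * δ)) 0 :=
    ContinuousAt.div (by fun_prop) (by fun_prop) (by norm_num)
  have h1 : ∀ᶠ δ : ℝ in 𝓝 0, (1 + δ) ^ 2 / (1 - 4 * δ) ≤ b := by
    refine (hc.tendsto.eventually_lt_const ?_).mono fun _ h => le_of_lt h
    simpa using hb
  have h2 : ∀ᶠ δ : ℝ in 𝓝 0, δ < 1 / 8 := gt_mem_nhds (by norm_num)
  obtain ⟨δ, ⟨hδ1, hδ2⟩, hδ⟩ := (((h1.and h2).filter_mono nhdsWithin_le_nhds).and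
    (self_mem_nhdsWithin (s := Set.Ioi (0 : ℝ)))).exists
  exact ⟨δ, hδ, hδ2, hδ1⟩

lemma sqrt_half_pow (n : ℕ) :
    (√(2 * n) / 2) ^ n = (n : ℝ) ^ ((n : ℝ) / 2) * (2 : ℝ) ^ (-(n : ℝ) / 2) := by
  have h1 : √(2 * n) / 2 = √n * (√2)⁻¹ := by
    rw [Real.sqrt_mul (by norm_num)]
    have h0 : √2 ≠ 0 := by positivity
    field_simp
    rw [Real.sq_sqrt two_pos.le, mul_comm]
  rw [h1, mul_pow, inv_pow, Real.sqrt_eq_rpow, Real.sqrt_eq_rpow, ← Real.rpow_mul_natCast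
    (Nat.cast_nonneg n), ← Real.rpow_mul_natCast two_pos.le, ← Real.rpow_neg two_pos.le]
  congr 2 <;> ring

/-- `H_n(K_{2,3}) ≤ n^{n/2} · 2^{-n/2 + o(n)}`. -/
theorem Hn_K23_upper :
    ∀ ε : ℝ, 0 < ε → ∃ n₀ : ℕ, ∀ n : ℕ, n₀ ≤ n →
      ∀ (m : ℕ) (P : Fin m → Σ u : Fin n, Σ v : Fin n, (⊤ : SimpleGraph (Fin n)).Walk u v),
        Function.Injective P →
        (∀ i, (P i).2.2.IsHamiltonian) →
        (∀ i j, i ≠ j →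
          ContainsCopy (completeBipartiteGraph (Fin 2) (Fin 3)) (walkUnion (P i).2.2 (P j).2.2)) →
        (m : ℝ) ≤ (n : ℝ) ^ ((n : ℝ) / 2) * (2 : ℝ) ^ (-(n : ℝ) / 2 + ε * n) := by
  intro ε hε
  obtain ⟨δ, hδ0, hδ1, hδb⟩ := exists_pos_lt_sq_div_le
    (Real.one_lt_rpow (by norm_num : (1 : ℝ) < 2) (half_pos hε))
  have hcast := tendsto_natCast_atTop_atTop (R := ℝ)
  have hroot : Tendsto (fun n : ℕ => (n : ℝ) ^ (1 / 4 : ℝ)) atTop atTop :=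
    (tendsto_rpow_atTop (by norm_num)).comp hcast
  have hx : Tendsto (fun n : ℕ => (1 + δ) * √(2 * n)) atTop atTop :=
    (Real.tendsto_sqrt_atTop.comp (hcast.const_mul_atTop two_pos)).const_mul_atTop
      (by linarith)
  rw [← eventually_atTop]
  filter_upwards [eventually_pow_le_two_rpow (half_pos hε),
    hx.eventually (eventually_exists_prime_le_mul hδ0),
    hroot.eventually_ge_atTop 4, hroot.eventually_ge_atTop (1 + 1 / δ ^ 2),
    hroot.eventually_ge_atTop (1 + 2 / δ ^ 5), hroot.eventually_ge_atTop (16 / δ),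
    hcast.eventually_ge_atTop (16 / δ), hcast.eventually_ge_atTop (1 / δ ^ 2),
    eventually_gt_atTop 0] with n hpow ⟨p, hp, hp1, hp2⟩ hy4 hyM hyd hyp hnδ hnδ2 hn m P _ hP hC
  set y : ℝ := (n : ℝ) ^ (1 / 4 : ℝ) with hy
  have hn0 : (0 : ℝ) < n := by exact_mod_cast hn
  have hyn : y ^ 4 = n := by
    rw [hy, ← Real.rpow_mul_natCast hn0.le]
    norm_num
  have hysq : y ^ 2 ≤ √(2 * n) := by
    refine Real.le_sqrt_of_sq_le ?_
    rw [← hyn]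
    nlinarith [sq_nonneg (y ^ 2)]
  have hpy : y ^ 2 ≤ p := by
    refine le_trans ?_ hp1
    nlinarith [Real.sqrt_nonneg (2 * n : ℝ)]
  have hpsq : (1 + δ) ^ 2 * (2 * n) ≤ (p : ℝ) ^ 2 := by
    calc (1 + δ) ^ 2 * (2 * n) = ((1 + δ) * √(2 * n)) ^ 2 := by
          rw [mul_pow, Real.sq_sqrt (by positivity)]
      _ ≤ _ := by gcongr
  have hp16 : (16 : ℝ) ≤ p := by nlinarith
  have hne2 : p ≠ 2 := by
    rintro rfl
    norm_num at hp16
  have hMle : ((⌈y⌉₊ : ℕ) : ℝ) ≤ y + 1 := (Nat.ceil_lt_add_one (by linarith)).le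
  have hbound := card_paths_le_of_prime hp hne2 hδ0 (by linarith) hδ0 (η := δ) (M := ⌈y⌉₊)
    ?_ hn ?_ ?_ ?_ ?_ P hP hC
  · have hb : (p : ℝ) / (2 * (1 - 4 * δ)) ≤ 2 ^ (ε / 2) * (√(2 * n) / 2) := by
      calc (p : ℝ) / (2 * (1 - 4 * δ))
          ≤ ((1 + δ) * ((1 + δ) * √(2 * n))) / (2 * (1 - 4 * δ)) := by
            refine div_le_div_of_nonneg_right hp2 ?_
            linarith
        _ = (1 + δ) ^ 2 / (1 - 4 * δ) * (√(2 * n) / 2) := by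
            have : 1 - 4 * δ ≠ 0 := by linarith
            field_simp
        _ ≤ _ := by gcongr
    calc (m : ℝ) ≤ _ := hbound
      _ ≤ 2 ^ (ε / 2 * n) * (2 ^ (ε / 2) * (√(2 * n) / 2)) ^ n := by
          refine mul_le_mul (hpow _ (Nat.le_ceil _)) (pow_le_pow_left₀ ?_ hb n) ?_ (by positivity)
          · exact div_nonneg (by positivity) (by linarith)
          · exact pow_nonneg (div_nonneg (by positivity) (by linarith)) n
      _ = _ := by
          rw [mul_pow, sqrt_half_pow, ← Real.rpow_mul_natCast two_pos.le, Real.rpow_add two_pos,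
            show ε * n = ε / 2 * n + ε / 2 * n by ring, Real.rpow_add two_pos]
          ring
  · have h1 : 2 / δ ^ 5 < p - 1 := by nlinarith
    rw [div_lt_iff₀ (by positivity)] at h1
    nlinarith
  · have : (4 : ℝ) ≤ (⌈y⌉₊ : ℕ) := hy4.trans (Nat.le_ceil _)
    exact_mod_cast this
  · have h1 : 1 ≤ (y - 1) * δ ^ 2 := by
      rw [← div_le_iff₀ (by positivity)]
      linarith
    have h2 : (y + 1) * 1 ≤ (y + 1) * ((y - 1) * δ ^ 2) := by gcongr
    have h3 : δ ^ 2 * (y ^ 2) ≤ δ ^ 2 * p := by gcongr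
    nlinarith
  · rw [div_le_iff₀ (by positivity)] at hnδ2
    linarith
  · have hpδ : 16 ≤ δ * p := by
      rw [div_le_iff₀ hδ0] at hyp
      nlinarith
    have hnδ' : 16 ≤ δ * n := by
      rw [div_le_iff₀ hδ0] at hnδ
      linarith
    have h1 : (1 - δ / 16) * (p : ℝ) ≤ p - 1 := by linarith
    have h2 : (1 - δ / 16) * (p : ℝ) ^ 2 ≤ p * (p - 1) := by nlinarith
    have h3 : (1 - δ / 16) * ((1 + δ) ^ 2 * (2 * n)) ≤ p * (p - 1) :=
      le_trans (mul_le_mul_of_nonneg_left hpsq (by linarith)) h2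
    have h4 : (1 - δ) * ((1 - δ / 16) * ((1 + δ) ^ 2 * n)) ≤ (1 - δ) * (p * (p - 1) / 2) :=
      mul_le_mul_of_nonneg_left (by linarith) (by linarith)
    have h5 : 1 + δ / 16 ≤ (1 - δ) * ((1 - δ / 16) * (1 + δ) ^ 2) := by
      have e : (1 - δ) * ((1 - δ / 16) * (1 + δ) ^ 2) =
        1 + δ / 16 + δ * (7 / 8 - 17 / 16 * δ - 15 / 16 * δ ^ 2 + 1 / 16 * δ ^ 3) := by ring
      have : 0 ≤ 7 / 8 - 17 / 16 * δ - 15 / 16 * δ ^ 2 + 1 / 16 * δ ^ 3 := by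
        have : 0 < δ ^ 3 := by positivity
        nlinarith
      rw [e]
      have := mul_nonneg hδ0.le this
      linarith
    have h6 := mul_le_mul_of_nonneg_right h5 hn0.le
    linarith
end

section
/- For every ε > 0 there exists n₀ such that for all integers n ≥ n₀, H_n(K_{2,4}) ≤ n^{n/2} · 3^{−n/2 + εn}; that is, the maximum size of a family of Hamilton paths in K_n the union of any two of which contains K_{2,4} is at most n^{n/2} 3^{−n/2 + o(n)}. -/
open SimpleGraph

/-- `u` and `v` occupy consecutive places of the linear order encoded by `pos`. -/
def Consecutive {V : Type*} (pos : V → ℕ) (u v : V) : Prop :=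
  pos v = pos u + 1 ∨ pos u = pos v + 1

open Classical in
/-- The element just after `u`, or `u` itself if there is none. -/
noncomputable def nextVertex {V : Type*} (pos : V → ℕ) (u : V) : V :=
  if h : ∃ v, pos v = pos u + 1 then h.choose else u

open Classical in
/-- The element just before `u`, or `u` itself if there is none. -/
noncomputable def prevVertex {V : Type*} (pos : V → ℕ) (u : V) : V :=
  if h : ∃ v, pos v + 1 = pos u then h.choose else u

lemma nextVertex_eq {V : Type*} {pos : V → ℕ} (hpos : Function.Injective pos) {u v : V}
    (h : pos v = pos u + 1) : nextVertex pos u = v := by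
  have hex : ∃ v, pos v = pos u + 1 := ⟨v, h⟩
  rw [nextVertex, dif_pos hex]
  exact hpos (hex.choose_spec.trans h.symm)

lemma prevVertex_eq {V : Type*} {pos : V → ℕ} (hpos : Function.Injective pos) {u v : V}
    (h : pos v + 1 = pos u) : prevVertex pos u = v := by
  have hex : ∃ v, pos v + 1 = pos u := ⟨v, h⟩
  rw [prevVertex, dif_pos hex]
  have := hex.choose_spec
  exact hpos (by omega)

lemma nextVertex_eq_self_or {V : Type*} (pos : V → ℕ) (u : V) :
    nextVertex pos u = u ∨ pos (nextVertex pos u) = pos u + 1 := by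
  by_cases hex : ∃ v, pos v = pos u + 1
  · right
    rw [nextVertex, dif_pos hex]
    exact hex.choose_spec
  · left
    rw [nextVertex, dif_neg hex]

/-- If four distinct vertices are neighbours of `a` in the union of two paths, then `a` has both a
predecessor and a successor among them in the first path, and no edge is used twice. -/
lemma four_neighbors {V : Type*} {p q : V → ℕ} (hp : Function.Injective p)
    (hq : Function.Injective q) {a : V} {c : Fin 4 → V} (hc : Function.Injective c)
    (h : ∀ k, Consecutive p a (c k) ∨ Consecutive q a (c k)) :
    (∃ k, p (c k) = p a + 1) ∧ (∃ k, p (c k) + 1 = p a) ∧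
      ∀ k, Consecutive p a (c k) → ¬ Consecutive q a (c k) := by
  let R : Fin 4 → Fin 4 → Prop := fun k o =>
    (o = 0 ∧ p (c k) = p a + 1) ∨ (o = 1 ∧ p a = p (c k) + 1) ∨
    (o = 2 ∧ q (c k) = q a + 1) ∨ (o = 3 ∧ q a = q (c k) + 1)
  have hR : ∀ k, ∃ o, R k o := by
    intro k
    rcases h k with (h | h) | (h | h)
    · exact ⟨0, Or.inl ⟨rfl, h⟩⟩
    · exact ⟨1, Or.inr (Or.inl ⟨rfl, h⟩)⟩
    · exact ⟨2, Or.inr (Or.inr (Or.inl ⟨rfl, h⟩))⟩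
    · exact ⟨3, Or.inr (Or.inr (Or.inr ⟨rfl, h⟩))⟩
  have huniq : ∀ k l o, R k o → R l o → k = l := by
    intro k l o hk hl
    apply hc
    rcases hk with ⟨rfl, hk⟩ | ⟨rfl, hk⟩ | ⟨rfl, hk⟩ | ⟨rfl, hk⟩ <;> simp [R] at hl
    · exact hp (by omega)
    · exact hp (by omega)
    · exact hq (by omega)
    · exact hq (by omega)
  choose g hg using hR
  have hginj : Function.Injective g := fun k l hkl =>
    huniq k l (g k) (hg k) (hkl ▸ hg l)
  have hgsurj : Function.Surjective g := Finite.surjective_of_injective hginj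
  have hfun : ∀ k o o', R k o → R k o' → o = o' := by
    intro k o o' ho ho'
    obtain ⟨l, rfl⟩ := hgsurj o
    obtain ⟨l', rfl⟩ := hgsurj o'
    rw [← huniq k l _ ho (hg l), ← huniq k l' _ ho' (hg l')]
  refine ⟨?_, ?_, ?_⟩
  · obtain ⟨k, hk⟩ := hgsurj 0
    have := hg k
    rw [hk] at this
    simp [R] at this
    exact ⟨k, this⟩
  · obtain ⟨k, hk⟩ := hgsurj 1
    have := hg k
    rw [hk] at this
    simp [R] at this
    exact ⟨k, this.symm⟩
  · rintro k (h1 | h1) (h2 | h2)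
    · exact absurd (hfun k 0 2 (by simp [R, h1]) (by simp [R, h2])) (by decide)
    · exact absurd (hfun k 0 3 (by simp [R, h1]) (by simp [R, h2])) (by decide)
    · exact absurd (hfun k 1 2 (by simp [R, h1]) (by simp [R, h2])) (by decide)
    · exact absurd (hfun k 1 3 (by simp [R, h1]) (by simp [R, h2])) (by decide)

/-- One orientation of the pair `u, q` has the same colour as the `s`-edge with the same tail. -/
def ColorCoincides {V κ : Type*} (s : V → V) (χ : V × V → κ) (u q : V) : Prop :=
  χ (u, q) = χ (u, s u) ∨ χ (q, u) = χ (q, s q)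

open Classical in
/-- In a uniformly random colouring, colour coincidences at distinct pairs that are not `s`-edges
happen simultaneously with probability at most `(2 / |κ|) ^ |ι|`. -/
lemma card_colorCoincides_le {ι V κ : Type*} [Fintype ι] [Fintype V] [Fintype κ]
    (s : V → V) (e : ι → V × V)
    (hne : ∀ i, (e i).2 ≠ s (e i).1 ∧ (e i).1 ≠ s (e i).2)
    (hinj : ∀ i j, i ≠ j → e i ≠ e j ∧ e i ≠ (e j).swap) :
    (Finset.univ.filter fun χ : V × V → κ =>
        ∀ i, ColorCoincides s χ (e i).1 (e i).2).card * Fintype.card κ ^ Fintype.card ι ≤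
      2 ^ Fintype.card ι * Fintype.card (V × V → κ) := by
  let o : (V × V → κ) → ι → Bool := fun χ i =>
    decide (χ ((e i).1, (e i).2) = χ ((e i).1, s (e i).1))
  let g : (ι → Bool) → ι → V × V := fun b i => if b i then e i else (e i).swap
  have hg : ∀ b, Function.Injective (g b) := by
    intro b i j hij
    by_contra hne'
    obtain ⟨h1, h2⟩ := hinj i j hne'
    simp only [g] at hij
    split_ifs at hij
    · exact h1 hij
    · exact h2 hij
    · exact h2 (by rw [← hij, Prod.swap_swap])
    · exact h1 (Prod.swap_injective hij)
  have hgs : ∀ b i v, g b i ≠ (v, s v) := by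
    intro b i v hv
    simp only [g] at hv
    split_ifs at hv
    · exact (hne i).1 (by rw [hv])
    · have h : e i = (s v, v) := by rw [← Prod.swap_swap (e i), hv, Prod.swap_prod_mk]
      exact (hne i).2 (by rw [h])
  let F : (V × V → κ) × (ι → κ) → (ι → Bool) × (V × V → κ) := fun x =>
    (o x.1, Function.extend (g (o x.1)) x.2 x.1)
  have key : ∀ χ : V × V → κ, (∀ i, ColorCoincides s χ (e i).1 (e i).2) → ∀ i,
      χ (g (o χ) i) = χ ((g (o χ) i).1, s (g (o χ) i).1) := by
    intro χ hχ i
    by_cases h : χ ((e i).1, (e i).2) = χ ((e i).1, s (e i).1)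
    · simp [g, o, h]
    · have := (hχ i).resolve_left h
      simpa [g, o, h, Prod.swap] using this
  have hF : Set.InjOn F (↑((Finset.univ.filter fun χ : V × V → κ =>
        ∀ i, ColorCoincides s χ (e i).1 (e i).2) ×ˢ (Finset.univ : Finset (ι → κ)))) := by
    rintro ⟨χ, k⟩ hx ⟨χ', k'⟩ hx' hFF
    simp only [Finset.coe_product, Finset.coe_filter, Finset.mem_univ, true_and,
      Finset.coe_univ, Set.mem_prod, Set.mem_ofPred_eq, Set.mem_univ, and_true] at hx hx'
    simp only [F, Prod.mk.injEq] at hFF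
    obtain ⟨ho, hext⟩ := hFF
    have hk := key χ hx
    have hk' := key χ' hx'
    rw [← ho] at hext hk'
    have hoff : ∀ y, (¬ ∃ i, g (o χ) i = y) → χ y = χ' y := by
      intro y hy
      have := congrFun hext y
      rwa [Function.extend_apply' _ _ _ hy, Function.extend_apply' _ _ _ hy] at this
    have hχ : χ = χ' := by
      funext y
      by_cases hy : ∃ i, g (o χ) i = y
      · obtain ⟨i, rfl⟩ := hy
        rw [hk, hk']
        exact hoff _ fun ⟨j, hj⟩ => hgs _ _ _ hj
      · exact hoff y hy
    have hkk : k = k' := by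
      funext i
      have := congrFun hext (g (o χ) i)
      rwa [(hg _).extend_apply, (hg _).extend_apply] at this
    rw [hχ, hkk]
  have hcard := Finset.card_le_card_of_injOn F (t := Finset.univ)
    (fun _ _ => Finset.mem_coe.2 (Finset.mem_univ _)) hF
  rw [Finset.card_product, Finset.card_univ, Finset.card_univ, Fintype.card_prod,
    Fintype.card_fun, Fintype.card_fun (α := ι) (β := Bool), Fintype.card_bool] at hcard
  exact hcard

/-- Both `a` and `b` are inner vertices, at distance at least three along the path, and all the
edges that would exchange their neighbours have coinciding colours. -/
def FarBad {V κ : Type*} (pos : V → ℕ) (χ : V × V → κ) (a b : V) : Prop :=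
  (pos a + 3 ≤ pos b ∧ pos (nextVertex pos a) = pos a + 1 ∧ pos (prevVertex pos a) + 1 = pos a ∧
    pos (nextVertex pos b) = pos b + 1 ∧ pos (prevVertex pos b) + 1 = pos b) ∧
  ColorCoincides (nextVertex pos) χ a (prevVertex pos b) ∧
  ColorCoincides (nextVertex pos) χ a (nextVertex pos b) ∧
  ColorCoincides (nextVertex pos) χ b (prevVertex pos a) ∧
  ColorCoincides (nextVertex pos) χ b (nextVertex pos a)

/-- The analogue of `FarBad` for `a` and the vertex `b` two places further. -/
def NearBad {V κ : Type*} (pos : V → ℕ) (χ : V × V → κ) (a b : V) : Prop :=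
  (pos b = pos a + 2 ∧ pos (prevVertex pos a) + 1 = pos a ∧ pos (nextVertex pos b) = pos b + 1) ∧
  ColorCoincides (nextVertex pos) χ a (nextVertex pos b) ∧
  ColorCoincides (nextVertex pos) χ b (prevVertex pos a)

/-- `a` precedes some `b` with which it could form the small side of a `K_{2,4}`. -/
def BadVertex {V κ : Type*} (pos : V → ℕ) (χ : V × V → κ) (a : V) : Prop :=
  NearBad pos χ a (nextVertex pos (nextVertex pos a)) ∨ ∃ b, FarBad pos χ a b

lemma ne_nextVertex {V : Type*} {pos : V → ℕ} {u q : V} (h : u ≠ q) (h' : pos q ≠ pos u + 1) :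
    q ≠ nextVertex pos u := by
  rintro rfl
  rcases nextVertex_eq_self_or pos u with h1 | h1
  · exact h h1.symm
  · exact h' h1

open Classical in
lemma card_farBad_le {V κ : Type*} [Fintype V] [Fintype κ] (pos : V → ℕ) (a b : V) :
    (Finset.univ.filter fun χ : V × V → κ => FarBad pos χ a b).card * Fintype.card κ ^ 4 ≤
      16 * Fintype.card (V × V → κ) := by
  by_cases hgeo : pos a + 3 ≤ pos b ∧ pos (nextVertex pos a) = pos a + 1 ∧
    pos (prevVertex pos a) + 1 = pos a ∧
    pos (nextVertex pos b) = pos b + 1 ∧ pos (prevVertex pos b) + 1 = pos b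
  · obtain ⟨h1, h2, h3, h4, h5⟩ := hgeo
    have hne : ∀ x y : V, pos x ≠ pos y → x ≠ y := fun x y h hxy => h (by rw [hxy])
    have := card_colorCoincides_le (κ := κ) (nextVertex pos)
      (![(a, prevVertex pos b), (a, nextVertex pos b), (b, prevVertex pos a),
        (b, nextVertex pos a)] : Fin 4 → V × V)
      (by
        intro i
        fin_cases i <;> constructor <;> apply ne_nextVertex <;> simp <;>
          first | omega | (apply hne; omega))
      (by
        have hpp : ∀ x y z w : V, pos x ≠ pos z ∨ pos y ≠ pos w → (x, y) ≠ (z, w) := by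
          rintro x y z w (h | h) hh <;> simp only [Prod.mk.injEq] at hh
          · exact h (by rw [hh.1])
          · exact h (by rw [hh.2])
        intro i j hij
        fin_cases i <;> fin_cases j <;> first | exact absurd rfl hij | skip
        all_goals
          constructor <;> apply hpp <;> simp <;> omega)
    simp only [Fintype.card_fin] at this
    refine le_trans (Nat.mul_le_mul_right _ (Finset.card_le_card ?_)) this
    intro χ
    simp only [Finset.mem_filter, Finset.mem_univ, true_and]
    rintro ⟨-, c1, c2, c3, c4⟩ i
    fin_cases i
    · exact c1
    · exact c2
    · exact c3
    · exact c4
  · rw [Finset.filter_false_of_mem fun χ _ h => hgeo h.1]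
    simp

open Classical in
lemma card_nearBad_le {V κ : Type*} [Fintype V] [Fintype κ] (pos : V → ℕ) (a b : V) :
    (Finset.univ.filter fun χ : V × V → κ => NearBad pos χ a b).card * Fintype.card κ ^ 2 ≤
      4 * Fintype.card (V × V → κ) := by
  by_cases hgeo : pos b = pos a + 2 ∧ pos (prevVertex pos a) + 1 = pos a ∧
    pos (nextVertex pos b) = pos b + 1
  · obtain ⟨h1, h2, h3⟩ := hgeo
    have hne : ∀ x y : V, pos x ≠ pos y → x ≠ y := fun x y h hxy => h (by rw [hxy])
    have := card_colorCoincides_le (κ := κ) (nextVertex pos)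
      (![(a, nextVertex pos b), (b, prevVertex pos a)] : Fin 2 → V × V)
      (by
        intro i
        fin_cases i <;> constructor <;> apply ne_nextVertex <;> simp <;>
          first | omega | (apply hne; omega))
      (by
        have hpp : ∀ x y z w : V, pos x ≠ pos z ∨ pos y ≠ pos w → (x, y) ≠ (z, w) := by
          rintro x y z w (h | h) hh <;> simp only [Prod.mk.injEq] at hh
          · exact h (by rw [hh.1])
          · exact h (by rw [hh.2])
        intro i j hij
        fin_cases i <;> fin_cases j <;> first | exact absurd rfl hij | skip
        all_goals
          constructor <;> apply hpp <;> simp <;> omega)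
    simp only [Fintype.card_fin] at this
    refine le_trans (Nat.mul_le_mul_right _ (Finset.card_le_card ?_)) this
    intro χ
    simp only [Finset.mem_filter, Finset.mem_univ, true_and]
    rintro ⟨-, c1, c2⟩ i
    fin_cases i
    · exact c1
    · exact c2
  · rw [Finset.filter_false_of_mem fun χ _ h => hgeo h.1]
    simp

open Classical in
/-- If the number of colours is at least `√|V| / 8`, a random colouring has a bounded expected
number of bad vertices. -/
lemma sum_card_badVertex_le {V κ : Type*} [Fintype V] [Fintype κ] (pos : V → ℕ)
    (hκ : 0 < Fintype.card κ) (hV : Fintype.card V ≤ 64 * Fintype.card κ ^ 2) :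
    ∑ χ : V × V → κ, (Finset.univ.filter fun a => BadVertex pos χ a).card ≤
      65792 * Fintype.card (V × V → κ) := by
  set K := Fintype.card κ
  set n := Fintype.card V with hn
  set N := Fintype.card (V × V → κ)
  have hle : ∀ χ : V × V → κ, (Finset.univ.filter fun a => BadVertex pos χ a).card ≤
      (∑ a : V, if NearBad pos χ a (nextVertex pos (nextVertex pos a)) then 1 else 0) +
        ∑ a : V, ∑ b : V, if FarBad pos χ a b then 1 else 0 := by
    intro χ
    rw [Finset.card_filter, ← Finset.sum_add_distrib]
    refine Finset.sum_le_sum fun a _ => ?_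
    split_ifs with h h1 h1
    · omega
    · obtain ⟨b, hb⟩ := h.resolve_left h1
      have := Finset.single_le_sum (f := fun b => if FarBad pos χ a b then 1 else 0)
        (fun _ _ => Nat.zero_le _) (Finset.mem_univ b)
      simp only [hb, if_true] at this
      omega
    · omega
    · omega
  have hnear : (∑ χ : V × V → κ, ∑ a : V,
      if NearBad pos χ a (nextVertex pos (nextVertex pos a)) then 1 else 0) * K ^ 2 ≤
        n * (4 * N) := by
    rw [Finset.sum_comm, Finset.sum_mul]
    refine (Finset.sum_le_card_nsmul _ _ (4 * N) fun a _ => ?_).trans_eq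
      (by rw [Finset.card_univ, smul_eq_mul])
    rw [← Finset.card_filter]
    exact card_nearBad_le pos a _
  have hfar : (∑ χ : V × V → κ, ∑ a : V, ∑ b : V, if FarBad pos χ a b then 1 else 0) * K ^ 4 ≤
      n * (n * (16 * N)) := by
    rw [Finset.sum_comm, Finset.sum_mul]
    refine (Finset.sum_le_card_nsmul _ _ (n * (16 * N)) fun a _ => ?_).trans_eq
      (by rw [Finset.card_univ, smul_eq_mul])
    rw [Finset.sum_comm, Finset.sum_mul]
    refine (Finset.sum_le_card_nsmul _ _ (16 * N) fun b _ => ?_).trans_eq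
      (by rw [Finset.card_univ, smul_eq_mul])
    rw [← Finset.card_filter]
    exact card_farBad_le pos a b
  refine (Finset.sum_le_sum fun χ _ => hle χ).trans ?_
  rw [Finset.sum_add_distrib]
  have hnear' : (∑ χ : V × V → κ, ∑ a : V,
      if NearBad pos χ a (nextVertex pos (nextVertex pos a)) then 1 else 0) ≤ 256 * N := by
    refine Nat.le_of_mul_le_mul_right (hnear.trans ?_) (pow_pos hκ 2)
    calc n * (4 * N) ≤ (64 * K ^ 2) * (4 * N) := Nat.mul_le_mul_right _ hV
      _ = 256 * N * K ^ 2 := by ring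
  have hfar' : (∑ χ : V × V → κ, ∑ a : V, ∑ b : V, if FarBad pos χ a b then 1 else 0) ≤
      65536 * N := by
    refine Nat.le_of_mul_le_mul_right (hfar.trans ?_) (pow_pos hκ 4)
    calc n * (n * (16 * N)) ≤ (64 * K ^ 2) * ((64 * K ^ 2) * (16 * N)) :=
          Nat.mul_le_mul hV (Nat.mul_le_mul_right _ hV)
      _ = 65536 * N * K ^ 4 := by ring
  omega

/-- If `a` and `b` are the small side of a `K_{2,4}` in the union of two paths with the same
colour data, then the one that comes first in the first path is bad there. -/
lemma badVertex_of_common_neighbors {V κ : Type*} {p q : V → ℕ} (hp : Function.Injective p)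
    (hq : Function.Injective q) {χ : V × V → κ}
    (hχ : ∀ v, χ (v, nextVertex p v) = χ (v, nextVertex q v)) {a b : V} (hab : p a < p b)
    {c : Fin 4 → V} (hc : Function.Injective c)
    (ha : ∀ k, Consecutive p a (c k) ∨ Consecutive q a (c k))
    (hb : ∀ k, Consecutive p b (c k) ∨ Consecutive q b (c k)) : BadVertex p χ a := by
  obtain ⟨⟨a₁, ha₁⟩, ⟨a₀, ha₀⟩, -⟩ := four_neighbors hp hq hc ha
  obtain ⟨⟨b₁, hb₁⟩, ⟨b₀, hb₀⟩, -⟩ := four_neighbors hp hq hc hb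
  have hcoin : ∀ u k, (∀ k, Consecutive p u (c k) ∨ Consecutive q u (c k)) →
      ¬ Consecutive p u (c k) → ColorCoincides (nextVertex p) χ u (c k) := by
    intro u k hu hk
    rcases (hu k).resolve_left hk with h | h
    · left
      rw [hχ, nextVertex_eq hq h]
    · right
      rw [hχ, nextVertex_eq hq h]
  have ea₁ := nextVertex_eq hp ha₁
  have ea₀ := prevVertex_eq hp ha₀
  have eb₁ := nextVertex_eq hp hb₁
  have eb₀ := prevVertex_eq hp hb₀
  have hne : p b ≠ p a + 1 := by
    intro h
    have hcb : c a₁ = b := hp (by omega)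
    rcases hb a₁ with h' | h' <;> rw [hcb] at h' <;> rcases h' with h' | h' <;> omega
  by_cases h2 : p b = p a + 2
  · left
    have hbb : nextVertex p (nextVertex p a) = b := by
      rw [ea₁]
      exact nextVertex_eq hp (by omega)
    rw [hbb]
    refine ⟨⟨h2, by rw [ea₀, ha₀], by rw [eb₁, hb₁]⟩, ?_, ?_⟩
    · rw [eb₁]
      exact hcoin a b₁ ha (by unfold Consecutive; omega)
    · rw [ea₀]
      exact hcoin b a₀ hb (by unfold Consecutive; omega)
  · right
    refine ⟨b, ⟨by omega, by rw [ea₁, ha₁], by rw [ea₀, ha₀], by rw [eb₁, hb₁],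
      by rw [eb₀, hb₀]⟩, ?_, ?_, ?_, ?_⟩
    · rw [eb₀]
      exact hcoin a b₀ ha (by unfold Consecutive; omega)
    · rw [eb₁]
      exact hcoin a b₁ ha (by unfold Consecutive; omega)
    · rw [ea₀]
      exact hcoin b a₀ hb (by unfold Consecutive; omega)
    · rw [ea₁]
      exact hcoin b a₁ hb (by unfold Consecutive; omega)

/-- Two paths with the same colour data and the same successors of bad vertices do not have a
`K_{2,4}` in their union. -/
lemma not_common_neighbors {V κ : Type*} {p q : V → ℕ} (hp : Function.Injective p)
    (hq : Function.Injective q) {χ : V × V → κ}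
    (hχ : ∀ v, χ (v, nextVertex p v) = χ (v, nextVertex q v))
    (hbad : ∀ v, BadVertex p χ v → nextVertex p v = nextVertex q v)
    {a b : V} (hab : a ≠ b) {c : Fin 4 → V} (hc : Function.Injective c)
    (ha : ∀ k, Consecutive p a (c k) ∨ Consecutive q a (c k))
    (hb : ∀ k, Consecutive p b (c k) ∨ Consecutive q b (c k)) : False := by
  wlog hlt : p a < p b generalizing a b
  · exact this hab.symm hb ha
      (lt_of_le_of_ne (not_lt.1 hlt) fun h => hab (hp h.symm))
  have hs := hbad a (badVertex_of_common_neighbors hp hq hχ hlt hc ha hb)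
  obtain ⟨⟨k, hk⟩, -, hdisj⟩ := four_neighbors hp hq hc ha
  rw [nextVertex_eq hp hk] at hs
  refine hdisj k (Or.inl hk) ?_
  rcases nextVertex_eq_self_or q a with h | h
  · have hca : c k = a := hs.trans h
    rw [hca] at hk
    omega
  · rw [← hs] at h
    exact Or.inl h

/-- Finsets of bounded size can be listed with padding. -/
lemma Finset.exists_option_listing {α : Type*} (S : Finset α) {T : ℕ} (h : S.card ≤ T) :
    ∃ f : Fin T → Option α, ∀ x, x ∈ S ↔ ∃ t, f t = some x := by
  refine ⟨fun t => if ht : t.1 < S.card then some (S.equivFin.symm ⟨t.1, ht⟩).1 else none,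
    fun x => ⟨fun hx => ?_, ?_⟩⟩
  · refine ⟨⟨(S.equivFin ⟨x, hx⟩).1, (S.equivFin ⟨x, hx⟩).2.trans_le h⟩, ?_⟩
    simp
  · rintro ⟨t, ht⟩
    dsimp only at ht
    split_ifs at ht with h'
    rw [← Option.some.inj ht]
    exact (S.equivFin.symm ⟨t.1, h'⟩).2

open Classical in
/-- A family of linear orders of `V` such that the union of any two of the corresponding paths
contains `K_{2,4}` is not much larger than the number of vertex colourings. -/
lemma card_family_le {ι V κ : Type*} [Fintype ι] [Fintype V] [Fintype κ] (pos : ι → V → ℕ)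
    (hpos : ∀ i, Function.Injective (pos i)) {T : ℕ} (hT : 131584 ≤ T)
    (hκ : 0 < Fintype.card κ) (hV : Fintype.card V ≤ 64 * Fintype.card κ ^ 2)
    (hpair : ∀ i j, i ≠ j → ∃ a b : V, a ≠ b ∧ ∃ c : Fin 4 → V, Function.Injective c ∧
      (∀ k, Consecutive (pos i) a (c k) ∨ Consecutive (pos j) a (c k)) ∧
      ∀ k, Consecutive (pos i) b (c k) ∨ Consecutive (pos j) b (c k)) :
    Fintype.card ι ≤
      2 * (Fintype.card κ ^ Fintype.card V * (Fintype.card V ^ 2 + 1) ^ T) := by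
  have : Nonempty κ := Fintype.card_pos_iff.1 hκ
  let B : ι → (V × V → κ) → Finset V := fun i χ => Finset.univ.filter fun a =>
    BadVertex (pos i) χ a
  obtain ⟨χ, hχ⟩ : ∃ χ : V × V → κ, ∑ i, (B i χ).card ≤ Fintype.card ι * 65792 := by
    have h : ∑ χ : V × V → κ, ∑ i, (B i χ).card ≤
        ∑ _χ : V × V → κ, Fintype.card ι * 65792 := by
      rw [Finset.sum_comm]
      refine (Finset.sum_le_sum fun i _ => sum_card_badVertex_le (pos i) hκ hV).trans_eq ?_
      simp only [Finset.sum_const, Finset.card_univ, smul_eq_mul]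
      ring
    obtain ⟨χ, -, hχ⟩ := Finset.exists_le_of_sum_le Finset.univ_nonempty h
    exact ⟨χ, hχ⟩
  let good : Finset ι := Finset.univ.filter fun i => (B i χ).card ≤ T
  have hgood : Fintype.card ι ≤ 2 * good.card := by
    have h1 : (Finset.univ.filter fun i => ¬ (B i χ).card ≤ T).card * 131584 ≤
        ∑ i, (B i χ).card := by
      rw [← smul_eq_mul]
      refine (Finset.card_nsmul_le_sum _ _ _ fun i hi => ?_).trans
        (Finset.sum_le_sum_of_subset (Finset.filter_subset _ _))
      simp only [Finset.mem_filter, Finset.mem_univ, true_and] at hi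
      omega
    have h2 := Finset.card_filter_add_card_filter_not (s := (Finset.univ : Finset ι))
      (fun i => (B i χ).card ≤ T)
    rw [Finset.card_univ] at h2
    change good.card + _ = _ at h2
    omega
  have hlist : ∀ i : ι, ∃ f : Fin T → Option (V × V), i ∈ good → ∀ x,
      x ∈ (B i χ).image (fun a => (a, nextVertex (pos i) a)) ↔ ∃ t, f t = some x := by
    intro i
    by_cases hi : i ∈ good
    · obtain ⟨f, hf⟩ := Finset.exists_option_listing
        ((B i χ).image (fun a => (a, nextVertex (pos i) a)))
        (Finset.card_image_le.trans (Finset.mem_filter.1 hi).2)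
      exact ⟨f, fun _ => hf⟩
    · exact ⟨fun _ => none, fun h => absurd h hi⟩
  choose f hf using hlist
  let sig : ι → (V → κ) × (Fin T → Option (V × V)) := fun i =>
    (fun v => χ (v, nextVertex (pos i) v), f i)
  have hsig : Set.InjOn sig good := by
    intro i hi j hj hij
    by_contra hne
    obtain ⟨a, b, hab, c, hc, hca, hcb⟩ := hpair i j hne
    simp only [sig, Prod.mk.injEq] at hij
    refine not_common_neighbors (hpos i) (hpos j) (χ := χ) (fun v => congrFun hij.1 v) ?_
      hab hc hca hcb
    intro v hv
    have hmem : (v, nextVertex (pos i) v) ∈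
        (B i χ).image (fun a => (a, nextVertex (pos i) a)) :=
      Finset.mem_image_of_mem _ (by simpa [B] using hv)
    rw [hf i hi, hij.2, ← hf j hj] at hmem
    obtain ⟨w, -, hw⟩ := Finset.mem_image.1 hmem
    simp only [Prod.mk.injEq] at hw
    rw [← hw.2, hw.1]
  have hcard := Finset.card_le_card_of_injOn sig (t := Finset.univ)
    (fun _ _ => Finset.mem_coe.2 (Finset.mem_univ _)) hsig
  rw [Finset.card_univ, Fintype.card_prod, Fintype.card_fun, Fintype.card_fun, Fintype.card_option,
    Fintype.card_prod, Fintype.card_fin, ← pow_two] at hcard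
  exact hgood.trans (Nat.mul_le_mul_left 2 hcard)

lemma SimpleGraph.Walk.IsHamiltonian.injective_idxOf {V : Type*} [DecidableEq V]
    {G : SimpleGraph V} {u v : V} {p : G.Walk u v} (hp : p.IsHamiltonian) :
    Function.Injective fun x => p.support.idxOf x := by
  intro x y hxy
  exact (List.idxOf_inj (hp.mem_support x)).1 hxy

lemma SimpleGraph.Walk.IsPath.consecutive_idxOf {V : Type*} [DecidableEq V]
    {G : SimpleGraph V} {u v : V} {p : G.Walk u v} (hp : p.IsPath) {x y : V}
    (h : p.toSubgraph.Adj x y) : Consecutive (fun x => p.support.idxOf x) x y := by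
  obtain ⟨i, hi, hlt⟩ := (SimpleGraph.Walk.toSubgraph_adj_iff p).1 h
  have hidx : ∀ k, k ≤ p.length → p.support.idxOf (p.getVert k) = k := by
    intro k hk
    have hk' : k < p.support.length := by rw [p.length_support]; omega
    rw [p.getVert_eq_support_getElem hk]
    exact hp.support_nodup.idxOf_getElem k hk'
  have h1 := hidx i hlt.le
  have h2 := hidx (i + 1) hlt
  rcases Sym2.eq_iff.1 hi with ⟨rfl, rfl⟩ | ⟨rfl, rfl⟩
  · left
    simp only [h1, h2]
  · right
    simp only [h1, h2]

lemma exists_common_neighbors_of_containsCopy {n : ℕ} {u v u' v' : Fin n}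
    {p : (⊤ : SimpleGraph (Fin n)).Walk u v} {q : (⊤ : SimpleGraph (Fin n)).Walk u' v'}
    (hp : p.IsHamiltonian) (hq : q.IsHamiltonian)
    (h : ContainsCopy (completeBipartiteGraph (Fin 2) (Fin 4)) (walkUnion p q)) :
    ∃ a b : Fin n, a ≠ b ∧ ∃ c : Fin 4 → Fin n, Function.Injective c ∧
      (∀ k, Consecutive (fun x => p.support.idxOf x) a (c k) ∨
        Consecutive (fun x => q.support.idxOf x) a (c k)) ∧
      ∀ k, Consecutive (fun x => p.support.idxOf x) b (c k) ∨
        Consecutive (fun x => q.support.idxOf x) b (c k) := by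
  obtain ⟨f, hf⟩ := h
  have hadj : ∀ i k, Consecutive (fun x => p.support.idxOf x) (f (Sum.inl i)) (f (Sum.inr k)) ∨
      Consecutive (fun x => q.support.idxOf x) (f (Sum.inl i)) (f (Sum.inr k)) := by
    intro i k
    have := hf (a := Sum.inl i) (b := Sum.inr k) (by simp)
    simp only [walkUnion, Subgraph.spanningCoe_adj, Subgraph.sup_adj] at this
    exact this.imp hp.isPath.consecutive_idxOf hq.isPath.consecutive_idxOf
  exact ⟨f (Sum.inl 0), f (Sum.inl 1), fun h => by simpa using f.injective h,
    fun k => f (Sum.inr k), fun k l hkl => by simpa using f.injective hkl, hadj 0, hadj 1⟩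

lemma eventually_two_mul_sq_add_one_pow_le (T : ℕ) :
    ∃ n₀ : ℕ, ∀ n : ℕ, n₀ ≤ n → 2 * ((n : ℝ) ^ 2 + 1) ^ T ≤ 2 ^ n := by
  have h := tendsto_pow_const_div_const_pow_of_one_lt (2 * T) (one_lt_two (α := ℝ))
  have hpos : (0 : ℝ) < 1 / (2 * 2 ^ T) := by positivity
  obtain ⟨N, hN⟩ := Filter.eventually_atTop.1 (h.eventually_lt_const hpos)
  refine ⟨max N 1, fun n hn => ?_⟩
  have hn1 : (1 : ℝ) ≤ n := by exact_mod_cast (le_max_right N 1).trans hn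
  have hlt := hN n ((le_max_left N 1).trans hn)
  rw [div_lt_div_iff₀ (by positivity) (by positivity), one_mul] at hlt
  calc 2 * ((n : ℝ) ^ 2 + 1) ^ T ≤ 2 * (2 * (n : ℝ) ^ 2) ^ T := by
        gcongr
        nlinarith
    _ = (n : ℝ) ^ (2 * T) * (2 * 2 ^ T) := by rw [mul_pow, ← pow_mul]; ring
    _ ≤ 2 ^ n := hlt.le

/-- `H_n(K_{2,4}) ≤ n^{n/2} · 3^{-n/2 + o(n)}`. -/
theorem Hn_K24_upper :
    ∀ ε : ℝ, 0 < ε → ∃ n₀ : ℕ, ∀ n : ℕ, n₀ ≤ n →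
      ∀ (m : ℕ) (P : Fin m → Σ u : Fin n, Σ v : Fin n, (⊤ : SimpleGraph (Fin n)).Walk u v),
        Function.Injective P →
        (∀ i, (P i).2.2.IsHamiltonian) →
        (∀ i j, i ≠ j →
          ContainsCopy (completeBipartiteGraph (Fin 2) (Fin 4)) (walkUnion (P i).2.2 (P j).2.2)) →
        (m : ℝ) ≤ (n : ℝ) ^ ((n : ℝ) / 2) * (3 : ℝ) ^ (-(n : ℝ) / 2 + ε * n) := by
  intro ε hε
  obtain ⟨T, hT⟩ : ∃ T : ℕ, 131584 ≤ T := ⟨_, le_rfl⟩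
  obtain ⟨n₀, hn₀⟩ := eventually_two_mul_sq_add_one_pow_le T
  refine ⟨max n₀ 16, fun n hn m P _ hham hpair => ?_⟩
  have hn16 : 16 ≤ n := (le_max_right n₀ 16).trans hn
  obtain ⟨K, hK⟩ : ∃ K, K = Nat.sqrt (n / 16) := ⟨_, rfl⟩
  have hK1 : K * K ≤ n / 16 := hK ▸ Nat.sqrt_le (n / 16)
  have hK2 : n / 16 < (K + 1) * (K + 1) := hK ▸ Nat.lt_succ_sqrt (n / 16)
  have hKpos : 0 < K := hK ▸ Nat.sqrt_pos.2 (by omega)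
  have hm := card_family_le (κ := Fin K) (fun i x => (P i).2.2.support.idxOf x)
    (fun i => (hham i).injective_idxOf) hT (by simpa using hKpos)
    (by
      simp only [Fintype.card_fin]
      have : n < 16 * ((K + 1) * (K + 1)) := by omega
      nlinarith)
    (fun i j hij => exists_common_neighbors_of_containsCopy (hham i) (hham j) (hpair i j hij))
  simp only [Fintype.card_fin] at hm
  have hmR : (m : ℝ) ≤ 2 * ((K : ℝ) ^ n * ((n : ℝ) ^ 2 + 1) ^ T) := by exact_mod_cast hm
  have hnpos : (0 : ℝ) < n := by
    have : (16 : ℝ) ≤ n := by exact_mod_cast hn16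
    linarith
  have hK4 : 4 * (K : ℝ) ≤ Real.sqrt n := by
    apply Real.le_sqrt_of_sq_le
    have h : 16 * (K * K) ≤ n := by omega
    have h' : 16 * ((K : ℝ) * K) ≤ n := by exact_mod_cast h
    linarith [h']
  have hsq : (n : ℝ) ^ ((n : ℝ) / 2) = Real.sqrt n ^ n := by
    rw [Real.sqrt_eq_rpow, ← Real.rpow_natCast, ← Real.rpow_mul hnpos.le]
    congr 1
    ring
  have h3 : (1 / 2 : ℝ) ^ n ≤ (3 : ℝ) ^ (-(n : ℝ) / 2 + ε * n) := by
    calc (1 / 2 : ℝ) ^ n = (4 : ℝ) ^ (-(n : ℝ) / 2) := by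
          rw [show (4 : ℝ) = 2 ^ (2 : ℝ) by norm_num, ← Real.rpow_mul (by norm_num),
            show (2 : ℝ) * (-(n : ℝ) / 2) = -n by ring, Real.rpow_neg (by norm_num),
            Real.rpow_natCast, one_div, inv_pow]
      _ ≤ (3 : ℝ) ^ (-(n : ℝ) / 2) :=
          Real.rpow_le_rpow_of_nonpos (by norm_num) (by norm_num) (by linarith)
      _ ≤ (3 : ℝ) ^ (-(n : ℝ) / 2 + ε * n) :=
          Real.rpow_le_rpow_of_exponent_le (by norm_num) (by nlinarith)
  calc (m : ℝ) ≤ (K : ℝ) ^ n * (2 * ((n : ℝ) ^ 2 + 1) ^ T) := by linarith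
    _ ≤ (K : ℝ) ^ n * 2 ^ n := by
        gcongr
        exact hn₀ n ((le_max_left n₀ 16).trans hn)
    _ = (4 * (K : ℝ)) ^ n * (1 / 2) ^ n := by
        rw [← mul_pow, ← mul_pow]
        congr 1
        ring
    _ ≤ (n : ℝ) ^ ((n : ℝ) / 2) * (3 : ℝ) ^ (-(n : ℝ) / 2 + ε * n) := by
        rw [hsq]
        gcongr
end

section
/- There exist c > 0, K > 0 and n₀ such that the following holds. Let G be a graph on n ≥ n₀ vertices with average degree d, minimum degree δ, maximum degree Δ, adjacency matrix A, and suppose λ̄ > 0 is such that for all vertex subsets U, W we have |e(U,W) − (d/n)·|U|·|W|| ≤ λ̄·√(|U|·|W|), that Δ − δ ≤ λ̄, and that d ≥ K·λ̄·(log n)². Then the permanent of A, i.e. per(A) = Σ_{σ ∈ Sₙ} Π_{i=1}^n A_{i,σ(i)}, satisfies per(A) ≥ (Δ/e)^n · e^{−20n/(log Δ)²}. -/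
open SimpleGraph

/-- The degree of a vertex. -/
noncomputable def degOf {n : ℕ} (G : SimpleGraph (Fin n)) (v : Fin n) : ℕ :=
  (G.neighborSet v).ncard

/-- The average degree of `G`. -/
noncomputable def avgDeg {n : ℕ} (G : SimpleGraph (Fin n)) : ℝ :=
  (∑ v : Fin n, (degOf G v : ℝ)) / n

/-- `e(U,W)`: the number of ordered pairs `(u,w)`, `u ∈ U`, `w ∈ W`, `uw ∈ E(G)`. -/
noncomputable def ePairs {n : ℕ} (G : SimpleGraph (Fin n)) (U W : Set (Fin n)) : ℕ :=
  {p : Fin n × Fin n | p.1 ∈ U ∧ p.2 ∈ W ∧ G.Adj p.1 p.2}.ncard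
/-- The minimum degree of `G`. -/
noncomputable def minDeg {n : ℕ} (G : SimpleGraph (Fin n)) : ℕ := sInf (Set.range (degOf G))

/-- The maximum degree of `G`. -/
noncomputable def maxDeg {n : ℕ} (G : SimpleGraph (Fin n)) : ℕ := sSup (Set.range (degOf G))

open Classical in
/-- The adjacency matrix of `G`, with real entries. -/
noncomputable def adjMat {n : ℕ} (G : SimpleGraph (Fin n)) : Matrix (Fin n) (Fin n) ℝ :=
  Matrix.of fun i j => if G.Adj i j then 1 else 0

/-- A complex polynomial is strictly stable if it has no zero in the closed right half-space
other than purely imaginary points. -/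
def IsStrictlyStable {k : ℕ} (p : MvPolynomial (Fin k) ℂ) : Prop :=
  ∀ z : Fin k → ℂ, (∀ i, 0 ≤ (z i).re) → (∃ i, 0 < (z i).re) → MvPolynomial.eval z p ≠ 0

/-- The restriction of `p` to the line obtained by fixing all variables but the first. -/
noncomputable def restrictTail {k : ℕ} (p : MvPolynomial (Fin (k + 1)) ℂ) (z : Fin k → ℂ) :
    Polynomial ℂ :=
  (MvPolynomial.finSuccEquiv ℂ k p).map (MvPolynomial.eval z)

/-- The coefficient of the first variable in `p`, as a polynomial in the other variables. -/
noncomputable def linearCoeff {k : ℕ} (p : MvPolynomial (Fin (k + 1)) ℂ) :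
    MvPolynomial (Fin k) ℂ :=
  (MvPolynomial.finSuccEquiv ℂ k p).coeff 1

section Stability

variable {k : ℕ} {p : MvPolynomial (Fin (k + 1)) ℂ}

lemma eval_restrictTail (z : Fin k → ℂ) (t : ℂ) :
    (restrictTail p z).eval t = MvPolynomial.eval (Fin.cons t z : Fin (k + 1) → ℂ) p :=
  (MvPolynomial.eval_eq_eval_mv_eval' z t p).symm

lemma coeff_one_restrictTail (z : Fin k → ℂ) :
    (restrictTail p z).coeff 1 = MvPolynomial.eval z (linearCoeff p) := by
  simp [restrictTail, linearCoeff, Polynomial.coeff_map]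

lemma coeff_restrictTail_zero (hp : p.IsHomogeneous (k + 1)) {i : ℕ} (hi : i ≠ k + 1) :
    (restrictTail p 0).coeff i = 0 := by
  rw [restrictTail, Polynomial.coeff_map, MvPolynomial.eval_zero,
    MvPolynomial.constantCoeff_eq, MvPolynomial.finSuccEquiv_coeff_coeff]
  apply hp.coeff_eq_zero
  simpa [Finsupp.degree_eq_sum, Fin.sum_univ_succ] using hi

lemma restrictTail_zero (hp : p.IsHomogeneous (k + 1)) :
    restrictTail p 0 = Polynomial.monomial (k + 1)
      (MvPolynomial.eval (Fin.cons 1 0 : Fin (k + 1) → ℂ) p) := by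
  have h : restrictTail p 0 =
      Polynomial.monomial (k + 1) ((restrictTail p 0).coeff (k + 1)) := by
    ext i
    rw [Polynomial.coeff_monomial]
    split_ifs with hi
    · rw [hi]
    · exact coeff_restrictTail_zero hp (Ne.symm hi)
  rw [h, ← eval_restrictTail, h]
  simp

lemma linearCoeff_isHomogeneous (hp : p.IsHomogeneous (k + 1)) :
    (linearCoeff p).IsHomogeneous k :=
  hp.finSuccEquiv_coeff_isHomogeneous 1 k (by omega)

lemma coeff_linearCoeff (m : Fin k →₀ ℕ) :
    (linearCoeff p).coeff m = p.coeff (m.cons 1) :=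
  MvPolynomial.finSuccEquiv_coeff_coeff m p 1

lemma coeff_top_restrictTail (hp : p.IsHomogeneous (k + 1)) (z : Fin k → ℂ) :
    (restrictTail p z).coeff (k + 1) =
      MvPolynomial.eval (Fin.cons 1 0 : Fin (k + 1) → ℂ) p := by
  have hhom := hp.finSuccEquiv_coeff_isHomogeneous (k + 1) 0 (by omega)
  have hc : ∀ w : Fin k → ℂ, (restrictTail p w).coeff (k + 1) =
      ((MvPolynomial.finSuccEquiv ℂ k p).coeff (k + 1)).coeff 0 := by
    intro w
    rw [restrictTail, Polynomial.coeff_map]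
    conv_lhs => rw [MvPolynomial.totalDegree_eq_zero_iff_eq_C.1
      (Nat.le_zero.1 hhom.totalDegree_le)]
    simp
  rw [hc z, ← hc 0, restrictTail_zero hp]
  simp

lemma IsStrictlyStable.natDegree_pos (hs : IsStrictlyStable p) (hp : p.IsHomogeneous (k + 1))
    (z : Fin k → ℂ) : 0 < (restrictTail p z).natDegree := by
  have hne : (restrictTail p z).coeff (k + 1) ≠ 0 := by
    rw [coeff_top_restrictTail hp]
    refine hs _ (fun i => ?_) ⟨0, by simp⟩
    refine Fin.cases ?_ (fun j => ?_) i <;> simp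
  exact lt_of_lt_of_le (Nat.succ_pos k) (Polynomial.le_natDegree_of_ne_zero hne)

lemma coeff_one_div_eval_zero {R : Polynomial ℂ} (h0 : R.eval 0 ≠ 0) :
    R.coeff 1 / R.eval 0 = (R.roots.map fun ρ => -ρ⁻¹).sum := by
  have h := (IsAlgClosed.splits R).eval_derivative_div_eval_of_ne_zero h0
  rw [← Polynomial.coeff_zero_eq_eval_zero, Polynomial.coeff_derivative] at h
  simpa using h

lemma re_multiset_sum_map (s : Multiset ℂ) (f : ℂ → ℂ) :
    (s.map f).sum.re = (s.map fun x => (f x).re).sum := by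
  induction s using Multiset.induction_on with
  | empty => simp
  | cons a s ih => simp [ih]

lemma coeff_one_ne_zero_of_roots_re_neg {R : Polynomial ℂ} (hd : 0 < R.natDegree)
    (hR : ∀ t : ℂ, 0 ≤ t.re → R.eval t ≠ 0) : R.coeff 1 ≠ 0 := by
  intro h1
  have h := coeff_one_div_eval_zero (hR 0 (by simp))
  rw [h1, zero_div] at h
  have hre : (R.roots.map fun ρ => (-ρ⁻¹).re).sum = 0 := by
    rw [← re_multiset_sum_map, ← h, Complex.zero_re]
  have hneg : ∀ ρ ∈ R.roots, 0 < (-ρ⁻¹).re := by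
    intro ρ hρ
    have hroot : R.eval ρ = 0 := (Polynomial.mem_roots'.1 hρ).2
    have hlt : ρ.re < 0 := by
      by_contra hge
      exact hR ρ (not_lt.1 hge) hroot
    have hρ0 : ρ ≠ 0 := by
      rintro rfl
      simp at hlt
    have : 0 < Complex.normSq ρ := Complex.normSq_pos.2 hρ0
    rw [Complex.neg_re, Complex.inv_re, ← neg_div]
    exact div_pos (by linarith) this
  have hcard : R.roots ≠ 0 := by
    intro h0
    have hc := (IsAlgClosed.splits R).natDegree_eq_card_roots
    rw [h0, Multiset.card_zero] at hc
    omega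
  obtain ⟨ρ, hρ⟩ := Multiset.exists_mem_of_ne_zero hcard
  obtain ⟨s, hs⟩ := Multiset.exists_cons_of_mem hρ
  rw [hs, Multiset.map_cons, Multiset.sum_cons] at hre
  have hs0 : 0 ≤ (s.map fun ρ => (-ρ⁻¹).re).sum := by
    apply Multiset.sum_nonneg
    intro x hx
    obtain ⟨y, hy, rfl⟩ := Multiset.mem_map.1 hx
    exact (hneg y (hs ▸ Multiset.mem_cons_of_mem hy)).le
  linarith [hneg ρ hρ]

lemma norm_eval_le_exp_of_roots_neg {R : Polynomial ℂ}
    (hR : ∀ ρ : ℂ, R.eval ρ = 0 → ρ.im = 0 ∧ ρ.re < 0) {t : ℝ} (ht : 0 ≤ t) :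
    ‖R.eval (t : ℂ)‖ ≤ ‖R.eval 0‖ * Real.exp (t * (R.coeff 1 / R.eval 0).re) := by
  have h0 : R.eval 0 ≠ 0 := by
    intro h
    simpa using (hR 0 h).2
  have key : ∀ s : Multiset ℂ, (∀ ρ ∈ s, ρ.im = 0 ∧ ρ.re < 0) →
      ‖(s.map fun ρ => (t : ℂ) - ρ).prod‖ ≤ ‖(s.map fun ρ => (0 : ℂ) - ρ).prod‖ *
        Real.exp (t * (s.map fun ρ => (-ρ⁻¹).re).sum) := by
    intro s
    induction s using Multiset.induction_on with
    | empty => simp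
    | cons ρ s ih =>
      intro hs
      have ih' := ih fun x hx => hs x (Multiset.mem_cons_of_mem hx)
      obtain ⟨him, hre⟩ := hs ρ (Multiset.mem_cons_self ρ s)
      obtain ⟨r, rfl⟩ : ∃ r : ℝ, ρ = r := ⟨ρ.re, Complex.ext rfl (by simpa using him)⟩
      rw [Complex.ofReal_re] at hre
      have hfac : ‖(t : ℂ) - r‖ ≤ ‖(0 : ℂ) - r‖ * Real.exp (t * (-(r : ℂ)⁻¹).re) := by
        rw [← Complex.ofReal_sub, zero_sub, norm_neg, ← Complex.ofReal_inv, ← Complex.ofReal_neg,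
          Complex.ofReal_re, Complex.norm_real, Complex.norm_real, Real.norm_of_nonneg (by linarith),
          Real.norm_of_nonpos hre.le]
        have hexp := Real.add_one_le_exp (t * -r⁻¹)
        have hinv : r * r⁻¹ = 1 := mul_inv_cancel₀ hre.ne
        calc t - r = -r * (t * -r⁻¹ + 1) := by linear_combination (-t) * hinv
          _ ≤ _ := mul_le_mul_of_nonneg_left hexp (by linarith)
      simp only [Multiset.map_cons, Multiset.prod_cons, Multiset.sum_cons, norm_mul, mul_add,
        Real.exp_add]
      calc _ ≤ (‖(0 : ℂ) - r‖ * Real.exp (t * (-(r : ℂ)⁻¹).re)) *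
            (‖(s.map fun ρ => (0 : ℂ) - ρ).prod‖ *
              Real.exp (t * (s.map fun ρ => (-ρ⁻¹).re).sum)) := by gcongr
        _ = _ := by ring
  have hk := key R.roots fun ρ hρ => hR ρ (Polynomial.mem_roots'.1 hρ).2
  rw [coeff_one_div_eval_zero h0, re_multiset_sum_map, (IsAlgClosed.splits R).eval_eq_prod_roots,
    (IsAlgClosed.splits R).eval_eq_prod_roots 0, norm_mul, norm_mul, mul_assoc]
  gcongr

lemma IsStrictlyStable.linearCoeff (hs : IsStrictlyStable p) (hp : p.IsHomogeneous (k + 1)) :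
    IsStrictlyStable (linearCoeff p) := by
  rintro z hz ⟨i, hi⟩
  rw [← coeff_one_restrictTail]
  apply coeff_one_ne_zero_of_roots_re_neg (hs.natDegree_pos hp z)
  intro t ht
  rw [eval_restrictTail]
  refine hs _ (fun j => ?_) ⟨i.succ, by simpa using hi⟩
  refine Fin.cases ?_ (fun j => ?_) j
  · simpa using ht
  · simpa using hz j

lemma MvPolynomial.IsHomogeneous.eval_mul {σ : Type*} [Fintype σ] {q : MvPolynomial σ ℂ} {m : ℕ}
    (hq : q.IsHomogeneous m) (u : ℂ) (z : σ → ℂ) :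
    MvPolynomial.eval (fun i => u * z i) q = u ^ m * MvPolynomial.eval z q := by
  rw [MvPolynomial.eval_eq', MvPolynomial.eval_eq', Finset.mul_sum]
  refine Finset.sum_congr rfl fun d hd => ?_
  have hdeg : ∑ i, d i = m := by
    rw [← Finsupp.degree_eq_sum]
    by_contra h
    exact MvPolynomial.mem_support_iff.1 hd (hq.coeff_eq_zero h)
  simp_rw [mul_pow, Finset.prod_mul_distrib, Finset.prod_pow_eq_pow_sum, hdeg]
  ring

lemma IsStrictlyStable.roots_neg (hs : IsStrictlyStable p) (hp : p.IsHomogeneous (k + 1))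
    {x : Fin k → ℝ} (hx : ∀ i, 0 < x i) (hk : 0 < k) {t : ℂ}
    (ht : (restrictTail p fun i => (x i : ℂ)).eval t = 0) : t.im = 0 ∧ t.re < 0 := by
  rw [eval_restrictTail] at ht
  have h0 : t ≠ 0 := by
    rintro rfl
    refine hs _ (fun j => ?_) ⟨Fin.succ ⟨0, hk⟩, by
      rw [Fin.cons_succ, Complex.ofReal_re]
      exact hx _⟩ ht
    refine Fin.cases ?_ (fun j => ?_) j
    · simp
    · simpa using (hx j).le
  by_contra hcon
  have hpos : 0 < ‖t‖ + t.re := by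
    have h1 := Complex.abs_re_le_norm t
    rcases (abs_le.1 h1).1.lt_or_eq with h | h
    · linarith
    · exfalso
      apply hcon
      have hsq := Complex.sq_norm t
      rw [Complex.normSq_apply] at hsq
      have him : t.im = 0 := by
        rw [show ‖t‖ = -t.re by linarith] at hsq
        exact mul_self_eq_zero.1 (by linarith)
      exact ⟨him, by linarith [norm_pos_iff.2 h0]⟩
  set u : ℂ := ‖t‖ + (starRingEnd ℂ) t with hu
  have hmul := hp.eval_mul u (Fin.cons t fun i => (x i : ℂ))
  rw [ht, mul_zero] at hmul
  refine hs _ (fun j => ?_) ⟨Fin.succ ⟨0, hk⟩, ?_⟩ hmul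
  · refine Fin.cases ?_ (fun j => ?_) j
    · have hre : (u * t).re = ‖t‖ * t.re + ‖t‖ ^ 2 := by
        rw [Complex.sq_norm, Complex.normSq_apply, hu]
        simp
        ring
      rw [Fin.cons_zero, hre]
      nlinarith [norm_nonneg t]
    · simp only [Fin.cons_succ, Complex.mul_re, Complex.ofReal_re, Complex.ofReal_im, mul_zero,
        sub_zero]
      exact mul_nonneg (by simpa [hu] using hpos.le) (hx j).le
  · simp only [Fin.cons_succ, Complex.mul_re, Complex.ofReal_re, Complex.ofReal_im, mul_zero,
      sub_zero]
    exact mul_pos (by simpa [hu] using hpos) (hx _)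

lemma IsStrictlyStable.capacity_linearCoeff (hs : IsStrictlyStable p)
    (hp : p.IsHomogeneous (k + 1)) {C : ℝ} (hC : 0 ≤ C)
    (hcap : ∀ x : Fin (k + 1) → ℝ, (∀ i, 0 < x i) →
      C * ∏ i, x i ≤ ‖MvPolynomial.eval (fun i => (x i : ℂ)) p‖)
    (x : Fin k → ℝ) (hx : ∀ i, 0 < x i) :
    C * Real.exp (-1) * ∏ i, x i ≤
      ‖MvPolynomial.eval (fun i => (x i : ℂ)) (_root_.linearCoeff p)‖ := by
  set R := restrictTail p fun i => (x i : ℂ) with hR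
  have hbound : ∀ t : ℝ, 0 < t → C * (t * ∏ i, x i) ≤ ‖R.eval (t : ℂ)‖ := by
    intro t ht
    have h := hcap (Fin.cons t x) (fun i => by
      refine Fin.cases ?_ (fun j => ?_) i
      · simpa using ht
      · simpa using hx j)
    rw [Fin.prod_univ_succ] at h
    have hc : (fun i => ((Fin.cons t x : Fin (k + 1) → ℝ) i : ℂ)) =
        (Fin.cons (t : ℂ) fun i => (x i : ℂ) : Fin (k + 1) → ℂ) := by
      ext i
      refine Fin.cases ?_ (fun j => ?_) i <;> simp
    rw [hc] at h
    simpa [hR, eval_restrictTail] using h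
  rw [← coeff_one_restrictTail, ← hR]
  have hprod : 0 < ∏ i, x i := Finset.prod_pos fun i _ => hx i
  rcases Nat.eq_zero_or_pos k with rfl | hk
  · have hx0 : (fun i : Fin 0 => (x i : ℂ)) = 0 := Subsingleton.elim _ _
    have hmon := restrictTail_zero hp
    rw [← hx0, ← hR] at hmon
    have h1 := hbound 1 one_pos
    have he : Real.exp (-1) ≤ 1 := Real.exp_le_one_iff.2 (by norm_num)
    have hcoeff : R.coeff 1 = R.eval ((1 : ℝ) : ℂ) := by
      rw [hmon]
      simp
    rw [hcoeff]
    refine le_trans ?_ h1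
    rw [one_mul]
    exact mul_le_mul_of_nonneg_right (mul_le_of_le_one_right hC he) hprod.le
  · have hroots : ∀ ρ : ℂ, R.eval ρ = 0 → ρ.im = 0 ∧ ρ.re < 0 :=
      fun ρ hρ => hs.roots_neg hp hx hk hρ
    have hne0 : R.eval 0 ≠ 0 := by
      intro h
      simpa using (hroots 0 h).2
    have hne1 : R.coeff 1 ≠ 0 := by
      rw [hR, coeff_one_restrictTail]
      exact hs.linearCoeff hp _ (fun i => by simpa using (hx i).le)
        ⟨⟨0, hk⟩, by simpa using hx _⟩
    have ha : 0 < ‖R.eval 0‖ := norm_pos_iff.2 hne0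
    have hb : 0 < ‖R.coeff 1‖ := norm_pos_iff.2 hne1
    set t : ℝ := ‖R.eval 0‖ / ‖R.coeff 1‖ with ht
    have htpos : 0 < t := div_pos ha hb
    have h1 := (hbound t htpos).trans (norm_eval_le_exp_of_roots_neg hroots htpos.le)
    have h2 : t * (R.coeff 1 / R.eval 0).re ≤ 1 := by
      calc t * (R.coeff 1 / R.eval 0).re ≤ t * ‖R.coeff 1 / R.eval 0‖ :=
            mul_le_mul_of_nonneg_left (Complex.re_le_norm _) htpos.le
        _ = 1 := by
            rw [norm_div, ht]
            field_simp
    have h3 : C * (t * ∏ i, x i) ≤ (t * ‖R.coeff 1‖) * Real.exp 1 := by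
      have : t * ‖R.coeff 1‖ = ‖R.eval 0‖ := by
        rw [ht]
        field_simp
      rw [this]
      refine h1.trans ?_
      gcongr
    have h4 : C * ∏ i, x i ≤ ‖R.coeff 1‖ * Real.exp 1 := by
      refine le_of_mul_le_mul_left ?_ htpos
      linarith
    calc C * Real.exp (-1) * ∏ i, x i = (C * ∏ i, x i) * Real.exp (-1) := by ring
      _ ≤ ‖R.coeff 1‖ * Real.exp 1 * Real.exp (-1) := by gcongr
      _ = ‖R.coeff 1‖ := by rw [mul_assoc, ← Real.exp_add]; simp

end Stability

/-- The capacity inequality of Gurvits: the coefficient of the square-free monomial of a stable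
homogeneous polynomial is at least its capacity divided by `e ^ k`. -/
theorem IsStrictlyStable.capacity_le_coeff {k : ℕ} {p : MvPolynomial (Fin k) ℂ}
    (hs : IsStrictlyStable p) (hp : p.IsHomogeneous k) {C : ℝ} (hC : 0 ≤ C)
    (hcap : ∀ x : Fin k → ℝ, (∀ i, 0 < x i) →
      C * ∏ i, x i ≤ ‖MvPolynomial.eval (fun i => (x i : ℂ)) p‖) :
    C * Real.exp (-k) ≤ ‖p.coeff (Finsupp.equivFunOnFinite.symm fun _ => 1)‖ := by
  induction k generalizing C with
  | zero =>
    have h := hcap 0 (fun i => i.elim0)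
    rw [MvPolynomial.eq_C_of_isEmpty p] at h
    have he : (Finsupp.equivFunOnFinite.symm fun _ => 1 : Fin 0 →₀ ℕ) = 0 :=
      Subsingleton.elim _ _
    rw [he]
    simpa using h
  | succ k ih =>
    have h := ih (hs.linearCoeff hp) (linearCoeff_isHomogeneous hp)
      (mul_nonneg hC (Real.exp_pos _).le) (hs.capacity_linearCoeff hp hC hcap)
    rw [coeff_linearCoeff, mul_assoc, ← Real.exp_add] at h
    have hones : (Finsupp.equivFunOnFinite.symm fun _ => 1 : Fin k →₀ ℕ).cons 1 =
        Finsupp.equivFunOnFinite.symm fun _ => 1 := by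
      ext i
      refine Fin.cases ?_ (fun j => ?_) i <;> simp
    rw [hones] at h
    have hexp : (-1 + -(k : ℝ)) = -((k + 1 : ℕ) : ℝ) := by
      push_cast
      ring
    rwa [hexp] at h

section Permanent

variable {n : ℕ}

/-- The product of the linear forms given by the rows of a matrix. -/
noncomputable def rowProduct (a : Matrix (Fin n) (Fin n) ℝ) : MvPolynomial (Fin n) ℂ :=
  ∏ i, ∑ j, MvPolynomial.C (a i j : ℂ) * MvPolynomial.X j

lemma eval_rowProduct (a : Matrix (Fin n) (Fin n) ℝ) (z : Fin n → ℂ) :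
    MvPolynomial.eval z (rowProduct a) = ∏ i, ∑ j, (a i j : ℂ) * z j := by
  simp [rowProduct]

lemma rowProduct_isHomogeneous (a : Matrix (Fin n) (Fin n) ℝ) :
    (rowProduct a).IsHomogeneous n := by
  have h := MvPolynomial.IsHomogeneous.prod Finset.univ
    (fun i => ∑ j, MvPolynomial.C (a i j : ℂ) * MvPolynomial.X j) (fun _ => 1)
    (fun i _ => MvPolynomial.IsHomogeneous.sum _ _ _ fun j _ => by
      simpa using (MvPolynomial.isHomogeneous_C (Fin n) (a i j : ℂ)).mul
        (MvPolynomial.isHomogeneous_X ℂ j))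
  simpa [rowProduct] using h

lemma rowProduct_isStrictlyStable {a : Matrix (Fin n) (Fin n) ℝ} (ha : ∀ i j, 0 < a i j) :
    IsStrictlyStable (rowProduct a) := by
  rintro z hz ⟨l, hl⟩
  rw [eval_rowProduct, Finset.prod_ne_zero_iff]
  intro i _ h
  have hre : ∑ j, a i j * (z j).re = 0 := by
    have := congrArg Complex.re h
    simpa [Complex.re_sum] using this
  have hpos : 0 < ∑ j, a i j * (z j).re :=
    Finset.sum_pos' (fun j _ => mul_nonneg (ha i j).le (hz j))
      ⟨l, Finset.mem_univ l, mul_pos (ha i l) hl⟩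
  exact hpos.ne' hre

lemma coeff_rowProduct (a : Matrix (Fin n) (Fin n) ℝ) :
    (rowProduct a).coeff (Finsupp.equivFunOnFinite.symm fun _ => 1) = (a.permanent : ℂ) := by
  have hmon : ∀ f : Fin n → Fin n,
      ∏ i, (MvPolynomial.C (a i (f i) : ℂ) * MvPolynomial.X (f i) : MvPolynomial (Fin n) ℂ) =
        MvPolynomial.monomial (∑ i, Finsupp.single (f i) 1) (∏ i, (a i (f i) : ℂ)) := by
    intro f
    rw [MvPolynomial.monomial_sum_prod]
    exact Finset.prod_congr rfl fun i _ => MvPolynomial.C_mul_X_eq_monomial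
  rw [← Matrix.permanent_transpose, Matrix.permanent, rowProduct, Finset.prod_univ_sum,
    Fintype.piFinset_univ, MvPolynomial.coeff_sum, Complex.ofReal_sum]
  symm
  refine Finset.sum_of_injOn (fun σ : Equiv.Perm (Fin n) => (σ : Fin n → Fin n))
    (fun σ _ τ _ h => DFunLike.coe_injective h) (fun _ _ => by simp) ?_ ?_
  · intro f _ hf
    rw [hmon, MvPolynomial.coeff_monomial, if_neg]
    intro heq
    apply hf
    have hsurj : Function.Surjective f := by
      intro j
      by_contra! hj
      have := DFunLike.congr_fun heq j
      simp [Finsupp.finsetSum_apply, hj] at this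
    exact ⟨Equiv.ofBijective f (Finite.surjective_iff_bijective.1 hsurj), by simp, rfl⟩
  · intro σ _
    have hσ : ∑ i, Finsupp.single (σ i) 1 =
        (Finsupp.equivFunOnFinite.symm fun _ => 1 : Fin n →₀ ℕ) := by
      rw [Equiv.sum_comp σ fun i => Finsupp.single i 1]
      ext j
      simp [Finsupp.finsetSum_apply, Finsupp.single_apply]
    rw [hmon, MvPolynomial.coeff_monomial, if_pos hσ]
    simp

lemma capacity_le_permanent_of_pos {a : Matrix (Fin n) (Fin n) ℝ} (ha : ∀ i j, 0 < a i j)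
    {C : ℝ} (hC : 0 ≤ C)
    (hcap : ∀ x : Fin n → ℝ, (∀ i, 0 < x i) → C * ∏ i, x i ≤ ∏ i, ∑ j, a i j * x j) :
    C * Real.exp (-n) ≤ a.permanent := by
  have hperm : 0 ≤ a.permanent :=
    Finset.sum_nonneg fun σ _ => Finset.prod_nonneg fun i _ => (ha _ _).le
  have h := (rowProduct_isStrictlyStable ha).capacity_le_coeff (rowProduct_isHomogeneous a) hC
    fun x hx => by
      refine (hcap x hx).trans ?_
      have he : MvPolynomial.eval (fun i => (x i : ℂ)) (rowProduct a) =
          ((∏ i, ∑ j, a i j * x j : ℝ) : ℂ) := by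
        rw [eval_rowProduct]
        push_cast
        rfl
      rw [he, Complex.norm_real]
      exact Real.le_norm_self _
  rwa [coeff_rowProduct, Complex.norm_real, Real.norm_of_nonneg hperm] at h

/-- The permanent of a nonnegative matrix is at least its capacity divided by `e ^ n`. -/
theorem capacity_le_permanent {a : Matrix (Fin n) (Fin n) ℝ} (ha : ∀ i j, 0 ≤ a i j)
    {C : ℝ} (hC : 0 ≤ C)
    (hcap : ∀ x : Fin n → ℝ, (∀ i, 0 < x i) → C * ∏ i, x i ≤ ∏ i, ∑ j, a i j * x j) :
    C * Real.exp (-n) ≤ a.permanent := by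
  have hcont : Continuous fun ε : ℝ =>
      (Matrix.of fun i j => a i j + ε : Matrix (Fin n) (Fin n) ℝ).permanent := by
    simp only [Matrix.permanent, Matrix.of_apply]
    fun_prop
  have hlim : Filter.Tendsto (fun ε : ℝ =>
      (Matrix.of fun i j => a i j + ε : Matrix (Fin n) (Fin n) ℝ).permanent)
      (nhdsWithin 0 (Set.Ioi 0)) (nhds a.permanent) := by
    have h := (hcont.tendsto 0).mono_left (nhdsWithin_le_nhds (s := Set.Ioi 0))
    simp only [add_zero] at h
    exact h
  refine ge_of_tendsto hlim ?_
  filter_upwards [self_mem_nhdsWithin] with ε hε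
  have hε' : (0 : ℝ) < ε := hε
  refine capacity_le_permanent_of_pos (fun i j => add_pos_of_nonneg_of_pos (ha i j) hε') hC
    fun x hx => (hcap x hx).trans ?_
  refine Finset.prod_le_prod
    (fun i _ => Finset.sum_nonneg fun j _ => mul_nonneg (ha i j) (hx j).le) fun i _ => ?_
  refine Finset.sum_le_sum fun j _ => mul_le_mul_of_nonneg_right ?_ (hx j).le
  simpa using hε'.le

open MeasureTheory in
lemma cut_condition_weighted {a : Matrix (Fin n) (Fin n) ℝ} {r : ℝ}
    (hcut : ∀ U W : Finset (Fin n),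
      r * ((U.card : ℝ) + W.card - n) ≤ ∑ i ∈ U, ∑ j ∈ W, a i j) (α β : Fin n → ℝ) :
    r * (∑ i, α i + ∑ j, β j) ≤ ∑ i, ∑ j, a i j * max 0 (α i + β j) := by
  classical
  set M : ℝ := ∑ i, |α i| + ∑ j, |β j| with hM
  have hα : ∀ i, |α i| ≤ M := fun i =>
    (Finset.single_le_sum (fun j _ => abs_nonneg (α j)) (Finset.mem_univ i)).trans
      (le_add_of_nonneg_right (Finset.sum_nonneg fun j _ => abs_nonneg _))
  have hβ : ∀ j, |β j| ≤ M := fun j =>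
    (Finset.single_le_sum (fun j _ => abs_nonneg (β j)) (Finset.mem_univ j)).trans
      (le_add_of_nonneg_left (Finset.sum_nonneg fun j _ => abs_nonneg _))
  have hM0 : 0 ≤ M := by positivity
  set ν : Measure ℝ := volume.restrict (Set.Ioc (-M) M) with hν
  set u : Fin n → ℝ → ℝ := fun i => (Set.Iio (α i)).indicator 1 with hu
  set w : Fin n → ℝ → ℝ := fun j => (Set.Ioi (-β j)).indicator 1 with hw
  set v : Fin n → Fin n → ℝ → ℝ := fun i j => (Set.Ioo (-β j) (α i)).indicator 1 with hv
  have hintegrable : ∀ s : Set ℝ, MeasurableSet s → Integrable (s.indicator (1 : ℝ → ℝ)) ν :=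
    fun s hs => (integrable_const (1 : ℝ)).indicator hs
  have hiu : ∀ i, Integrable (u i) ν := fun i => hintegrable _ measurableSet_Iio
  have hiw : ∀ j, Integrable (w j) ν := fun j => hintegrable _ measurableSet_Ioi
  have hiv : ∀ i j, Integrable (v i j) ν := fun i j => hintegrable _ measurableSet_Ioo
  have hmeas : ∀ s : Set ℝ, MeasurableSet s →
      ∫ t, s.indicator (1 : ℝ → ℝ) t ∂ν = volume.real (s ∩ Set.Ioc (-M) M) := by
    intro s hs
    rw [integral_indicator_one hs, hν, measureReal_restrict_apply hs]
  have hIu : ∀ i, ∫ t, u i t ∂ν = α i + M := by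
    intro i
    have h := abs_le.1 (hα i)
    rw [hmeas _ measurableSet_Iio]
    have hset : volume.real (Set.Iio (α i) ∩ Set.Ioc (-M) M) = volume.real (Set.Ioo (-M) (α i)) := by
      congr 1
      ext t
      simp only [Set.mem_inter_iff, Set.mem_Iio, Set.mem_Ioc, Set.mem_Ioo]
      constructor
      · rintro ⟨h1, h2, h3⟩
        exact ⟨h2, h1⟩
      · rintro ⟨h1, h2⟩
        exact ⟨h2, h1, by linarith⟩
    rw [hset, Real.volume_real_Ioo_of_le h.1]
    ring
  have hIw : ∀ j, ∫ t, w j t ∂ν = β j + M := by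
    intro j
    have h := abs_le.1 (hβ j)
    rw [hmeas _ measurableSet_Ioi]
    have hset : Set.Ioi (-β j) ∩ Set.Ioc (-M) M = Set.Ioc (-β j) M := by
      ext t
      simp only [Set.mem_inter_iff, Set.mem_Ioi, Set.mem_Ioc]
      constructor
      · rintro ⟨h1, h2, h3⟩
        exact ⟨h1, h3⟩
      · rintro ⟨h1, h2⟩
        exact ⟨h1, by linarith, h2⟩
    rw [hset, Real.volume_real_Ioc_of_le (by linarith)]
    ring
  have hIv : ∀ i j, ∫ t, v i j t ∂ν = max 0 (α i + β j) := by
    intro i j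
    have h := abs_le.1 (hα i)
    have h' := abs_le.1 (hβ j)
    rw [hmeas _ measurableSet_Ioo]
    have hset : Set.Ioo (-β j) (α i) ∩ Set.Ioc (-M) M = Set.Ioo (-β j) (α i) := by
      ext t
      simp only [Set.mem_inter_iff, Set.mem_Ioo, Set.mem_Ioc]
      constructor
      · exact fun h => h.1
      · rintro ⟨h1, h2⟩
        exact ⟨⟨h1, h2⟩, by linarith, by linarith⟩
    rw [hset, Real.volume_real_Ioo, max_comm, sub_neg_eq_add]
  have hpt : ∀ t, r * (∑ i, u i t + ∑ j, w j t - n) ≤ ∑ i, ∑ j, a i j * v i j t := by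
    intro t
    have h := hcut {i | t < α i} {j | -β j < t}
    have h1 : ∑ i, u i t = (({i | t < α i} : Finset (Fin n)).card : ℝ) := by
      simp [hu, Set.indicator_apply]
    have h2 : ∑ j, w j t = (({j | -β j < t} : Finset (Fin n)).card : ℝ) := by
      simp [hw, Set.indicator_apply]
    have h3 : ∑ i, ∑ j, a i j * v i j t =
        ∑ i ∈ ({i | t < α i} : Finset (Fin n)), ∑ j ∈ ({j | -β j < t} : Finset (Fin n)), a i j := by
      rw [Finset.sum_filter]
      refine Finset.sum_congr rfl fun i _ => ?_
      split_ifs with hi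
      · rw [Finset.sum_filter]
        refine Finset.sum_congr rfl fun j _ => ?_
        simp [hv, Set.indicator_apply, hi]
      · simp [hv, hi]
    rw [h1, h2, h3]
    exact h
  have hisum : Integrable (fun t => ∑ i, u i t + ∑ j, w j t) ν :=
    (integrable_finsetSum _ fun i _ => hiu i).add (integrable_finsetSum _ fun j _ => hiw j)
  have hL : ∫ t, r * (∑ i, u i t + ∑ j, w j t - n) ∂ν = r * (∑ i, α i + ∑ j, β j) := by
    have hconst : ∫ _t : ℝ, (n : ℝ) ∂ν = 2 * M * n := by
      rw [integral_const, hν, measureReal_restrict_apply MeasurableSet.univ, Set.univ_inter,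
        Real.volume_real_Ioc_of_le (by linarith), smul_eq_mul]
      ring
    rw [integral_const_mul, integral_sub hisum (integrable_const _),
      integral_add (integrable_finsetSum _ fun i _ => hiu i)
        (integrable_finsetSum _ fun j _ => hiw j),
      integral_finsetSum _ (fun i _ => hiu i), integral_finsetSum _ (fun j _ => hiw j), hconst]
    simp_rw [hIu, hIw, Finset.sum_add_distrib]
    simp only [Finset.sum_const, Finset.card_univ, Fintype.card_fin, nsmul_eq_mul]
    ring
  have hR : ∫ t, ∑ i, ∑ j, a i j * v i j t ∂ν = ∑ i, ∑ j, a i j * max 0 (α i + β j) := by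
    rw [integral_finsetSum _ fun i _ =>
      integrable_finsetSum _ fun j _ => (hiv i j).const_mul (a i j)]
    refine Finset.sum_congr rfl fun i _ => ?_
    rw [integral_finsetSum _ fun j _ => (hiv i j).const_mul (a i j)]
    refine Finset.sum_congr rfl fun j _ => ?_
    rw [integral_const_mul, hIv]
  rw [← hL, ← hR]
  refine integral_mono ((hisum.sub (integrable_const _)).const_mul r) ?_ hpt
  exact integrable_finsetSum _ fun i _ =>
    integrable_finsetSum _ fun j _ => (hiv i j).const_mul (a i j)

lemma capacity_of_cut_condition {a : Matrix (Fin n) (Fin n) ℝ} (ha : ∀ i j, 0 ≤ a i j) {r : ℝ}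
    (hr : 0 < r) (hcut : ∀ U W : Finset (Fin n),
      r * ((U.card : ℝ) + W.card - n) ≤ ∑ i ∈ U, ∑ j ∈ W, a i j)
    (x : Fin n → ℝ) (hx : ∀ i, 0 < x i) :
    r ^ n * ∏ i, x i ≤ ∏ i, ∑ j, a i j * x j := by
  set s : Fin n → ℝ := fun i => ∑ j, a i j * x j with hs
  have hspos : ∀ i, 0 < s i := by
    intro i
    have hrow : 0 < ∑ j, a i j := by
      have h := hcut {i} Finset.univ
      simp only [Finset.card_singleton, Finset.card_univ, Fintype.card_fin, Finset.sum_singleton]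
        at h
      push_cast at h
      linarith
    obtain ⟨j, _, hj⟩ := Finset.exists_lt_of_sum_lt (f := fun _ => (0 : ℝ)) (by simpa using hrow)
    exact Finset.sum_pos' (fun l _ => mul_nonneg (ha i l) (hx l).le)
      ⟨j, Finset.mem_univ j, mul_pos hj (hx j)⟩
  have h := cut_condition_weighted hcut (fun i => Real.log (r / s i) + 1) fun j => Real.log (x j)
  have hle : ∑ i, ∑ j, a i j * max 0 (Real.log (r / s i) + 1 + Real.log (x j)) ≤ r * n := by
    have hrow : ∀ i, ∑ j, a i j * max 0 (Real.log (r / s i) + 1 + Real.log (x j)) ≤ r := by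
      intro i
      have hpos : 0 < r / s i := div_pos hr (hspos i)
      calc _ ≤ ∑ j, a i j * (r / s i * x j) := by
            refine Finset.sum_le_sum fun j _ => mul_le_mul_of_nonneg_left ?_ (ha i j)
            have hmul := mul_pos hpos (hx j)
            refine max_le hmul.le ?_
            have hlog := Real.log_le_sub_one_of_pos hmul
            rw [Real.log_mul hpos.ne' (hx j).ne'] at hlog
            linarith
        _ = r / s i * s i := by
            rw [hs, Finset.mul_sum]
            exact Finset.sum_congr rfl fun j _ => by ring
        _ = r := div_mul_cancel₀ r (hspos i).ne'
    calc _ ≤ ∑ _i : Fin n, r := Finset.sum_le_sum fun i _ => hrow i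
      _ = r * n := by simp [mul_comm]
  have hsum : ∑ i, Real.log (r / s i) + ∑ j, Real.log (x j) ≤ 0 := by
    have h' := h.trans hle
    rw [Finset.sum_add_distrib] at h'
    simp only [Finset.sum_const, Finset.card_univ, Fintype.card_fin, nsmul_eq_mul, mul_one] at h'
    have := le_of_mul_le_mul_left h' hr
    linarith
  rw [← Real.log_prod (fun i _ => (div_pos hr (hspos i)).ne'),
    ← Real.log_prod (fun j _ => (hx j).ne')] at hsum
  have hpx : 0 < ∏ j, x j := Finset.prod_pos fun j _ => hx j
  have hps : 0 < ∏ i, s i := Finset.prod_pos fun i _ => hspos i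
  have hpr : 0 < ∏ i, r / s i := Finset.prod_pos fun i _ => div_pos hr (hspos i)
  rw [← Real.log_mul hpr.ne' hpx.ne', Real.log_nonpos_iff (mul_pos hpr hpx).le,
    Finset.prod_div_distrib, Finset.prod_const, Finset.card_univ, Fintype.card_fin,
    div_mul_eq_mul_div, div_le_one hps] at hsum
  exact hsum

/-- If every `U × W` submatrix of a nonnegative matrix has weight at least `r (|U| + |W| - n)`,
then the permanent is at least `(r / e) ^ n`. -/
theorem permanent_ge_of_cut_condition {a : Matrix (Fin n) (Fin n) ℝ} (ha : ∀ i j, 0 ≤ a i j)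
    {r : ℝ} (hr : 0 < r) (hcut : ∀ U W : Finset (Fin n),
      r * ((U.card : ℝ) + W.card - n) ≤ ∑ i ∈ U, ∑ j ∈ W, a i j) :
    (r / Real.exp 1) ^ n ≤ a.permanent := by
  have h := capacity_le_permanent ha (pow_nonneg hr.le n) (capacity_of_cut_condition ha hr hcut)
  rwa [Real.exp_neg, ← div_eq_mul_inv, ← mul_one (n : ℝ), Real.exp_nat_mul, ← div_pow] at h

end Permanent

section Pseudorandom

lemma sqrt_mul_le_half_add {x y : ℝ} (hx : 0 ≤ x) (hy : 0 ≤ y) : √(x * y) ≤ (x + y) / 2 := by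
  rw [Real.sqrt_le_left (by positivity)]
  nlinarith [sq_nonneg (x - y)]

lemma cut_bound_of_almost_full {n u w d lamb e : ℝ} (hn : 0 < n) (hu : u ≤ n) (hw : 0 ≤ w)
    (hlamb : 0 < lamb) (hd : 4096 * lamb ≤ d) (hw' : w ≤ n / 3)
    (he : (d - lamb) * w - (d / n * (n - u) * w + lamb * √((n - u) * w)) ≤ e) :
    (d - 4 * lamb) * (u + w - n) ≤ e := by
  refine le_trans ?_ he
  have hsqrt := sqrt_mul_le_half_add (sub_nonneg.2 hu) hw
  have hmul := mul_le_mul_of_nonneg_left hsqrt hlamb.le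
  have hwn : w / n ≤ 1 / 3 := by
    rw [div_le_iff₀ hn]
    linarith
  have hda : 0 ≤ d * (n - u) := mul_nonneg (by linarith) (sub_nonneg.2 hu)
  have h1 : d / n * (n - u) * w ≤ d * (n - u) / 3 := by
    calc d / n * (n - u) * w = d * (n - u) * (w / n) := by ring
      _ ≤ d * (n - u) * (1 / 3) := mul_le_mul_of_nonneg_left hwn hda
      _ = _ := by ring
  have h2 : 4096 * lamb * (n - u) ≤ d * (n - u) :=
    mul_le_mul_of_nonneg_right hd (sub_nonneg.2 hu)
  have h3 : 0 ≤ lamb * (n - u) := mul_nonneg hlamb.le (sub_nonneg.2 hu)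
  have h4 : 0 ≤ lamb * w := mul_nonneg hlamb.le hw
  linarith

lemma cut_bound_of_spread {n u w d lamb e : ℝ} (hn : 0 < n) (hu0 : 0 ≤ u) (hu : u ≤ n)
    (hw0 : 0 ≤ w) (hw : w ≤ n) (hlamb : 0 < lamb) (hd : 4096 * lamb ≤ d) (huw : n ≤ u + w)
    (hcase : n / 4 ≤ u + w - n ∨ (n / 64 ≤ n - u ∧ n / 64 ≤ n - w))
    (he : d / n * u * w - lamb * √(u * w) ≤ e) :
    (d - 4 * lamb) * (u + w - n) ≤ e := by
  refine le_trans ?_ he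
  have hmul := mul_le_mul_of_nonneg_left (sqrt_mul_le_half_add hu0 hw0) hlamb.le
  have hmul' : lamb * ((u + w) / 2) ≤ lamb * n :=
    mul_le_mul_of_nonneg_left (by linarith) hlamb.le
  have hexpand : d / n * u * w = d * (u + w - n) + d / n * ((n - u) * (n - w)) := by
    field_simp
    ring
  have hd0 : 0 ≤ d / n := div_nonneg (by linarith) hn.le
  have hab : 0 ≤ (n - u) * (n - w) := mul_nonneg (sub_nonneg.2 hu) (sub_nonneg.2 hw)
  rcases hcase with h | ⟨ha, hb⟩
  · have h1 := mul_le_mul_of_nonneg_left h hlamb.le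
    have h2 := mul_nonneg hd0 hab
    linarith
  · have h1 : n / 64 * (n / 64) ≤ (n - u) * (n - w) :=
      mul_le_mul ha hb (by positivity) (by linarith)
    have h2 : d / n * (n / 64 * (n / 64)) ≤ d / n * ((n - u) * (n - w)) :=
      mul_le_mul_of_nonneg_left h1 hd0
    have h3 : d / n * (n / 64 * (n / 64)) = d * n / 4096 := by
      field_simp
      norm_num
    have h4 := mul_le_mul_of_nonneg_right hd hn.le
    have h5 : 0 ≤ lamb * (u + w - n) := mul_nonneg hlamb.le (by linarith)
    linarith

lemma cut_condition_of_pseudorandom {n : ℕ} {a : Matrix (Fin n) (Fin n) ℝ}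
    (ha : ∀ i j, 0 ≤ a i j) {d lamb : ℝ} (hlamb : 0 < lamb) (hd : 4096 * lamb ≤ d)
    (hrow : ∀ i, d - lamb ≤ ∑ j, a i j) (hcol : ∀ j, d - lamb ≤ ∑ i, a i j)
    (hdisc : ∀ U W : Finset (Fin n),
      |∑ i ∈ U, ∑ j ∈ W, a i j - d / n * U.card * W.card| ≤ lamb * √((U.card : ℝ) * W.card))
    (U W : Finset (Fin n)) :
    (d - 4 * lamb) * ((U.card : ℝ) + W.card - n) ≤ ∑ i ∈ U, ∑ j ∈ W, a i j := by
  have hnonneg : 0 ≤ ∑ i ∈ U, ∑ j ∈ W, a i j :=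
    Finset.sum_nonneg fun i _ => Finset.sum_nonneg fun j _ => ha i j
  have hcard : ∀ S : Finset (Fin n), (S.card : ℝ) ≤ n := fun S => by
    exact_mod_cast (Finset.card_le_univ S).trans_eq (Fintype.card_fin n)
  have hcompl : ∀ S : Finset (Fin n), (Sᶜ.card : ℝ) = n - S.card := fun S => by
    have h := Finset.card_add_card_compl S
    rw [Fintype.card_fin] at h
    have h' : (S.card : ℝ) + Sᶜ.card = n := by exact_mod_cast h
    linarith
  rcases le_or_gt ((U.card : ℝ) + W.card) n with huw | huw
  · exact (mul_nonpos_of_nonneg_of_nonpos (by linarith) (by linarith)).trans hnonneg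
  have hU := hcard U
  have hW := hcard W
  have hn : (0 : ℝ) < n := by
    rcases (Nat.cast_nonneg (α := ℝ) n).lt_or_eq with h | h
    · exact h
    · linarith
  have hU0 : (0 : ℝ) ≤ U.card := Nat.cast_nonneg _
  have hW0 : (0 : ℝ) ≤ W.card := Nat.cast_nonneg _
  by_cases hcase : (n : ℝ) / 4 ≤ U.card + W.card - n ∨
      ((n : ℝ) / 64 ≤ n - U.card ∧ (n : ℝ) / 64 ≤ n - W.card)
  · exact cut_bound_of_spread hn hU0 hU hW0 hW hlamb hd huw.le hcase
      (by linarith [(abs_le.1 (hdisc U W)).1])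
  push Not at hcase
  obtain ⟨h1, h2⟩ := hcase
  rcases le_or_gt ((n : ℝ) / 64) (n - U.card) with h | h
  · have hsplit : ∑ i ∈ U, ∑ j ∈ W, a i j + ∑ i ∈ U, ∑ j ∈ Wᶜ, a i j = ∑ i ∈ U, ∑ j, a i j := by
      rw [← Finset.sum_add_distrib]
      exact Finset.sum_congr rfl fun i _ => Finset.sum_add_sum_compl W _
    have htot : (d - lamb) * U.card ≤ ∑ i ∈ U, ∑ j, a i j := by
      rw [mul_comm, ← nsmul_eq_mul]
      exact Finset.card_nsmul_le_sum _ _ _ fun i _ => hrow i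
    have hdW := (abs_le.1 (hdisc U Wᶜ)).2
    rw [hcompl, mul_comm (U.card : ℝ), mul_right_comm] at hdW
    have := cut_bound_of_almost_full (e := ∑ i ∈ U, ∑ j ∈ W, a i j) hn hW hU0 hlamb hd
      (by linarith [h2 h]) (by linarith)
    linarith
  · have hsplit : ∑ i ∈ U, ∑ j ∈ W, a i j + ∑ i ∈ Uᶜ, ∑ j ∈ W, a i j = ∑ i, ∑ j ∈ W, a i j :=
      Finset.sum_add_sum_compl U _
    have htot : (d - lamb) * W.card ≤ ∑ i, ∑ j ∈ W, a i j := by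
      rw [Finset.sum_comm (f := fun i j => a i j), mul_comm, ← nsmul_eq_mul]
      exact Finset.card_nsmul_le_sum _ _ _ fun j _ => hcol j
    have hdU := (abs_le.1 (hdisc Uᶜ W)).2
    rw [hcompl] at hdU
    exact cut_bound_of_almost_full hn hU hW0 hlamb hd (by linarith) (by linarith)

end Pseudorandom

section Graph

variable {n : ℕ} (G : SimpleGraph (Fin n))

lemma adjMat_nonneg (i j : Fin n) : 0 ≤ adjMat G i j := by
  simp only [adjMat, Matrix.of_apply]
  split_ifs <;> norm_num

lemma adjMat_comm (i j : Fin n) : adjMat G i j = adjMat G j i := by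
  have h := G.adj_comm i j
  by_cases hij : G.Adj i j
  · simp [adjMat, hij, h.1 hij]
  · simp [adjMat, hij, mt h.2 hij]

lemma degOf_eq_sum (v : Fin n) : (degOf G v : ℝ) = ∑ j, adjMat G v j := by
  classical
  have h : G.neighborSet v = (Finset.univ.filter fun j => G.Adj v j : Finset (Fin n)) := by
    ext j
    simp
  rw [degOf, h, Set.ncard_coe_finset, Finset.card_filter]
  push_cast
  exact Finset.sum_congr rfl fun j _ => by simp [adjMat]

lemma ePairs_eq_sum (U W : Finset (Fin n)) :
    (ePairs G U W : ℝ) = ∑ i ∈ U, ∑ j ∈ W, adjMat G i j := by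
  classical
  have h : {p : Fin n × Fin n | p.1 ∈ (U : Set (Fin n)) ∧ p.2 ∈ (W : Set (Fin n)) ∧
      G.Adj p.1 p.2} = ((U ×ˢ W).filter fun p => G.Adj p.1 p.2 : Finset (Fin n × Fin n)) := by
    ext p
    simp [and_assoc]
  rw [ePairs, h, Set.ncard_coe_finset, Finset.card_filter, Finset.sum_product]
  push_cast
  exact Finset.sum_congr rfl fun i _ => Finset.sum_congr rfl fun j _ => by simp [adjMat]

lemma degOf_le_maxDeg (v : Fin n) : degOf G v ≤ maxDeg G :=
  le_csSup (Set.finite_range _).bddAbove ⟨v, rfl⟩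

lemma minDeg_le_degOf (v : Fin n) : minDeg G ≤ degOf G v := Nat.sInf_le ⟨v, rfl⟩

lemma degOf_le (v : Fin n) : degOf G v ≤ n := by
  have h := Set.ncard_le_ncard (Set.subset_univ (G.neighborSet v))
  simpa [degOf, Set.ncard_univ] using h

lemma maxDeg_le : maxDeg G ≤ n := by
  rcases Nat.eq_zero_or_pos n with rfl | hn
  · simp [maxDeg]
  · have : Nonempty (Fin n) := ⟨⟨0, hn⟩⟩
    exact csSup_le (Set.range_nonempty _) (by rintro _ ⟨v, rfl⟩; exact degOf_le G v)

variable {G}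

lemma avgDeg_le_maxDeg (hn : 0 < n) : avgDeg G ≤ maxDeg G := by
  rw [avgDeg, div_le_iff₀ (by exact_mod_cast hn)]
  calc _ ≤ ∑ _v : Fin n, (maxDeg G : ℝ) :=
        Finset.sum_le_sum fun v _ => by exact_mod_cast degOf_le_maxDeg G v
    _ = _ := by simp [mul_comm]

lemma exists_adj_of_avgDeg_pos (h : 0 < avgDeg G) : ∃ u v, G.Adj u v := by
  by_contra! hno
  have : avgDeg G = 0 := by simp [avgDeg, degOf_eq_sum, adjMat, hno]
  linarith

lemma two_le_maxDeg (hn : 3 ≤ n) {lamb : ℝ} (hd : 4096 * lamb ≤ avgDeg G) (hd0 : 0 < avgDeg G)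
    (hdisc : ∀ U W : Finset (Fin n),
      |∑ i ∈ U, ∑ j ∈ W, adjMat G i j - avgDeg G / n * U.card * W.card| ≤
        lamb * √((U.card : ℝ) * W.card)) : 2 ≤ maxDeg G := by
  by_contra! hlt
  have h1 : (maxDeg G : ℝ) ≤ 1 := by exact_mod_cast Nat.lt_succ_iff.1 hlt
  have h2 := avgDeg_le_maxDeg (G := G) (by omega)
  have hn' : (3 : ℝ) ≤ n := by exact_mod_cast hn
  obtain ⟨u, v, huv⟩ := exists_adj_of_avgDeg_pos hd0
  have h := (abs_le.1 (hdisc {u} {v})).2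
  simp only [Finset.sum_singleton, Finset.card_singleton, Nat.cast_one, mul_one, Real.sqrt_one]
    at h
  have hadj : adjMat G u v = 1 := by simp [adjMat, huv]
  have h3 : avgDeg G / n ≤ 1 / 3 := by
    rw [div_le_iff₀ (by linarith)]
    linarith
  linarith

end Graph

lemma exp_neg_two_mul_le {x : ℝ} (hx0 : 0 ≤ x) (hx : x ≤ 1 / 2) :
    Real.exp (-(2 * x)) ≤ 1 - x := by
  have h := Real.add_one_le_exp (2 * x)
  rw [Real.exp_neg, inv_le_comm₀ (Real.exp_pos _) (by linarith)]
  refine le_trans ?_ h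
  rw [inv_le_iff_one_le_mul₀ (by linarith)]
  nlinarith

lemma mul_exp_le_of_relative_error {D r lamb L l : ℝ} (hD : 0 ≤ D) (hL : 1 ≤ L) (hl : 0 < l)
    (hlL : l ≤ L) (hK : 4096 * lamb * L ^ 2 ≤ D) (hr : D - 5 * lamb ≤ r) :
    D * Real.exp (-20 / l ^ 2) ≤ r := by
  have hL2 : 1 ≤ L ^ 2 := one_le_pow₀ hL
  have hx : 5 / (4096 * L ^ 2) ≤ 1 / 2 := by
    rw [div_le_iff₀ (by positivity)]
    linarith
  have h1 := exp_neg_two_mul_le (by positivity) hx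
  have h2 : -20 / l ^ 2 ≤ -(2 * (5 / (4096 * L ^ 2))) := by
    have hsq : 20 / L ^ 2 ≤ 20 / l ^ 2 := by gcongr
    have h3 : 2 * (5 / (4096 * L ^ 2)) ≤ 20 / L ^ 2 := by
      rw [← mul_div_assoc, div_le_div_iff₀ (by positivity) (by positivity)]
      nlinarith
    rw [neg_div]
    linarith
  have h4 : D * (5 / (4096 * L ^ 2)) ≥ 5 * lamb := by
    rw [ge_iff_le, ← mul_div_assoc, le_div_iff₀ (by positivity)]
    linarith
  calc D * Real.exp (-20 / l ^ 2) ≤ D * (1 - 5 / (4096 * L ^ 2)) :=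
        mul_le_mul_of_nonneg_left ((Real.exp_le_exp.2 h2).trans h1) hD
    _ ≤ r := by linarith

/-- Permanent lower bound: if the edge distribution is controlled by `λ̄`, `Δ - δ ≤ λ̄` and
`d ≥ K λ̄ (log n)²`, then `per(A) ≥ (Δ/e)^n e^{-20n/(log Δ)²}`. -/
theorem adjMat_permanent_lower :
    ∃ c : ℝ, 0 < c ∧ ∃ K : ℝ, 0 < K ∧ ∃ n₀ : ℕ, ∀ n : ℕ, n₀ ≤ n →
    ∀ (G : SimpleGraph (Fin n)) (lamb : ℝ), 0 < lamb →
    (∀ U W : Set (Fin n),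
      |(ePairs G U W : ℝ) - avgDeg G / n * U.ncard * W.ncard| ≤
        lamb * Real.sqrt ((U.ncard : ℝ) * W.ncard)) →
    (maxDeg G : ℝ) - (minDeg G : ℝ) ≤ lamb →
    avgDeg G ≥ K * lamb * (Real.log n) ^ 2 →
    (adjMat G).permanent ≥
      ((maxDeg G : ℝ) / Real.exp 1) ^ n * Real.exp (-(20 * n) / (Real.log (maxDeg G)) ^ 2) := by
  refine ⟨1, one_pos, 4096, by norm_num, 3, ?_⟩
  intro n hn G lamb hlamb hset hdeg havg
  have hn' : (3 : ℝ) ≤ n := by exact_mod_cast hn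
  have hL : 1 ≤ Real.log n := by
    rw [Real.le_log_iff_exp_le (by linarith)]
    linarith [Real.exp_one_lt_three]
  have hdisc : ∀ U W : Finset (Fin n),
      |∑ i ∈ U, ∑ j ∈ W, adjMat G i j - avgDeg G / n * U.card * W.card| ≤
        lamb * √((U.card : ℝ) * W.card) := by
    intro U W
    have h := hset U W
    rwa [ePairs_eq_sum, Set.ncard_coe_finset, Set.ncard_coe_finset] at h
  have hd : 4096 * lamb ≤ avgDeg G :=
    (le_mul_of_one_le_right (by positivity) (one_le_pow₀ hL)).trans havg
  have hmax := avgDeg_le_maxDeg (G := G) (by omega)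
  have hmax2 : 2 ≤ maxDeg G := two_le_maxDeg hn hd (by linarith) hdisc
  have hmax2' : (2 : ℝ) ≤ maxDeg G := by exact_mod_cast hmax2
  have hrow : ∀ i, avgDeg G - lamb ≤ ∑ j, adjMat G i j := by
    intro i
    rw [← degOf_eq_sum]
    have : (minDeg G : ℝ) ≤ degOf G i := by exact_mod_cast minDeg_le_degOf G i
    linarith
  have hcol : ∀ j, avgDeg G - lamb ≤ ∑ i, adjMat G i j := by
    intro j
    simpa only [adjMat_comm G _ j] using hrow j
  have hminavg : (minDeg G : ℝ) ≤ avgDeg G := by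
    rw [avgDeg, le_div_iff₀ (by linarith)]
    calc (minDeg G : ℝ) * n = ∑ _v : Fin n, (minDeg G : ℝ) := by simp [mul_comm]
      _ ≤ _ := Finset.sum_le_sum fun v _ => by exact_mod_cast minDeg_le_degOf G v
  have hper := permanent_ge_of_cut_condition (adjMat_nonneg G)
    (r := avgDeg G - 4 * lamb) (by linarith)
    (cut_condition_of_pseudorandom (adjMat_nonneg G) hlamb hd hrow hcol hdisc)
  refine ge_iff_le.2 (le_trans ?_ hper)
  have hfactor := mul_exp_le_of_relative_error (D := maxDeg G) (r := avgDeg G - 4 * lamb)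
    (l := Real.log (maxDeg G)) (by linarith) hL (Real.log_pos (by linarith))
    (Real.log_le_log (by linarith) (by exact_mod_cast maxDeg_le G)) (havg.le.trans hmax)
    (by linarith)
  have hexp : Real.exp (-(20 * n) / Real.log (maxDeg G) ^ 2) =
      Real.exp (-20 / Real.log (maxDeg G) ^ 2) ^ n := by
    rw [← Real.exp_nat_mul]
    congr 1
    ring
  rw [hexp, ← mul_pow, div_mul_eq_mul_div]
  gcongr
end
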